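/- Let K be a number field, φ ∈ K(x) of degree d ≥ 2 and α ∈ K not exceptional for φ. If the Galois group G_∞(φ,α) of the field generated by the backward orbit of α is abelian, then φ is post-critically finite. -/

import Mathlib

open Polynomial IntermediateField
open scoped Classical

/-- The self-map of `ℙ¹ = OnePoint F` induced by the rational function `p/q`. -/
noncomputable def onePointMap {F : Type*} [Field F] (p q : Polynomial F) :
    OnePoint F → OnePoint F := fun x =>
  Option.elim x
    (if q.natDegree < p.natDegree then OnePoint.infty
     else OnePoint.some (p.coeff (max p.natDegree q.natDegree) /
            q.coeff (max p.natDegree q.natDegree)))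
    (fun z => if q.eval z = 0 then OnePoint.infty else OnePoint.some (p.eval z / q.eval z))

/-- The backward orbit of `α` under the rational function `p/q`. -/
noncomputable def backOrbit {F : Type*} [Field F] (p q : Polynomial F) (α : F) : Set F :=
  {γ : F | ∃ n : ℕ, 1 ≤ n ∧ (onePointMap p q)^[n] (OnePoint.some γ) = OnePoint.some α}

/-- `p/q` (with `p, q` coprime) is post-critically finite: every affine critical point
(i.e. zero of the Wronskian `p'q − pq'`, which detects ramification also at poles) has
finite forward orbit in `ℙ¹`, and if `∞` is a critical point (detected by the Wronskian of
`φ(1/x)`, whose numerator and denominator are the degree-`d` reflections of `p` and `q`),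
then `∞` also has finite forward orbit. -/
noncomputable def IsPCF {F : Type*} [Field F] (p q : Polynomial F) : Prop :=
  (∀ c : F, (derivative p * q - p * derivative q).eval c = 0 →
      (Set.range (fun n : ℕ => (onePointMap p q)^[n] (OnePoint.some c))).Finite) ∧
  (((derivative (p.reflect (max p.natDegree q.natDegree)) *
        q.reflect (max p.natDegree q.natDegree) -
      p.reflect (max p.natDegree q.natDegree) *
        derivative (q.reflect (max p.natDegree q.natDegree))).eval 0 = 0) →
    (Set.range (fun n : ℕ => (onePointMap p q)^[n] OnePoint.infty)).Finite)

namespace ArbPCF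
section M1
set_option linter.unusedSectionVars false
variable {k : Type*} [Field k]

noncomputable def phi (p q : k[X]) (x : k) : k := p.eval x / q.eval x

def Lev (p q : k[X]) (a : k) : ℕ → Set k
  | 0 => {a}
  | n + 1 => {x | q.eval x ≠ 0 ∧ phi p q x ∈ Lev p q a n}

noncomputable def Wr (p q : k[X]) : k[X] := derivative p * q - p * derivative q

/-- Standing assumptions on the pair `p, q`. -/
structure Good (p q : k[X]) : Prop where
  monic : p.Monic
  two_le : 2 ≤ p.natDegree
  lt : q.natDegree < p.natDegree
  cop : IsCoprime p q

variable {p q : k[X]} {a : k}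

lemma Lev_succ (n : ℕ) (x : k) :
    x ∈ Lev p q a (n+1) ↔ q.eval x ≠ 0 ∧ phi p q x ∈ Lev p q a n := Iff.rfl

lemma mem_Lev_zero (x : k) : x ∈ Lev p q a 0 ↔ x = a := Iff.rfl

lemma mem_Lev_iff (n : ℕ) : ∀ x : k, x ∈ Lev p q a n ↔
    (∀ i < n, q.eval ((phi p q)^[i] x) ≠ 0) ∧ (phi p q)^[n] x = a := by
  induction n with
  | zero => intro x; simp [mem_Lev_zero]
  | succ n ih =>
    intro x
    rw [Lev_succ, ih, Function.iterate_succ_apply]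
    constructor
    · rintro ⟨h0, h1, h2⟩
      refine ⟨?_, h2⟩
      intro i hi
      rcases i with _ | i
      · simpa using h0
      · rw [Function.iterate_succ_apply]; exact h1 i (by omega)
    · rintro ⟨h1, h2⟩
      refine ⟨by simpa using h1 0 (by omega), ?_, h2⟩
      intro i hi
      have := h1 (i+1) (by omega)
      rwa [Function.iterate_succ_apply] at this

lemma Lev_iter {m n : ℕ} {x : k} (hx : x ∈ Lev p q a (m + n)) :
    (phi p q)^[n] x ∈ Lev p q a m := by
  induction n generalizing x with
  | zero => simpa using hx
  | succ n ih =>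
    rw [Function.iterate_succ_apply]
    exact ih hx.2

lemma Lev_trans {m n : ℕ} {b x : k} (hb : b ∈ Lev p q a m) (hx : x ∈ Lev p q b n) :
    x ∈ Lev p q a (m + n) := by
  induction n generalizing x with
  | zero => rw [mem_Lev_zero] at hx; subst hx; simpa using hb
  | succ n ih => exact ⟨hx.1, ih hx.2⟩

lemma Lev_split {m n : ℕ} {x : k} (hx : x ∈ Lev p q a (m + n)) :
    x ∈ Lev p q ((phi p q)^[n] x) n := by
  rw [mem_Lev_iff] at hx ⊢
  exact ⟨fun i hi => hx.1 i (by omega), rfl⟩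

namespace Good
variable (h : Good p q)
include h

lemma q_ne : q ≠ 0 := by
  rintro rfl
  have h1 := h.cop
  rw [isCoprime_zero_right] at h1
  have := natDegree_eq_zero_of_isUnit h1
  have := h.two_le
  omega

lemma q_eval_ne {x t : k} (hx : p.eval x = t * q.eval x) : q.eval x ≠ 0 := by
  intro h0
  obtain ⟨u, v, huv⟩ := h.cop
  have := congrArg (eval x) huv
  simp [hx, h0] at this

lemma phi_eq_iff {x t : k} : (q.eval x ≠ 0 ∧ phi p q x = t) ↔ p.eval x = t * q.eval x := by
  constructor
  · rintro ⟨h0, rfl⟩; rw [phi, div_mul_cancel₀ _ h0]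
  · intro hx
    have h0 := h.q_eval_ne hx
    exact ⟨h0, by rw [phi, hx, mul_div_cancel_right₀ _ h0]⟩

lemma Lev_succ' (n : ℕ) (x : k) :
    x ∈ Lev p q a (n+1) ↔ ∃ t ∈ Lev p q a n, p.eval x = t * q.eval x := by
  rw [Lev_succ]
  constructor
  · rintro ⟨h0, h1⟩; exact ⟨_, h1, (h.phi_eq_iff.1 ⟨h0, rfl⟩)⟩
  · rintro ⟨t, ht, hx⟩
    obtain ⟨h0, rfl⟩ := h.phi_eq_iff.2 hx
    exact ⟨h0, ht⟩

lemma degq (t : k) : (C t * q).degree < p.degree := by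
  refine lt_of_le_of_lt ?_ (degree_lt_degree h.lt)
  by_cases ht : t = 0
  · simp [ht]
  · rw [degree_C_mul ht]

lemma fib_monic (t : k) : (p - C t * q).Monic := h.monic.sub_of_left (h.degq t)

lemma fib_natDegree (t : k) : (p - C t * q).natDegree = p.natDegree := by
  apply natDegree_eq_of_degree_eq
  exact degree_sub_eq_left_of_degree_lt (h.degq t)

lemma fib_ne (t : k) : p - C t * q ≠ 0 := (h.fib_monic t).ne_zero

lemma mem_fib {t x : k} : x ∈ (p - C t * q).roots ↔ p.eval x = t * q.eval x := by
  rw [mem_roots (h.fib_ne t)]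
  simp [IsRoot.def, sub_eq_zero]

lemma mem_fib' {t x : k} : x ∈ (p - C t * q).roots ↔ q.eval x ≠ 0 ∧ phi p q x = t := by
  rw [h.mem_fib, h.phi_eq_iff]

lemma Lev_finite (n : ℕ) : (Lev p q a n).Finite := by
  induction n with
  | zero => exact Set.finite_singleton a
  | succ n ih =>
    refine (ih.biUnion (fun t _ => (p - C t * q).roots.toFinset.finite_toSet)).subset ?_
    intro x hx
    rw [h.Lev_succ'] at hx
    obtain ⟨t, ht, hx⟩ := hx
    simp only [Set.mem_iUnion]
    exact ⟨t, ht, by simpa using (h.mem_fib.2 hx)⟩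

lemma exists_pre [IsAlgClosed k] (t : k) : ∃ x, p.eval x = t * q.eval x := by
  have : (p - C t * q).degree ≠ 0 := by
    rw [degree_eq_natDegree (h.fib_ne t), h.fib_natDegree]
    have := h.two_le
    norm_cast; omega
  obtain ⟨x, hx⟩ := IsAlgClosed.exists_root _ this
  exact ⟨x, by simpa [sub_eq_zero] using hx⟩

lemma Lev_nonempty [IsAlgClosed k] (n : ℕ) : (Lev p q a n).Nonempty := by
  induction n with
  | zero => exact ⟨a, rfl⟩
  | succ n ih =>
    obtain ⟨t, ht⟩ := ih
    obtain ⟨x, hx⟩ := h.exists_pre t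
    exact ⟨x, (h.Lev_succ' n x).2 ⟨t, ht, hx⟩⟩

lemma Wr_ne [CharZero k] : Wr p q ≠ 0 := by
  intro h0
  have h1 : p ∣ derivative p * q := ⟨derivative q, by rw [Wr, sub_eq_zero] at h0; exact h0⟩
  have h2 := h.cop.dvd_of_dvd_mul_right h1
  have h3 : derivative p = 0 := eq_zero_of_dvd_of_degree_lt h2 (degree_derivative_lt h.monic.ne_zero)
  have := derivative_eq_zero.1 h3
  have := h.two_le
  omega

lemma Wr_natDegree : (Wr p q).natDegree ≤ 2 * p.natDegree - 2 := by
  have := h.two_le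
  have := h.lt
  have h1 := natDegree_derivative_le p
  have h2 := natDegree_derivative_le q
  refine (natDegree_sub_le _ _).trans (max_le ?_ ?_)
  · refine natDegree_mul_le.trans ?_; omega
  · refine natDegree_mul_le.trans ?_; omega

lemma Wr_eval {x t : k} (hx : p.eval x = t * q.eval x) :
    (Wr p q).eval x = (derivative (p - C t * q)).eval x * q.eval x := by
  simp [Wr, hx]; ring

lemma fib_nodup {t : k} (hW : ∀ x, p.eval x = t * q.eval x → (Wr p q).eval x ≠ 0) :
    (p - C t * q).roots.Nodup := by
  rw [Multiset.nodup_iff_count_le_one]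
  intro x
  rw [count_roots]
  by_contra hlt
  push Not at hlt
  have := (one_lt_rootMultiplicity_iff_isRoot (h.fib_ne t)).1 hlt
  have hx : p.eval x = t * q.eval x := by
    have := this.1; simpa [sub_eq_zero] using this
  apply hW x hx
  rw [h.Wr_eval hx, this.2.eq_zero, zero_mul]

lemma ncard_mono [IsAlgClosed k] (n : ℕ) : (Lev p q a n).ncard ≤ (Lev p q a (n+1)).ncard := by
  have : Lev p q a n ⊆ phi p q '' Lev p q a (n+1) := by
    intro t ht
    obtain ⟨x, hx⟩ := h.exists_pre t
    have := h.phi_eq_iff.2 hx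
    exact ⟨x, (h.Lev_succ' n x).2 ⟨t, ht, hx⟩, this.2⟩
  exact (Set.ncard_le_ncard this ((h.Lev_finite _).image _)).trans (Set.ncard_image_le (h.Lev_finite _))

lemma grow [IsAlgClosed k] [CharZero k] (hinf : (⋃ n, Lev p q a n).Infinite) (B : ℕ) :
    ∃ n, B ≤ (Lev p q a n).ncard := by
  by_contra hcon
  push Not at hcon
  have hmono : Monotone (fun n => (Lev p q a n).ncard) := monotone_nat_of_le_succ (h.ncard_mono)
  obtain ⟨n0, hn0⟩ : ∃ n0, ∀ n ≥ n0, (Lev p q a n).ncard = (Lev p q a n0).ncard := by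
    have hbdd : BddAbove (Set.range (fun n => (Lev p q a n).ncard)) :=
      ⟨B, by rintro _ ⟨n, rfl⟩; exact (hcon n).le⟩
    obtain ⟨n0, hn0⟩ := Nat.sSup_mem (Set.range_nonempty _) hbdd
    refine ⟨n0, fun n hn => le_antisymm ?_ (hmono hn)⟩
    have := le_csSup hbdd ⟨n, rfl⟩
    simp only at hn0
    rw [hn0]; exact this
  apply hinf
  have hsub : (⋃ n, Lev p q a n) ⊆ (⋃ n ∈ Finset.range (n0+1), Lev p q a n) ∪ (Wr p q).roots.toFinset := by
    intro x hx
    obtain ⟨n, hx⟩ := Set.mem_iUnion.1 hx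
    by_cases hn : n ≤ n0
    · left; simp only [Set.mem_iUnion]; exact ⟨n, by simpa using Nat.lt_succ_of_le hn, hx⟩
    · right
      obtain ⟨m, rfl⟩ : ∃ m, n = m + 1 := ⟨n-1, by omega⟩
      obtain ⟨t, ht, hxt⟩ := (h.Lev_succ' m x).1 hx
      simp only [Finset.mem_coe, Multiset.mem_toFinset]
      rw [mem_roots h.Wr_ne, IsRoot.def]
      by_contra hW
      have himg : phi p q '' Lev p q a (m+1) ⊆ Lev p q a m := by
        rintro _ ⟨y, hy, rfl⟩; exact hy.2
      have himg2 : Lev p q a m ⊆ phi p q '' Lev p q a (m+1) := by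
        intro t ht
        obtain ⟨x, hx⟩ := h.exists_pre t
        have := h.phi_eq_iff.2 hx
        exact ⟨x, (h.Lev_succ' m x).2 ⟨t, ht, hx⟩, this.2⟩
      have hinj : Set.InjOn (phi p q) (Lev p q a (m+1)) := by
        apply Set.injOn_of_ncard_image_eq _ (h.Lev_finite _)
        rw [Set.Subset.antisymm himg himg2, hn0 m (by omega), hn0 (m+1) (by omega)]
      have hall : ∀ y ∈ (p - C t * q).roots, y = x := by
        intro y hy
        have hy' := h.mem_fib.1 hy
        apply hinj ((h.Lev_succ' m y).2 ⟨t, ht, hy'⟩) hx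
        rw [(h.phi_eq_iff.2 hy').2, (h.phi_eq_iff.2 hxt).2]
      have hnd : (p - C t * q).roots.Nodup := by
        apply h.fib_nodup
        intro y hy
        rw [hall y (h.mem_fib.2 hy)]; exact hW
      have hcard : (p - C t * q).roots.card = p.natDegree := by
        rw [← h.fib_natDegree t]
        exact (splits_iff_card_roots.1 (IsAlgClosed.splits _))
      have hle : (p - C t * q).roots.card ≤ 1 := by
        have h1 : (p - C t * q).roots = Multiset.replicate (p - C t * q).roots.card x :=
          Multiset.eq_replicate_card.2 hall
        have h2 := Multiset.nodup_iff_count_le_one.1 hnd x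
        rw [h1, Multiset.count_replicate_self] at h2
        exact h2
      have := h.two_le
      omega
  refine Set.Finite.subset ?_ hsub
  refine Set.Finite.union ?_ (Finset.finite_toSet _)
  exact Set.Finite.biUnion (Finset.finite_toSet _) (fun n _ => h.Lev_finite n)

end Good
end M1
end ArbPCF

namespace ArbPCF
section M2a
set_option linter.unusedSectionVars false
set_option linter.style.haveILetI false
variable {k : Type*} [Field k]

structure TreeData (p q : k[X]) (T : ℕ → Set k) (Φ : k → k) : Prop where
  pre : ∀ n x, x ∈ T (n+1) ↔ ∃ t ∈ T n, p.eval x = t * q.eval x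
  ne : ∀ n, (T n).Nonempty
  disj : ∀ m n x, x ∈ T m → x ∈ T n → m = n
  mapsΦ : ∀ n x, x ∈ T n → Φ x ∈ T n
  commΦ : ∀ n x t, t ∈ T n → p.eval x = t * q.eval x → p.eval (Φ x) = Φ t * q.eval (Φ x)
  crit : ∀ n x, x ∈ T (n+1) → (Wr p q).eval x ≠ 0

def Van (T : ℕ → Set k) (Φ : k → k) (F : k[X][X]) : Prop :=
  ∃ n0, ∀ n ≥ n0, ∀ x ∈ T n, F.evalEval x (Φ x) = 0

lemma pdiv {R : Type*} [CommRing R] [IsDomain R] (G : R[X]) (hG : G ≠ 0) :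
    ∀ (n : ℕ) (F : R[X]), F.degree < n →
      ∃ (c : R) (Q S : R[X]), c ≠ 0 ∧ C c * F = Q * G + S ∧ S.degree < G.degree := by
  intro n
  induction n with
  | zero =>
    intro F hF
    have : F = 0 := by
      by_contra h
      rw [degree_eq_natDegree h] at hF
      norm_cast at hF
    exact ⟨1, 0, 0, one_ne_zero, by simp [this], by simpa [bot_lt_iff_ne_bot] using hG⟩
  | succ n ih =>
    intro F hF
    by_cases h : F.degree < G.degree
    · exact ⟨1, 0, F, one_ne_zero, by simp, h⟩
    push Not at h
    have hF0 : F ≠ 0 := by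
      rintro rfl
      simp at h; exact hG h
    have hlG : G.leadingCoeff ≠ 0 := leadingCoeff_ne_zero.2 hG
    have hlF : F.leadingCoeff ≠ 0 := leadingCoeff_ne_zero.2 hF0
    have hnd : G.natDegree ≤ F.natDegree := natDegree_le_natDegree h
    have h1 : (C G.leadingCoeff * F).degree = F.degree := degree_C_mul hlG
    have h2 : (C F.leadingCoeff * (X ^ (F.natDegree - G.natDegree) * G)).degree = F.degree := by
      rw [degree_C_mul hlF, degree_mul, degree_X_pow, degree_eq_natDegree hG, degree_eq_natDegree hF0]
      norm_cast; omega
    have h3 : (C G.leadingCoeff * F - C F.leadingCoeff * (X ^ (F.natDegree - G.natDegree) * G)).degree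
        < (n : WithBot ℕ) := by
      have := degree_sub_lt_left (h1.trans h2.symm) (by simp [hlG, hF0]) (by
        simp [leadingCoeff_mul, mul_comm])
      rw [h1] at this
      have h4 : F.degree ≤ n := by
        rw [degree_eq_natDegree hF0] at hF ⊢
        norm_cast at hF ⊢; omega
      exact lt_of_lt_of_le this h4
    obtain ⟨c, Q, S, hc, he, hS⟩ := ih _ h3
    refine ⟨c * G.leadingCoeff, Q + C c * (C F.leadingCoeff * X ^ (F.natDegree - G.natDegree)), S,
      mul_ne_zero hc hlG, ?_, hS⟩
    rw [C_mul]
    linear_combination he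

variable {p q : k[X]} {T : ℕ → Set k} {Φ : k → k}

namespace Van

lemma add {F G : k[X][X]} (hF : Van T Φ F) (hG : Van T Φ G) : Van T Φ (F + G) := by
  obtain ⟨a, ha⟩ := hF
  obtain ⟨b, hb⟩ := hG
  refine ⟨max a b, fun n hn x hx => ?_⟩
  rw [evalEval_add, ha n (le_trans (le_max_left _ _) hn) x hx,
    hb n (le_trans (le_max_right _ _) hn) x hx, add_zero]

lemma mul {F : k[X][X]} (G : k[X][X]) (hF : Van T Φ F) : Van T Φ (G * F) := by
  obtain ⟨a, ha⟩ := hF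
  exact ⟨a, fun n hn x hx => by rw [evalEval_mul, ha n hn x hx, mul_zero]⟩

lemma of_dvd {F G : k[X][X]} (hF : Van T Φ F) (h : F ∣ G) : Van T Φ G := by
  obtain ⟨W, rfl⟩ := h
  rw [mul_comm]; exact hF.mul W

end Van

namespace TreeData
variable (h : TreeData p q T Φ)
include h

lemma eventually_ne (y : k) : ∃ n0, ∀ n ≥ n0, ∀ x ∈ T n, x ≠ y := by
  by_cases hy : ∃ m, y ∈ T m
  · obtain ⟨m, hm⟩ := hy
    refine ⟨m + 1, fun n hn x hx hxy => ?_⟩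
    subst hxy
    have := h.disj _ _ _ hm hx
    omega
  · push Not at hy
    exact ⟨0, fun n _ x hx hxy => hy n (hxy ▸ hx)⟩

lemma eventually_eval_ne (f : k[X]) (hf : f ≠ 0) : ∃ n0, ∀ n ≥ n0, ∀ x ∈ T n, f.eval x ≠ 0 := by
  choose N hN using h.eventually_ne
  refine ⟨f.roots.toFinset.sup N, fun n hn x hx h0 => ?_⟩
  have hmem : x ∈ f.roots.toFinset := by simpa [hf] using h0
  exact hN x n (le_trans (Finset.le_sup (f := N) hmem) hn) x hx rfl

lemma van_cancel_C {f : k[X]} (hf : f ≠ 0) {F : k[X][X]} (hF : Van T Φ (C f * F)) : Van T Φ F := by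
  obtain ⟨a, ha⟩ := hF
  obtain ⟨b, hb⟩ := h.eventually_eval_ne f hf
  refine ⟨max a b, fun n hn x hx => ?_⟩
  have h1 := ha n (le_trans (le_max_left _ _) hn) x hx
  have h2 := hb n (le_trans (le_max_right _ _) hn) x hx
  rw [evalEval_mul, evalEval_C] at h1
  exact (mul_eq_zero.1 h1).resolve_left h2

lemma van_cancel_map {f : k[X]} (hf : f ≠ 0) {F : k[X][X]} (hF : Van T Φ (f.map C * F)) :
    Van T Φ F := by
  obtain ⟨a, ha⟩ := hF
  obtain ⟨b, hb⟩ := h.eventually_eval_ne f hf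
  refine ⟨max a b, fun n hn x hx => ?_⟩
  have h1 := ha n (le_trans (le_max_left _ _) hn) x hx
  have h2 := hb n (le_trans (le_max_right _ _) hn) _ (h.mapsΦ _ _ hx)
  rw [evalEval_mul, evalEval_map_C] at h1
  exact (mul_eq_zero.1 h1).resolve_left h2

lemma exists_gen {N : k[X][X]} (hN : N ≠ 0) (hv : Van T Φ N) :
    ∃ G : k[X][X], G ≠ 0 ∧ Van T Φ G ∧ ∀ F, Van T Φ F → G ∣ F := by
  have hex : ∃ n : ℕ, ∃ G : k[X][X], G ≠ 0 ∧ Van T Φ G ∧ G.natDegree = n := ⟨_, N, hN, hv, rfl⟩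
  obtain ⟨G0, h0, hv0, hn⟩ := Nat.find_spec hex
  have hmin : ∀ F : k[X][X], F ≠ 0 → Van T Φ F → G0.natDegree ≤ F.natDegree := by
    intro F hF hvF
    rw [hn]
    exact Nat.find_min' hex ⟨F, hF, hvF, rfl⟩
  letI : NormalizedGCDMonoid k[X] := Classical.arbitrary _
  have hG0 := G0.eq_C_content_mul_primPart
  set G := G0.primPart with hGdef
  have hcont : G0.content ≠ 0 := by rwa [Ne, content_eq_zero_iff]
  have hvG : Van T Φ G := by
    rw [hG0] at hv0; exact h.van_cancel_C hcont hv0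
  have hprim : G.IsPrimitive := isPrimitive_primPart G0
  have hGne : G ≠ 0 := hprim.ne_zero
  have hdeg : G.natDegree = G0.natDegree := natDegree_primPart G0
  refine ⟨G, hGne, hvG, fun F hF => ?_⟩
  obtain ⟨c, Q, S, hc, he, hS⟩ := pdiv G hGne (F.natDegree + 1) F (by
    refine lt_of_le_of_lt degree_le_natDegree ?_
    norm_cast; omega)
  have hS0 : S = 0 := by
    by_contra hS0
    have hvS : Van T Φ S := by
      have : S = C c * F + (-Q) * G := by rw [he]; ring
      rw [this]
      exact (hF.mul _).add (hvG.mul _)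
    have h1 := hmin S hS0 hvS
    have h2 := natDegree_lt_natDegree hS0 hS
    omega
  rw [hS0, add_zero] at he
  apply hprim.dvd_of_fraction_map_dvd_fraction_map (K := FractionRing k[X])
  have h1 : (C c * F).map (algebraMap k[X] (FractionRing k[X])) =
      (Q * G).map (algebraMap k[X] (FractionRing k[X])) := by rw [he]
  rw [Polynomial.map_mul, Polynomial.map_mul, map_C] at h1
  have hu : IsUnit (C (algebraMap k[X] (FractionRing k[X]) c)) := by
    rw [isUnit_C, isUnit_iff_ne_zero, Ne, FaithfulSMul.algebraMap_eq_zero_iff]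
    exact hc
  rw [← hu.dvd_mul_left, h1]
  exact dvd_mul_left _ _

variable {G : k[X][X]} (hG : G ≠ 0) (hvG : Van T Φ G) (hgen : ∀ F, Van T Φ F → G ∣ F)
include hG hvG hgen

lemma gen_cancel {f F : k[X][X]} (hf : ¬ IsUnit f) (hc : Van T Φ (f * F) → Van T Φ F) :
    G ≠ f * F := by
  intro he
  have h1 : Van T Φ F := hc (he ▸ hvG)
  obtain ⟨W, hW⟩ := hgen F h1
  have hF : F ≠ 0 := by rintro rfl; simp at he; exact hG he
  apply hf
  have : F * 1 = F * (f * W) := by rw [mul_one]; conv_lhs => rw [hW, he]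
                                   ring
  have := mul_left_cancel₀ hF this
  exact IsUnit.of_mul_eq_one W this.symm

lemma gen_map_eval_ne (x0 : k) : G.map (evalRingHom x0) ≠ 0 := by
  intro h0
  have hd : C (X - C x0) ∣ G := by
    rw [C_dvd_iff_dvd_coeff]
    intro i
    rw [dvd_iff_isRoot, IsRoot.def]
    have := congrArg (fun f => coeff f i) h0
    simpa using this
  obtain ⟨F, hF⟩ := hd
  refine h.gen_cancel hG hvG hgen (f := C (X - C x0)) (F := F) ?_ (h.van_cancel_C (X_sub_C_ne_zero _)) hF
  rw [isUnit_C]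
  exact not_isUnit_X_sub_C x0

lemma gen_eval_C_ne (y0 : k) : G.eval (C y0) ≠ 0 := by
  intro h0
  obtain ⟨F, hF⟩ := dvd_iff_isRoot.2 h0
  have hm : (X - C (C y0) : k[X][X]) = (X - C y0 : k[X]).map C := by simp
  rw [hm] at hF
  refine h.gen_cancel hG hvG hgen (F := F) ?_ (h.van_cancel_map (X_sub_C_ne_zero _)) hF
  rw [← hm]
  exact not_isUnit_X_sub_C _

lemma gen_squarefree : Squarefree G := by
  intro f hf
  by_contra hu
  obtain ⟨F, hF⟩ := hf
  rw [mul_assoc] at hF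
  refine h.gen_cancel hG hvG hgen hu ?_ hF
  rintro ⟨n0, hn⟩
  refine ⟨n0, fun n hn' x hx => ?_⟩
  have := hn n hn' x hx
  simp only [evalEval_mul] at this ⊢
  rcases mul_eq_zero.1 this with h1 | h1
  · simp [h1]
  · exact h1

end TreeData
end M2a
end ArbPCF

namespace ArbPCF
section M2b
set_option linter.unusedSectionVars false
variable {k : Type*} [Field k]

/-- expansion at `x0` -/
noncomputable def iotaS (s : PowerSeries k) : k[X] →+* PowerSeries k :=
  eval₂RingHom (PowerSeries.C (R := k)) s

noncomputable abbrev xiS (x0 : k) : PowerSeries k := PowerSeries.C x0 + PowerSeries.X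

lemma iotaS_C (s : PowerSeries k) (c : k) : iotaS s (C c) = PowerSeries.C c := by simp [iotaS]
lemma iotaS_X (s : PowerSeries k) : iotaS s X = s := by simp [iotaS]

lemma constCoeff_iotaS (s : PowerSeries k) (f : k[X]) :
    PowerSeries.constantCoeff (iotaS s f) = f.eval (PowerSeries.constantCoeff s) := by
  have : (PowerSeries.constantCoeff (R := k)).comp (iotaS s) =
      evalRingHom (PowerSeries.constantCoeff s) := by
    apply Polynomial.ringHom_ext
    · intro a; simp [iotaS_C]
    · simp [iotaS_X]
  exact RingHom.congr_fun this f

lemma isUnit_iotaS {s : PowerSeries k} {f : k[X]} (h : f.eval (PowerSeries.constantCoeff s) ≠ 0) :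
    IsUnit (iotaS s f) := by
  rw [PowerSeries.isUnit_iff_constantCoeff, constCoeff_iotaS, isUnit_iff_ne_zero]
  exact h

lemma iotaS_factor {s : PowerSeries k} {f : k[X]} (hf : f ≠ 0) :
    ∃ u, IsUnit u ∧ iotaS s f = (s - PowerSeries.C (PowerSeries.constantCoeff s)) ^
      (f.rootMultiplicity (PowerSeries.constantCoeff s)) * u := by
  obtain ⟨g, hg, hgd⟩ := exists_eq_pow_rootMultiplicity_mul_and_not_dvd f hf (PowerSeries.constantCoeff s)
  refine ⟨iotaS s g, isUnit_iotaS ?_, ?_⟩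
  · intro h0; exact hgd (dvd_iff_isRoot.2 h0)
  · conv_lhs => rw [hg]
    rw [map_mul, map_pow, map_sub, iotaS_X, iotaS_C]

lemma iota_xi {x0 : k} {f : k[X]} (hf : f ≠ 0) :
    ∃ u, IsUnit u ∧ iotaS (xiS x0) f = PowerSeries.X ^ (f.rootMultiplicity x0) * u := by
  obtain ⟨u, hu, h⟩ := iotaS_factor (s := xiS x0) hf
  refine ⟨u, hu, ?_⟩
  simpa using h

lemma X_pow_unit_inj {a b : ℕ} {u v : PowerSeries k} (hu : IsUnit u) (hv : IsUnit v)
    (h : PowerSeries.X ^ a * u = PowerSeries.X ^ b * v) : a = b := by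
  have h1 := congrArg PowerSeries.order h
  rw [PowerSeries.order_mul, PowerSeries.order_mul, PowerSeries.order_X_pow, PowerSeries.order_X_pow] at h1
  have : ∀ w : PowerSeries k, IsUnit w → w.order = 0 := by
    intro w hw
    exact PowerSeries.order_zero_of_unit hw
  rw [this u hu, this v hv] at h1
  simpa using h1

noncomputable def ordG (G : k[X][X]) (y x : k) : ℕ := (G.eval (C y)).rootMultiplicity x

noncomputable def ram (p q : k[X]) (x : k) : ℕ := (p - C (phi p q x) * q).rootMultiplicity x

/-- `p(Y) - s q(Y)` over an arbitrary `k[X][X]`-like ring. -/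
noncomputable def fibPoly {R : Type*} [CommRing R] (ψ : k →+* R) (p q : k[X]) (s : R) : R[X] :=
  p.map ψ - C s * q.map ψ

lemma fibPoly_map {R S : Type*} [CommRing R] [CommRing S] (ψ : k →+* R) (p q : k[X]) (s : R)
    (f : R →+* S) : (fibPoly ψ p q s).map f = fibPoly (f.comp ψ) p q (f s) := by
  simp [fibPoly, Polynomial.map_map]

lemma fibPoly_self (p q : k[X]) (s : k) : fibPoly (RingHom.id k) p q s = p - C s * q := by
  simp [fibPoly]

variable {p q : k[X]} {T : ℕ → Set k} {Φ : k → k}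

lemma fibPoly_monic (hpq : Good p q) {R : Type*} [CommRing R] [Nontrivial R] (ψ : k →+* R) (s : R) :
    (fibPoly ψ p q s).Monic ∧ (fibPoly ψ p q s).natDegree = p.natDegree := by
  have hm : (p.map ψ).Monic := hpq.monic.map ψ
  have hdeg : (C s * q.map ψ).degree < (p.map ψ).degree := by
    rw [degree_eq_natDegree hm.ne_zero, hpq.monic.natDegree_map]
    rw [C_mul']
    refine lt_of_le_of_lt (degree_smul_le _ _) ?_
    refine lt_of_le_of_lt (degree_map_le) ?_
    rw [← degree_eq_natDegree hpq.monic.ne_zero]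
    exact degree_lt_degree hpq.lt
  refine ⟨hm.sub_of_left hdeg, ?_⟩
  rw [fibPoly, ← hpq.monic.natDegree_map ψ]
  exact natDegree_eq_of_degree_eq (degree_sub_eq_left_of_degree_lt hdeg)

/-- the coefficients of remainder -/
lemma div_lemma [IsAlgClosed k] (hpq : Good p q) (h : TreeData p q T Φ) {G : k[X][X]}
    (hgen : ∀ F, Van T Φ F → G ∣ F) {F : k[X][X]}
    (hF : ∃ n0, ∀ n ≥ n0, ∀ t ∈ T n, ∀ x, p.eval x = t * q.eval x → F.evalEval x (Φ t) = 0)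
    {S : Type*} [CommRing S] (ψ : k →+* S) (ξ τ : S)
    (hξ : p.eval₂ ψ ξ = τ * q.eval₂ ψ ξ) :
    (G.map (eval₂RingHom ψ τ)) ∣ (F.map (eval₂RingHom ψ ξ)) := by
  set CC' : k →+* k[X][X] := (C : k[X] →+* k[X][X]).comp (C : k →+* k[X]) with hCC
  set M : k[X][X][X] := fibPoly CC' p q (C X) with hM
  have hMm : M.Monic := (fibPoly_monic hpq CC' (C X)).1
  have hMd : M.natDegree = p.natDegree := (fibPoly_monic hpq CC' (C X)).2
  set F' : k[X][X][X] := F.eval₂ (mapRingHom CC') (C X) with hF'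
  set r := F' %ₘ M with hr
  have hdiv : r + M * (F' /ₘ M) = F' := modByMonic_add_div F' M
  have hrd : r.degree < M.degree := degree_modByMonic_lt _ hMm
  -- general evaluation
  have hcoef : ∀ i, G ∣ r.coeff i := by
    intro i
    apply hgen
    obtain ⟨n0, hn0⟩ := hF
    refine ⟨n0, fun n hn t ht => ?_⟩
    set ev := evalEvalRingHom t (Φ t) with hev
    have hevCC : ev.comp CC' = RingHom.id k := by ext a; simp [hev, hCC]
    have hMev : M.map ev = p - C t * q := by
      rw [hM, fibPoly_map, hevCC]
      have : ev (C X) = t := by simp [hev]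
      rw [this, fibPoly_self]
    have hzero : r.map ev = 0 := by
      have hnd : (p - C t * q).roots.Nodup := by
        apply hpq.fib_nodup
        intro x hx
        exact h.crit n x ((h.pre n x).2 ⟨t, ht, hx⟩)
      by_contra hne
      have hle : (p - C t * q).roots ≤ (r.map ev).roots := by
        rw [Multiset.le_iff_subset hnd]
        intro x hx
        have hx' := hpq.mem_fib.1 hx
        rw [mem_roots hne, IsRoot.def]
        have h1 := congrArg (fun f => (f.map ev).eval x) hdiv
        simp only [Polynomial.map_add, Polynomial.map_mul, eval_add, eval_mul, hMev] at h1
        have h2 : (p - C t * q).eval x = 0 := by simp [hx']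
        rw [h2, zero_mul, add_zero] at h1
        rw [h1]
        have h3 := hn0 n hn t ht x hx'
        rw [← h3]
        -- evaluate F'
        have : ((evalRingHom x).comp (mapRingHom ev)).comp (eval₂RingHom (S := k[X][X][X]) (mapRingHom CC') (C X)) =
            evalEvalRingHom x (Φ t) := by
          apply Polynomial.ringHom_ext'
          · apply Polynomial.ringHom_ext
            · intro a; simp [hev, hCC]
            · simp
          · simp [hev]
        exact RingHom.congr_fun this F
      have hc := Multiset.card_le_card hle
      have hcard : (p - C t * q).roots.card = p.natDegree := by
        rw [← hpq.fib_natDegree t]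
        exact (splits_iff_card_roots.1 (IsAlgClosed.splits _))
      have h4 : (r.map ev).roots.card ≤ (r.map ev).natDegree := card_roots' _
      have h5 : (r.map ev).degree < M.degree := lt_of_le_of_lt degree_map_le hrd
      have h6 := natDegree_lt_natDegree hne h5
      omega
    have := congrArg (fun f => coeff f i) hzero
    simpa [hev] using this
  set Ψ : k[X][X] →+* S[X] := mapRingHom (eval₂RingHom ψ τ) with hΨ
  have hFev : F.map (eval₂RingHom ψ ξ) = r.eval₂ Ψ (C ξ) := by
    have h1 := congrArg (eval₂ Ψ (C ξ)) hdiv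
    rw [eval₂_add, eval₂_mul] at h1
    have hM0 : M.eval₂ Ψ (C ξ) = 0 := by
      have hc : Ψ.comp CC' = (C : S →+* S[X]).comp ψ := by ext a; simp [hΨ, hCC]
      rw [hM, fibPoly, eval₂_sub, eval₂_mul, eval₂_map, eval₂_map, eval₂_C, hc]
      have : Ψ (C X) = C τ := by simp [hΨ]
      rw [this, ← hom_eval₂, ← hom_eval₂, hξ, map_mul, sub_self]
    rw [hM0, zero_mul, add_zero] at h1
    rw [h1]
    have : (eval₂RingHom Ψ (C ξ)).comp (eval₂RingHom (S := k[X][X][X]) (mapRingHom CC') (C X)) =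
        mapRingHom (eval₂RingHom ψ ξ) := by
      apply Polynomial.ringHom_ext'
      · apply Polynomial.ringHom_ext
        · intro a; simp [hΨ, hCC]
        · simp
      · simp [hΨ]
    exact (RingHom.congr_fun this F).symm
  rw [hFev, eval₂_eq_sum, Polynomial.sum]
  apply Finset.dvd_sum
  intro i _
  refine Dvd.dvd.mul_right ?_ _
  exact map_dvd Ψ (hcoef i)

/-- the resultant -/
noncomputable def resH (p q : k[X]) (G : k[X][X]) : k[X][X] :=
  resultant (fibPoly ((C : k[X] →+* k[X][X]).comp (C : k →+* k[X])) p q (X : k[X][X])) (G.map C)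
    p.natDegree G.natDegree

lemma resH_eval [IsAlgClosed k] (hpq : Good p q) (G : k[X][X]) (z : k) :
    (resH p q G).eval (C z) = ((p - C z * q).roots.map (fun y => G.eval (C y))).prod := by
  have h1 : (resH p q G).eval (C z) = evalRingHom (C z) (resH p q G) := rfl
  rw [h1, resH, ← resultant_map_map, fibPoly_map]
  have h2 : (G.map C).map (evalRingHom (C z)) = G := by
    rw [Polynomial.map_map]
    have : (evalRingHom (C z)).comp (C : k[X] →+* k[X][X]) = RingHom.id _ := by ext a <;> simp
    rw [this, Polynomial.map_id]
  have h3 : (evalRingHom (C z)).comp ((C : k[X] →+* k[X][X]).comp (C : k →+* k[X])) = C := by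
    ext a; simp
  rw [h2, h3]
  have h4 : fibPoly (C : k →+* k[X]) p q ((evalRingHom (C z)) X) = (p - C z * q).map C := by
    simp [fibPoly]
  rw [h4]
  have hm : ((p - C z * q).map (C : k →+* k[X])).Monic := (hpq.fib_monic z).map C
  have hs : ((p - C z * q).map (C : k →+* k[X])).Splits := (IsAlgClosed.splits _).map _
  have h5 := resultant_eq_prod_eval ((p - C z * q).map (C : k →+* k[X])) G G.natDegree le_rfl hs
  rw [(hpq.fib_monic z).natDegree_map, hpq.fib_natDegree] at h5
  rw [h5, hm.leadingCoeff, one_pow, one_mul]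
  have h6 : ((p - C z * q).map (C : k →+* k[X])).roots = (p - C z * q).roots.map C := by
    rw [roots_map_of_injective_of_card_eq_natDegree C_injective]
    exact (splits_iff_card_roots.1 (IsAlgClosed.splits _))
  rw [h6, Multiset.map_map]
  rfl

lemma resH_natDegree (G : k[X][X]) : (resH p q G).natDegree ≤ G.natDegree := by
  rw [resH, resultant, Matrix.det_apply]
  apply natDegree_sum_le_of_forall_le
  intro σ _
  refine (natDegree_smul_le _ _).trans ?_
  refine (natDegree_prod_le _ _).trans ?_
  rw [Fin.sum_univ_add]
  have hl : ∀ i : Fin p.natDegree, (sylvester (fibPoly ((C : k[X] →+* k[X][X]).comp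
      (C : k →+* k[X])) p q (X : k[X][X])) (G.map C) p.natDegree G.natDegree
      (σ (Fin.castAdd _ i)) (Fin.castAdd _ i)).natDegree ≤ 0 := by
    intro i
    simp only [sylvester, Matrix.of_apply, Fin.addCases_left]
    split_ifs
    · simp
    · simp
  have hr : ∀ i : Fin G.natDegree, (sylvester (fibPoly ((C : k[X] →+* k[X][X]).comp
      (C : k →+* k[X])) p q (X : k[X][X])) (G.map C) p.natDegree G.natDegree
      (σ (Fin.natAdd _ i)) (Fin.natAdd _ i)).natDegree ≤ 1 := by
    intro i
    simp only [sylvester, Matrix.of_apply, Fin.addCases_right]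
    split_ifs
    · simp only [fibPoly, coeff_sub, coeff_map, coeff_C_mul, RingHom.comp_apply]
      refine (natDegree_sub_le _ _).trans (max_le (by simp) ?_)
      refine natDegree_mul_le.trans ?_
      simp
    · simp
  refine (add_le_add (Finset.sum_le_sum (fun i _ => hl i)) (Finset.sum_le_sum (fun i _ => hr i))).trans ?_
  simp

end M2b
end ArbPCF

namespace ArbPCF
section M2c
set_option linter.unusedSectionVars false
variable {k : Type*} [Field k]
variable {p q : k[X]} {T : ℕ → Set k} {Φ : k → k}

lemma resH_van [IsAlgClosed k] (hpq : Good p q) (h : TreeData p q T Φ) {G : k[X][X]}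
    (hvG : Van T Φ G) :
    ∃ n0, ∀ n ≥ n0, ∀ t ∈ T n, ∀ x, p.eval x = t * q.eval x → (resH p q G).evalEval x (Φ t) = 0 := by
  obtain ⟨n0, hn0⟩ := hvG
  refine ⟨n0, fun n hn t ht x hx => ?_⟩
  rw [evalEval, resH_eval hpq]
  have h1 : x ∈ T (n+1) := (h.pre n x).2 ⟨t, ht, hx⟩
  have h2 : Φ x ∈ (p - C (Φ t) * q).roots := hpq.mem_fib.2 (h.commΦ n x t ht hx)
  have h3 := hn0 (n+1) (by omega) x h1
  have h4 : G.eval (C (Φ x)) ∣ ((p - C (Φ t) * q).roots.map (fun y => G.eval (C y))).prod :=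
    Multiset.dvd_prod (Multiset.mem_map_of_mem (fun y => G.eval (C y)) h2)
  exact eval_eq_zero_of_dvd_of_eval_eq_zero h4 h3

lemma resH_map_ne [IsAlgClosed k] (hpq : Good p q) {G : k[X][X]} {x0 : k}
    (hx : G.map (evalRingHom x0) ≠ 0) : (resH p q G).map (evalRingHom x0) ≠ 0 := by
  intro h0
  obtain ⟨z, hz⟩ := Infinite.exists_notMem_finset
    ((G.map (evalRingHom x0)).roots.toFinset.image (phi p q))
  have h1 : ((resH p q G).map (evalRingHom x0)).eval z = 0 := by rw [h0]; simp
  rw [map_evalRingHom_eval, evalEval, resH_eval hpq, ← coe_evalRingHom, map_multiset_prod,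
    Multiset.map_map, Multiset.prod_eq_zero_iff, Multiset.mem_map] at h1
  obtain ⟨y, hy, hy0⟩ := h1
  apply hz
  rw [Finset.mem_image]
  refine ⟨y, ?_, (hpq.mem_fib'.1 hy).2⟩
  rw [Multiset.mem_toFinset, mem_roots hx, IsRoot.def, map_evalRingHom_eval]
  exact hy0

lemma map_eval_comp (x0 : k) : (PowerSeries.constantCoeff (R := k)).comp (iotaS (xiS x0)) =
    evalRingHom x0 := by
  ext f
  · simp [constCoeff_iotaS]
  · simp [constCoeff_iotaS]

theorem ord_identity [IsAlgClosed k] [CharZero k] (hpq : Good p q) (h : TreeData p q T Φ)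
    {G : k[X][X]} (hG : G ≠ 0) (hvG : Van T Φ G) (hgen : ∀ F, Van T Φ F → G ∣ F)
    {x0 : k} (hx0 : q.eval x0 ≠ 0) (z : k) :
    ((p - C z * q).roots.map (fun y => ordG G y x0)).sum =
      ram p q x0 * ordG G z (phi p q x0) := by
  set ξ : PowerSeries k := xiS x0 with hξ
  set t0 := phi p q x0 with ht0
  have hcξ : PowerSeries.constantCoeff ξ = x0 := by simp [hξ]
  have hqu : IsUnit (iotaS ξ q) := isUnit_iotaS (by rw [hcξ]; exact hx0)
  obtain ⟨v, hv⟩ := hqu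
  set τ : PowerSeries k := iotaS ξ p * ↑v⁻¹ with hτ
  have hτq : iotaS ξ p = τ * iotaS ξ q := by
    rw [hτ, ← hv, mul_assoc, Units.inv_mul, mul_one]
  have hcτ : PowerSeries.constantCoeff τ = t0 := by
    have := congrArg (PowerSeries.constantCoeff (R := k)) hτq
    rw [map_mul, constCoeff_iotaS, constCoeff_iotaS, hcξ] at this
    rw [ht0, phi, this, mul_div_cancel_right₀ _ hx0]
  have hτt : ∃ u, IsUnit u ∧ τ - PowerSeries.C t0 = PowerSeries.X ^ (ram p q x0) * u := by
    obtain ⟨u, hu, he⟩ := iota_xi (x0 := x0) (hpq.fib_ne t0)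
    refine ⟨u * ↑v⁻¹, hu.mul (Units.isUnit _), ?_⟩
    rw [← mul_assoc, ram, ← ht0, ← he, map_sub, map_mul, iotaS_C, ← hξ, sub_mul, ← hτ,
      mul_assoc, ← hv, Units.mul_inv, mul_one]
  have hιτ : ∀ f : k[X], f ≠ 0 → ∃ u, IsUnit u ∧
      iotaS τ f = PowerSeries.X ^ (ram p q x0 * f.rootMultiplicity t0) * u := by
    intro f hf
    obtain ⟨u, hu, he⟩ := iotaS_factor (s := τ) hf
    obtain ⟨w, hw, he2⟩ := hτt
    rw [hcτ, he2, mul_pow, ← pow_mul, mul_assoc] at he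
    exact ⟨_, (hw.pow _).mul hu, he⟩
  have hιne : ∀ f : k[X], f ≠ 0 → iotaS τ f ≠ 0 := by
    intro f hf
    obtain ⟨u, hu, he⟩ := hιτ f hf
    rw [he]
    exact mul_ne_zero (pow_ne_zero _ PowerSeries.X_ne_zero) hu.ne_zero
  obtain ⟨W, hW⟩ : G.map (iotaS τ) ∣ (resH p q G).map (iotaS ξ) :=
    div_lemma hpq h hgen (resH_van hpq h hvG) _ ξ τ hτq
  have hHne : (resH p q G).map (evalRingHom x0) ≠ 0 :=
    resH_map_ne hpq (h.gen_map_eval_ne hG hvG hgen x0)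
  have hHne' : (resH p q G).map (iotaS ξ) ≠ 0 := by
    intro h0
    apply hHne
    rw [← map_eval_comp, ← Polynomial.map_map, h0, Polynomial.map_zero]
  have hGτ : (G.map (iotaS τ)).natDegree = G.natDegree :=
    natDegree_map_of_leadingCoeff_ne_zero _ (hιne _ (leadingCoeff_ne_zero.2 hG))
  have hGne' : G.map (iotaS τ) ≠ 0 := by
    intro h0; rw [hW, h0, zero_mul] at hHne'; exact hHne' rfl
  have hWne : W ≠ 0 := by
    rintro rfl; rw [hW, mul_zero] at hHne'; exact hHne' rfl
  have hW0 : W.natDegree = 0 := by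
    have h1 := congrArg natDegree hW
    rw [natDegree_mul hGne' hWne, hGτ] at h1
    have h2 : ((resH p q G).map (iotaS ξ)).natDegree ≤ G.natDegree :=
      natDegree_map_le.trans (resH_natDegree G)
    omega
  obtain ⟨w, rfl⟩ := natDegree_eq_zero.1 hW0
  have hwu : IsUnit w := by
    rw [PowerSeries.isUnit_iff_constantCoeff, isUnit_iff_ne_zero]
    intro h0
    apply hHne
    rw [← map_eval_comp, ← Polynomial.map_map, ← hξ, hW, Polynomial.map_mul, map_C, h0]
    simp
  have h1 := congrArg (eval (PowerSeries.C z)) hW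
  rw [eval_mul, eval_C] at h1
  have hev : ∀ (s : PowerSeries k) (F : k[X][X]), (F.map (iotaS s)).eval (PowerSeries.C z) =
      iotaS s (F.eval (C z)) := by
    intro s F
    rw [eval_map, ← iotaS_C s, eval₂_at_apply]
  rw [hev, hev, resH_eval hpq, map_multiset_prod, Multiset.map_map] at h1
  obtain ⟨u1, hu1, he1⟩ := hιτ (G.eval (C z)) (h.gen_eval_C_ne hG hvG hgen z)
  have hprod : ∀ m : Multiset k, ∃ u, IsUnit u ∧
      (m.map (⇑(iotaS ξ) ∘ fun y => G.eval (C y))).prod =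
        PowerSeries.X ^ ((m.map (fun y => ordG G y x0)).sum) * u := by
    intro m
    induction m using Multiset.induction_on with
    | empty => exact ⟨1, isUnit_one, by simp⟩
    | cons y m ih =>
      obtain ⟨u, hu, he⟩ := ih
      obtain ⟨u2, hu2, he2⟩ := iota_xi (x0 := x0) (h.gen_eval_C_ne hG hvG hgen y)
      refine ⟨u2 * u, hu2.mul hu, ?_⟩
      rw [Multiset.map_cons, Multiset.map_cons, Multiset.prod_cons, Multiset.sum_cons, he,
        Function.comp_apply, he2, pow_add, ordG]
      ring
  obtain ⟨u2, hu2, he2⟩ := hprod (p - C z * q).roots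
  rw [he2, he1, mul_assoc] at h1
  exact X_pow_unit_inj hu2 (hu1.mul hwu) h1

/-- The two consequences that we need. -/
theorem ord_le [IsAlgClosed k] [CharZero k] (hpq : Good p q) (h : TreeData p q T Φ)
    {G : k[X][X]} (hG : G ≠ 0) (hvG : Van T Φ G) (hgen : ∀ F, Van T Φ F → G ∣ F)
    {x0 : k} (hx0 : q.eval x0 ≠ 0) {y : k} (hy : q.eval y ≠ 0) :
    ordG G y x0 ≤ ram p q x0 * ordG G (phi p q y) (phi p q x0) := by
  rw [← ord_identity hpq h hG hvG hgen hx0]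
  have : y ∈ (p - C (phi p q y) * q).roots := hpq.mem_fib'.2 ⟨hy, rfl⟩
  exact Multiset.single_le_sum (fun _ _ => Nat.zero_le _) _ (Multiset.mem_map_of_mem (fun y => ordG G y x0) this)

theorem ord_le_crit [IsAlgClosed k] [CharZero k] (hpq : Good p q) (h : TreeData p q T Φ)
    {G : k[X][X]} (hG : G ≠ 0) (hvG : Van T Φ G) (hgen : ∀ F, Van T Φ F → G ∣ F)
    {x0 : k} (hx0 : q.eval x0 ≠ 0) {y : k} (hy : q.eval y ≠ 0) (hW : (Wr p q).eval y = 0) :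
    2 * ordG G y x0 ≤ ram p q x0 * ordG G (phi p q y) (phi p q x0) := by
  rw [← ord_identity hpq h hG hvG hgen hx0]
  have hy' : p.eval y = phi p q y * q.eval y := hpq.phi_eq_iff.1 ⟨hy, rfl⟩
  have h1 : 2 ≤ (p - C (phi p q y) * q).roots.count y := by
    rw [count_roots]
    apply (one_lt_rootMultiplicity_iff_isRoot (hpq.fib_ne _)).2
    refine ⟨by simp [hy'], ?_⟩
    rw [hpq.Wr_eval hy'] at hW
    exact (mul_eq_zero.1 hW).resolve_right hy
  rw [Multiset.le_count_iff_replicate_le] at h1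
  have h2 := Multiset.map_le_map (f := fun y => ordG G y x0) h1
  obtain ⟨r, hr⟩ := Multiset.le_iff_exists_add.1 h2
  rw [hr, Multiset.sum_add]
  simp only [Multiset.map_replicate, Multiset.sum_replicate, smul_eq_mul]
  omega

end M2c
end ArbPCF

namespace ArbPCF
section M3
set_option linter.unusedSectionVars false
variable {k : Type*} [Field k]

lemma det_dvd_of_ker {n : Type*} [Fintype n] [DecidableEq n] (M : Matrix n n k[X]) (y0 : k)
    (δ : ℕ) (h : δ ≤ Module.finrank k (LinearMap.ker (M.map (evalRingHom y0)).mulVecLin)) :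
    (X - C y0) ^ δ ∣ M.det := by
  set W := LinearMap.ker (M.map (evalRingHom y0)).mulVecLin with hW
  let b := (Module.finBasis k W).sumQuot (Module.finBasis k ((n → k) ⧸ W))
  have e : (Fin (Module.finrank k W) ⊕ Fin (Module.finrank k ((n → k) ⧸ W))) ≃ n :=
    b.indexEquiv (Pi.basisFun k n)
  let b' := b.reindex e
  let P : Matrix n n k := (Pi.basisFun k n).toMatrix b'
  have hP : IsUnit P.det := by
    have := (Pi.basisFun k n).isUnit_det b'
    rwa [Module.Basis.det_apply] at this
  have hcol : ∀ (j : Fin (Module.finrank k W)) (i : n),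
      (X - C y0) ∣ (M * P.map C) i (e (Sum.inl j)) := by
    intro j i
    rw [dvd_iff_isRoot, IsRoot.def, ← coe_evalRingHom, Matrix.mul_apply, map_sum]
    have h1 : b' (e (Sum.inl j)) ∈ W := by
      simp [b', b]
    replace h1 := LinearMap.mem_ker.1 h1
    have h2 := congrFun h1 i
    simp only [Matrix.mulVecLin_apply, Matrix.mulVec, dotProduct] at h2
    simpa [P, Module.Basis.toMatrix_apply] using h2
  choose! A hA using hcol
  let v : n → k[X] := fun j => Sum.elim (fun _ => X - C y0) (fun _ => 1) (e.symm j)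
  let B : Matrix n n k[X] := Matrix.of fun i j =>
    Sum.elim (fun j' => A j' i) (fun _ => (M * P.map C) i j) (e.symm j)
  have hB : M * P.map C = Matrix.of fun i j => v j * B i j := by
    ext1 i j
    obtain ⟨j, rfl⟩ := e.surjective j
    rcases j with j | j
    · simp [v, B, hA]
    · simp [v, B]
  have h3 := congrArg Matrix.det hB
  rw [Matrix.det_mul_row, Matrix.det_mul] at h3
  have h4 : ∏ i, v i = (X - C y0) ^ (Module.finrank k W) := by
    rw [← e.prod_comp]
    simp [v]
  have h5 : (P.map C).det = C P.det := (RingHom.map_det C P).symm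
  have h6 : (X - C y0) ^ δ ∣ M.det * (P.map C).det := by
    rw [h3, h4]; exact (pow_dvd_pow _ h).mul_right _
  have h7 : IsUnit (P.map C).det := by rw [h5]; exact hP.map C
  exact h7.dvd_mul_right.1 h6

lemma natDegree_det_le {n : Type*} [Fintype n] [DecidableEq n] (M : Matrix n n k[X]) (b : ℕ)
    (h : ∀ i j, (M i j).natDegree ≤ b) : M.det.natDegree ≤ Fintype.card n * b := by
  rw [Matrix.det_apply]
  apply natDegree_sum_le_of_forall_le
  intro σ _
  refine (natDegree_smul_le _ _).trans ?_
  refine (natDegree_prod_le _ _).trans ?_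
  refine (Finset.sum_le_card_nsmul _ _ b (fun i _ => h _ _)).trans ?_
  simp

/-- excess of a polynomial : sum of (multiplicity - 1) over roots -/
noncomputable def exc (f : k[X]) : ℕ := ∑ u ∈ f.roots.toFinset, (f.rootMultiplicity u - 1)

lemma exc_dvd [CharZero k] (f : k[X]) (hf : f ≠ 0) :
    ∃ D : k[X], D.Monic ∧ D.natDegree = exc f ∧ D ∣ f ∧ D ∣ derivative f := by
  refine ⟨∏ u ∈ f.roots.toFinset, (X - C u) ^ (f.rootMultiplicity u - 1), ?_, ?_, ?_, ?_⟩
  · exact monic_prod_of_monic _ _ (fun u _ => (monic_X_sub_C u).pow _)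
  · rw [natDegree_prod_of_monic _ _ (fun u _ => (monic_X_sub_C u).pow _), exc]
    simp
  · apply Finset.prod_dvd_of_coprime
    · intro u _ v _ huv
      exact (isCoprime_X_sub_C_of_isUnit_sub (sub_ne_zero.2 huv).isUnit).pow
    · intro u _
      exact (pow_dvd_pow _ (Nat.sub_le _ _)).trans (pow_rootMultiplicity_dvd f u)
  · apply Finset.prod_dvd_of_coprime
    · intro u _ v _ huv
      exact (isCoprime_X_sub_C_of_isUnit_sub (sub_ne_zero.2 huv).isUnit).pow
    · intro u hu
      rw [Multiset.mem_toFinset, mem_roots hf] at hu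
      rw [← derivative_rootMultiplicity_of_root hu]
      exact pow_rootMultiplicity_dvd _ _

lemma sylv_ker [CharZero k] (f : k[X]) (hf : f ≠ 0) (a : ℕ) (ha : f.natDegree ≤ a) :
    exc f ≤ Module.finrank k (LinearMap.ker (sylvester f (derivative f) a (a-1)).mulVecLin) := by
  obtain ⟨D, hDm, hDd, ⟨f2, hf2⟩, ⟨g2, hg2⟩⟩ := exc_dvd f hf
  have hD0 := hDm.ne_zero
  have hdg : (derivative f).natDegree ≤ a - 1 := (natDegree_derivative_le f).trans (by omega)
  have hfn : f2 ≠ 0 := by rintro rfl; simp at hf2; exact hf hf2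
  have hfd : D.natDegree + f2.natDegree ≤ a := by
    rw [← natDegree_mul hD0 hfn, ← hf2]; exact ha
  let b1 := ((degreeLT.basis k a).prod (degreeLT.basis k (a-1))).reindex finSumFinEquiv
  have hker : exc f ≤ Module.finrank k (LinearMap.ker (sylvesterMap f (derivative f) ha hdg)) := by
    rw [← hDd]
    have hg2' : ∀ w ∈ degreeLT k D.natDegree, g2 * w ∈ degreeLT k (a-1) := by
      intro w hw
      rw [mem_degreeLT] at *
      by_cases h0 : g2 = 0
      · rw [h0]; simp
      by_cases h1 : w = 0
      · rw [h1]; simp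
      have h2 : D.natDegree + g2.natDegree ≤ a - 1 := by
        rw [← natDegree_mul hD0 h0, ← hg2]; exact hdg
      rw [degree_mul, degree_eq_natDegree h0, degree_eq_natDegree h1] at *
      norm_cast at *; omega
    have hf2' : ∀ w ∈ degreeLT k D.natDegree, -(f2 * w) ∈ degreeLT k a := by
      intro w hw
      rw [mem_degreeLT] at *
      by_cases h1 : w = 0
      · rw [h1]; simp
      rw [degree_neg, degree_mul, degree_eq_natDegree hfn, degree_eq_natDegree h1] at *
      norm_cast at *; omega
    let L : degreeLT k D.natDegree →ₗ[k] LinearMap.ker (sylvesterMap f (derivative f) ha hdg) :=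
      { toFun := fun w => ⟨(⟨_, hf2' w w.2⟩, ⟨_, hg2' w w.2⟩), by
          rw [LinearMap.mem_ker]
          apply Subtype.ext
          change f * (g2 * w) + derivative f * (-(f2 * w)) = 0
          rw [hg2, hf2]
          rw [← hf2]
          linear_combination (g2 * w) * hf2⟩
        map_add' := by
          intro x y
          apply Subtype.ext
          apply Prod.ext <;> apply Subtype.ext
          · change -(f2 * (x + y : k[X])) = -(f2 * x) + -(f2 * y)
            ring
          · change (g2 * (x + y : k[X])) = (g2 * x) + (g2 * y)
            ring
        map_smul' := by
          intro c x
          apply Subtype.ext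
          apply Prod.ext <;> apply Subtype.ext
          · change -(f2 * (c • x : k[X])) = c • -(f2 * x)
            simp
          · change (g2 * (c • x : k[X])) = c • (g2 * x)
            simp }
    have hL : Function.Injective L := by
      intro x y hxy
      have h1 := congrArg (fun z => (z.1.1 : k[X])) hxy
      change -(f2 * (x : k[X])) = -(f2 * y) at h1
      exact Subtype.ext (mul_left_cancel₀ hfn (neg_injective h1))
    have := LinearMap.finrank_le_finrank_of_injective hL
    rwa [Module.finrank_eq_card_basis (degreeLT.basis k D.natDegree), Fintype.card_fin] at this
  refine hker.trans ?_
  have hm := toMatrix_sylvesterMap' f (derivative f) ha hdg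
  have h1 := LinearMap.finrank_range_add_finrank_ker (sylvesterMap f (derivative f) ha hdg)
  have h2 := LinearMap.finrank_range_add_finrank_ker (sylvester f (derivative f) a (a-1)).mulVecLin
  have h3 : (sylvester f (derivative f) a (a-1)).rank =
      Module.finrank k (LinearMap.range (sylvesterMap f (derivative f) ha hdg)) := by
    rw [← hm, Matrix.rank_eq_finrank_range_toLin _ (degreeLT.basis k (a + (a-1)))
      b1, Matrix.toLin_toMatrix]
  rw [Matrix.rank] at h3
  have h4 : Module.finrank k (degreeLT k a × degreeLT k (a-1)) = Module.finrank k (Fin (a + (a-1)) → k) := by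
    rw [Module.finrank_eq_card_basis b1, Module.finrank_fin_fun, Fintype.card_fin]
  omega

lemma squarefree_frac {R : Type*} [CommRing R] [IsDomain R] [NormalizedGCDMonoid R] {f : R[X]} (hs : Squarefree f)
    (hp : f.IsPrimitive) : Squarefree (f.map (algebraMap R (FractionRing R))) := by
  intro h hh
  have hf0 : f.map (algebraMap R (FractionRing R)) ≠ 0 := by
    rw [Ne, Polynomial.map_eq_zero_iff (IsFractionRing.injective R (FractionRing R))]
    exact hp.ne_zero
  have h0 : h ≠ 0 := by rintro rfl; simp at hh; exact hf0 (by simpa using hh)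
  obtain ⟨c, hc, hcn⟩ := IsLocalization.integerNormalization_spec (nonZeroDivisors R) h
  set g := IsLocalization.integerNormalization (nonZeroDivisors R) h with hg
  have hg0 : g ≠ 0 := by
    intro h1
    rw [h1, Polynomial.map_zero] at hcn
    have := smul_eq_zero.1 hcn.symm
    rcases this with h2 | h2
    · exact nonZeroDivisors.ne_zero hc h2
    · exact h0 h2
  have key : g.primPart.map (algebraMap R (FractionRing R)) ∣ h ∧
      h ∣ g.primPart.map (algebraMap R (FractionRing R)) := by
    have h1 : IsUnit (C (algebraMap R (FractionRing R) c)) :=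
      Polynomial.isUnit_C.2 (isUnit_iff_ne_zero.2 (by
        simpa using nonZeroDivisors.ne_zero hc))
    have h2 : IsUnit (C (algebraMap R (FractionRing R) g.content)) :=
      Polynomial.isUnit_C.2 (isUnit_iff_ne_zero.2 (by
        simpa [content_eq_zero_iff] using hg0))
    have h3 : C (algebraMap R (FractionRing R) c) * h =
        C (algebraMap R (FractionRing R) g.content) * g.primPart.map (algebraMap R (FractionRing R)) := by
      rw [← Polynomial.map_C, ← Polynomial.map_C, ← Polynomial.map_mul, ← eq_C_content_mul_primPart, hcn]
      rw [Polynomial.map_C]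
      ext n
      simp [Algebra.smul_def]
    constructor
    · have : g.primPart.map (algebraMap R (FractionRing R)) ∣ C (algebraMap R (FractionRing R) c) * h := h3 ▸ dvd_mul_left _ _
      exact h1.dvd_mul_left.1 this
    · have : h ∣ C (algebraMap R (FractionRing R) g.content) * g.primPart.map (algebraMap R (FractionRing R)) := h3 ▸ dvd_mul_left _ _
      exact h2.dvd_mul_left.1 this
  have h4 : g.primPart * g.primPart ∣ f := by
    apply Polynomial.IsPrimitive.dvd_of_fraction_map_dvd_fraction_map (K := FractionRing R)
      (g.isPrimitive_primPart.mul g.isPrimitive_primPart)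
    rw [Polynomial.map_mul]
    exact (mul_dvd_mul key.1 key.1).trans hh
  have h5 := hs _ h4
  exact isUnit_of_dvd_unit key.2 (h5.map (mapRingHom (algebraMap R (FractionRing R))))

theorem disc_bound [CharZero k] (f : k[X][X]) (hs : Squarefree f) (hp : f.IsPrimitive)
    (hne : ∀ y, f.map (evalRingHom y) ≠ 0)
    (b : ℕ) (hb : ∀ i, (f.coeff i).natDegree ≤ b) (S : Finset k) :
    ∑ y ∈ S, exc (f.map (evalRingHom y)) ≤ (2 * f.natDegree - 1) * b := by
  set a := f.natDegree with ha
  set M := sylvester f (derivative f) a (a-1) with hM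
  have hdet : M.det ≠ 0 := by
    have h1 := squarefree_frac hs hp
    have : CharZero (FractionRing k[X]) := charZero_of_injective_algebraMap
      (IsFractionRing.injective k[X] (FractionRing k[X]))
    have h2 := (PerfectField.separable_iff_squarefree.2 h1)
    rw [Separable] at h2
    have h3 := resultant_ne_zero _ _ h2
    rw [natDegree_map_eq_of_injective (IsFractionRing.injective k[X] (FractionRing k[X])),
      natDegree_derivative, natDegree_map_eq_of_injective (IsFractionRing.injective k[X] (FractionRing k[X])),
      derivative_map, resultant_map_map] at h3
    intro h4
    apply h3
    rw [resultant, ← ha, ← hM, h4, map_zero]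
  have hdiv : ∀ y, (X - C y) ^ (exc (f.map (evalRingHom y))) ∣ M.det := by
    intro y
    apply det_dvd_of_ker
    have h1 := sylv_ker (f.map (evalRingHom y)) (hne y) a natDegree_map_le
    have h2 : sylvester (f.map (evalRingHom y)) (derivative (f.map (evalRingHom y))) a (a-1) =
        M.map (evalRingHom y) := by
      rw [derivative_map, sylvester_map_map, RingHom.mapMatrix_apply]
    rw [h2] at h1
    exact h1
  have hprod : ∏ y ∈ S, (X - C y) ^ (exc (f.map (evalRingHom y))) ∣ M.det := by
    apply Finset.prod_dvd_of_coprime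
    · intro u _ v _ huv
      exact (isCoprime_X_sub_C_of_isUnit_sub (sub_ne_zero.2 huv).isUnit).pow
    · intro u _
      exact hdiv u
  have h1 := natDegree_le_of_dvd hprod hdet
  rw [natDegree_prod_of_monic _ _ (fun u _ => (monic_X_sub_C u).pow _)] at h1
  simp only [natDegree_pow, natDegree_X_sub_C, mul_one] at h1
  refine h1.trans ((natDegree_det_le M b ?_).trans ?_)
  · intro i j
    rw [hM, sylvester, Matrix.of_apply]
    induction j using Fin.addCases with
    | left j =>
      rw [Fin.addCases_left]
      split_ifs
      · rw [coeff_derivative]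
        refine natDegree_mul_le.trans ?_
        have : ((↑(↑i - ↑j : ℕ) + 1 : k[X])).natDegree = 0 := by
          have := natDegree_natCast (R := k) (i - j + 1)
          push_cast at this
          exact_mod_cast this
        rw [this]; exact hb _
      · simp
    | right j =>
      rw [Fin.addCases_right]
      split_ifs
      · exact hb _
      · simp
  · rw [Fintype.card_fin]
    exact Nat.mul_le_mul_right _ (by omega)

lemma coeff_swap (F : k[X][X]) (i j : ℕ) :
    ((Bivariate.swap F).coeff i).coeff j = (F.coeff j).coeff i := by
  induction F using Polynomial.induction_on' with
  | add f g hf hg => simp [hf, hg]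
  | monomial n f =>
    rw [Bivariate.swap_monomial, coeff_mul_C, coeff_map, coeff_C_mul, coeff_X_pow, coeff_monomial]
    by_cases h : n = j
    · simp [h]
    · simp [h, Ne.symm h]

lemma swap_map_eval (F : k[X][X]) (y : k) : (Bivariate.swap F).map (evalRingHom y) = F.eval (C y) := by
  induction F using Polynomial.induction_on' with
  | add f g hf hg => simp [hf, hg]
  | monomial n f =>
    rw [Bivariate.swap_monomial, eval_monomial, Polynomial.map_mul, Polynomial.map_map, map_C]
    congr 1
    · convert! Polynomial.map_id (p := f) using 2
      ext; simp
    · simp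

lemma swap_dvd {F N : k[X][X]} (h : F ∣ N) : Bivariate.swap F ∣ Bivariate.swap N := by
  obtain ⟨W, rfl⟩ := h
  exact ⟨Bivariate.swap W, by rw [_root_.map_mul]⟩

lemma swap_ne {F : k[X][X]} (h : F ≠ 0) : Bivariate.swap F ≠ 0 := by
  intro h0
  apply h
  rw [← Bivariate.swap_swap_apply F, h0, _root_.map_zero]

lemma swap_isUnit {F : k[X][X]} (h : IsUnit (Bivariate.swap F)) : IsUnit F := by
  have h2 := h.map (Bivariate.swap (R := k))
  rwa [Bivariate.swap_swap_apply] at h2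

/-- discriminant bound for the generator -/
theorem gen_disc_bound [IsAlgClosed k] [CharZero k] (G : k[X][X]) (hs : Squarefree G)
    (hne : ∀ y, G.eval (C y) ≠ 0) {N : k[X][X]} (hN : N ≠ 0) (hGN : G ∣ N) (dx dy : ℕ)
    (hdx : ∀ i, (N.coeff i).natDegree ≤ dx) (hdy : N.natDegree ≤ dy) (S : Finset k) :
    ∑ y ∈ S, exc (G.eval (C y)) ≤ 2 * dx * dy := by
  have h1 := disc_bound (Bivariate.swap G) ?_ ?_ ?_ G.natDegree ?_ S
  · simp_rw [swap_map_eval] at h1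
    refine le_trans h1 (Nat.mul_le_mul ?_ ((natDegree_le_of_dvd hGN hN).trans hdy))
    have h2 : (Bivariate.swap G).natDegree ≤ (Bivariate.swap N).natDegree :=
      natDegree_le_of_dvd (swap_dvd hGN) (swap_ne hN)
    have h3 : (Bivariate.swap N).natDegree ≤ dx := by
      rw [natDegree_le_iff_coeff_eq_zero]
      intro i hi
      ext j
      rw [coeff_swap, coeff_zero]
      exact coeff_eq_zero_of_natDegree_lt ((hdx j).trans_lt hi)
    omega
  · intro x hx
    apply swap_isUnit
    apply hs
    have h3 := swap_dvd hx
    rwa [Bivariate.swap_swap_apply, _root_.map_mul] at h3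
  · intro c hc
    by_contra hu
    have hc0 : c.degree ≠ 0 := by
      intro h; exact hu (isUnit_iff_degree_eq_zero.2 h)
    obtain ⟨y, hy⟩ := IsAlgClosed.exists_root c hc0
    apply hne y
    rw [← swap_map_eval]
    obtain ⟨W, hW⟩ := hc
    rw [hW, Polynomial.map_mul, map_C, coe_evalRingHom, hy.eq_zero]; simp
  · intro y
    rw [swap_map_eval]; exact hne y
  · intro i
    rw [natDegree_le_iff_coeff_eq_zero]
    intro j hj
    rw [coeff_swap, coeff_eq_zero_of_natDegree_lt hj, coeff_zero]

end M3
end ArbPCF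

namespace ArbPCF
section M4
set_option linter.unusedSectionVars false
variable {k : Type*} [Field k]

open IsLocalRing

/-- Wronskian over a commutative ring -/
noncomputable def WrR {R : Type*} [CommRing R] (p q : R[X]) : R[X] :=
  derivative p * q - p * derivative q

section discs
variable (V : ValuationSubring k)

/-- congruence modulo the maximal ideal -/
def Cong (x y : k) : Prop := ∃ a b : V, (a : k) = x ∧ (b : k) = y ∧ residue V a = residue V b

/-- `f x` is a unit of `V` -/
def UnitAt (f : V[X]) (x : k) : Prop := ∃ a : V, (a : k) = x ∧ IsUnit (f.eval a)

variable {V}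

lemma residue_eval (f : V[X]) (a : V) :
    residue V (f.eval a) = (f.map (residue V)).eval (residue V a) := by
  rw [eval_map, eval₂_at_apply]

lemma coe_eval (f : V[X]) (a : V) :
    ((f.eval a : V) : k) = (f.map (algebraMap V k)).eval (a : k) := by
  rw [eval_map]
  exact (eval₂_at_apply (algebraMap V k) a).symm

lemma isUnit_iff_residue (a : V) : IsUnit a ↔ residue V a ≠ 0 := by
  rw [residue_ne_zero_iff_isUnit]

lemma Cong.symm {x y : k} (h : Cong V x y) : Cong V y x := by
  obtain ⟨a, b, h1, h2, h3⟩ := h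
  exact ⟨b, a, h2, h1, h3.symm⟩

lemma Cong.trans {x y z : k} (h : Cong V x y) (h' : Cong V y z) : Cong V x z := by
  obtain ⟨a, b, h1, h2, h3⟩ := h
  obtain ⟨b', c, h1', h2', h3'⟩ := h'
  have : b = b' := Subtype.ext (h2.trans h1'.symm)
  subst this
  exact ⟨a, c, h1, h2', h3.trans h3'⟩

lemma UnitAt.cong {f : V[X]} {x y : k} (h : UnitAt V f x) (hc : Cong V x y) : UnitAt V f y := by
  obtain ⟨a, ha, hu⟩ := h
  obtain ⟨a', b, h1, h2, h3⟩ := hc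
  have : a = a' := Subtype.ext (ha.trans h1.symm)
  subst this
  refine ⟨b, h2, ?_⟩
  rw [isUnit_iff_residue, residue_eval, ← h3, ← residue_eval, ← isUnit_iff_residue]
  exact hu

lemma UnitAt.ne {f : V[X]} {x : k} (h : UnitAt V f x) : (f.map (algebraMap V k)).eval x ≠ 0 := by
  obtain ⟨a, rfl, hu⟩ := h
  rw [← coe_eval]
  have := hu.ne_zero
  simpa using this

variable {p q : k[X]} {pV qV : V[X]} (hp : pV.map (algebraMap V k) = p)
  (hq : qV.map (algebraMap V k) = q)

include hp hq

lemma WrV : (WrR pV qV).map (algebraMap V k) = Wr p q := by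
  rw [WrR, Wr, ← hp, ← hq]
  simp [derivative_map]

lemma Cong.phi {x y : k} (h : Cong V x y) (hu : UnitAt V qV x) :
    UnitAt V qV y ∧ Cong V (phi p q x) (phi p q y) := by
  refine ⟨hu.cong h, ?_⟩
  obtain ⟨b, rfl, hub⟩ := hu.cong h
  obtain ⟨a, rfl, hua⟩ := hu
  obtain ⟨a', b', h1, h2, h3⟩ := h
  obtain rfl := Subtype.ext h1
  obtain rfl := Subtype.ext h2
  obtain ⟨u, hu⟩ := hua
  obtain ⟨v, hv⟩ := hub
  refine ⟨pV.eval a' * ↑u⁻¹, pV.eval b' * ↑v⁻¹, ?_, ?_, ?_⟩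
  · rw [ArbPCF.phi, ← hp, ← hq, ← coe_eval, ← coe_eval, ← hu]
    have : ((u : V) : k) ≠ 0 := by simp
    rw [eq_div_iff this, ← MulMemClass.coe_mul, mul_assoc, Units.inv_mul, mul_one]
  · rw [ArbPCF.phi, ← hp, ← hq, ← coe_eval, ← coe_eval, ← hv]
    have : ((v : V) : k) ≠ 0 := by simp
    rw [eq_div_iff this, ← MulMemClass.coe_mul, mul_assoc, Units.inv_mul, mul_one]
  · rw [map_mul, map_mul, residue_eval, residue_eval, h3]
    congr 1
    have h4 : residue V (u : V) = residue V v := by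
      rw [hu, hv, residue_eval, residue_eval, h3]
    have h5 : residue V (u : V) * residue V (↑u⁻¹ : V) = 1 := by rw [← map_mul]; simp
    have h6 : residue V (v : V) * residue V (↑v⁻¹ : V) = 1 := by rw [← map_mul]; simp
    rw [h4] at h5
    have h7 : residue V (v : V) ≠ 0 := left_ne_zero_of_mul_eq_one h6
    exact mul_left_cancel₀ h7 (h5.trans h6.symm)

lemma Cong.iter {x z : k} (h : Cong V x z) (n : ℕ)
    (hu : ∀ i < n, UnitAt V qV ((ArbPCF.phi p q)^[i] z)) :
    ∀ i ≤ n, Cong V ((ArbPCF.phi p q)^[i] x) ((ArbPCF.phi p q)^[i] z) := by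
  intro i
  induction i with
  | zero => intro _; exact h
  | succ i ih =>
    intro hi
    rw [Function.iterate_succ_apply', Function.iterate_succ_apply']
    exact ((ih (by omega)).symm.phi hp hq (hu i (by omega))).2.symm

lemma disc_inj {x y : k} (h : Cong V x y) (hu : UnitAt V qV x)
    (hw : UnitAt V (WrR pV qV) x) (he : ArbPCF.phi p q x = ArbPCF.phi p q y) : x = y := by
  have hqy := (hu.cong h).ne
  have hqx := hu.ne
  obtain ⟨a, rfl, hua⟩ := hu
  obtain ⟨a', b, h1, rfl, h3⟩ := h
  obtain rfl := Subtype.ext h1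
  obtain ⟨a'', h1', hw⟩ := hw
  obtain rfl := Subtype.ext h1'
  rw [ArbPCF.phi, ArbPCF.phi, ← hp, ← hq, div_eq_div_iff hqx hqy] at he
  simp only [← coe_eval] at he
  have he' : pV.eval a'' * qV.eval b = pV.eval b * qV.eval a'' := by exact_mod_cast he
  let F : V[X] := C (qV.eval a'') * pV - C (pV.eval a'') * qV
  have hF1 : F.eval a'' = 0 := by simp [F]; ring
  have hF2 : F.eval b = 0 := by
    simp only [F, eval_sub, eval_mul, eval_C]; linear_combination -he'
  have hF3 : F.derivative.eval a'' = (WrR pV qV).eval a'' := by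
    simp [F, WrR]; ring
  obtain ⟨r, hr⟩ := F.binomExpansion a'' (b - a'')
  rw [add_sub_cancel, hF1, hF2, hF3] at hr
  have h4 : (b - a'') * ((WrR pV qV).eval a'' + r * (b - a'')) = 0 := by linear_combination -hr
  rcases mul_eq_zero.1 h4 with h5 | h5
  · rw [sub_eq_zero.1 h5]
  · exfalso
    have h6 := congrArg (residue V) h5
    rw [map_add, map_mul, map_sub, h3, sub_self, mul_zero, add_zero, map_zero] at h6
    exact (isUnit_iff_residue _).1 hw h6

end discs

section ramif
variable {p q : k[X]}

lemma ram_le (hpq : Good p q) (x : k) : ram p q x ≤ p.natDegree := by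
  rw [ram, ← hpq.fib_natDegree (phi p q x), ← count_roots]
  exact (Multiset.count_le_card _ _).trans (card_roots' _)

lemma ram_eq_one (hpq : Good p q) {x : k} (hx : q.eval x ≠ 0) (hw : (Wr p q).eval x ≠ 0) :
    ram p q x = 1 := by
  have hx' : p.eval x = phi p q x * q.eval x := hpq.phi_eq_iff.1 ⟨hx, rfl⟩
  rw [hpq.Wr_eval hx'] at hw
  apply le_antisymm
  · by_contra h
    push Not at h
    have := (one_lt_rootMultiplicity_iff_isRoot (hpq.fib_ne _)).1 h
    exact hw (by rw [this.2.eq_zero, zero_mul])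
  · rw [ram, Nat.succ_le_iff, rootMultiplicity_pos (hpq.fib_ne _)]
    simp [hx']

lemma Lev_ncard_le (hpq : Good p q) (a : k) (n : ℕ) : (Lev p q a n).ncard ≤ p.natDegree ^ n := by
  induction n with
  | zero =>
    have : Lev p q a 0 = {a} := by ext x; exact mem_Lev_zero x
    simp [this]
  | succ n ih =>
    have hf := hpq.Lev_finite (a := a) n
    have hsub : Lev p q a (n+1) ⊆
        ((hf.toFinset.biUnion fun t => (p - C t * q).roots.toFinset : Finset k) : Set k) := by
      intro x hx
      rw [hpq.Lev_succ'] at hx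
      obtain ⟨t, ht, hx⟩ := hx
      rw [Finset.mem_coe, Finset.mem_biUnion]
      refine ⟨t, by simpa using ht, ?_⟩
      rw [Multiset.mem_toFinset]
      exact hpq.mem_fib.2 hx
    refine (Set.ncard_le_ncard hsub (Finset.finite_toSet _)).trans ?_
    rw [Set.ncard_coe_finset]
    refine (Finset.card_biUnion_le_card_mul _ _ p.natDegree ?_).trans ?_
    · intro t _
      refine (Multiset.toFinset_card_le _).trans ((card_roots' _).trans ?_)
      rw [hpq.fib_natDegree]
    · rw [pow_succ]
      apply Nat.mul_le_mul_right
      rwa [Set.ncard_eq_toFinset_card _ hf] at ih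

lemma ord_chain {T : ℕ → Set k} {Φ : k → k} [IsAlgClosed k] [CharZero k] (hpq : Good p q)
    (h : TreeData p q T Φ)
    {G : k[X][X]} (hG : G ≠ 0) (hvG : Van T Φ G) (hgen : ∀ F, Van T Φ F → G ∣ F)
    (n : ℕ) : ∀ {x y : k}, (∀ i < n, q.eval ((phi p q)^[i] x) ≠ 0) →
      (∀ i < n, q.eval ((phi p q)^[i] y) ≠ 0) →
    ordG G y x ≤ (∏ i ∈ Finset.range n, ram p q ((phi p q)^[i] x)) *
      ordG G ((phi p q)^[n] y) ((phi p q)^[n] x) := by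
  induction n with
  | zero => intro x y _ _; simp
  | succ n ih =>
    intro x y hx hy
    refine (ih (fun i hi => hx i (by omega)) (fun i hi => hy i (by omega))).trans ?_
    rw [Finset.prod_range_succ, mul_assoc]
    apply Nat.mul_le_mul_left
    rw [Function.iterate_succ_apply', Function.iterate_succ_apply']
    exact ord_le hpq h hG hvG hgen (hx n (by omega)) (hy n (by omega))

end ramif
end M4
end ArbPCF

namespace ArbPCF
section M4b
set_option linter.unusedSectionVars false
variable {k : Type*} [Field k] {V : ValuationSubring k}

open IsLocalRing

lemma map_V_inj : Function.Injective (Polynomial.map (algebraMap V k)) :=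
  map_injective _ (FaithfulSMul.algebraMap_injective V k)

lemma exists_root_disc [IsAlgClosed k] (B : V[X]) (hB : B.map (residue V) ≠ 0) (a : V)
    (ha : (B.map (residue V)).eval (residue V a) = 0) :
    ∃ r : V, B.eval r = 0 ∧ residue V r = residue V a := by
  by_contra hcon
  push Not at hcon
  apply hB
  set f := B.map (algebraMap V k) with hf
  have hsp : f = C f.leadingCoeff * (f.roots.map (fun r => X - C r)).prod :=
    (IsAlgClosed.splits f).eq_prod_roots
  have hout : ∀ r ∈ f.roots, (a : k) - r ≠ 0 ∧ ((a : k) - r)⁻¹ ∈ V := by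
    intro r hr
    have hr0 : f.eval r = 0 := by
      have := (mem_roots'.1 hr).2; exact this
    have h1 : ∀ hrV : (a : k) - r ∈ V, IsUnit (⟨_, hrV⟩ : V) := by
      intro hrV
      rw [isUnit_iff_residue]
      intro h0
      have hrV' : r ∈ V := by
        have := sub_mem a.2 hrV
        simpa using this
      apply hcon ⟨r, hrV'⟩
      · have : ((B.eval (⟨r, hrV'⟩ : V) : V) : k) = 0 := by rw [coe_eval]; exact hr0
        exact_mod_cast this
      · have : (⟨(a : k) - r, hrV⟩ : V) = a - ⟨r, hrV'⟩ := rfl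
        rw [this, map_sub, sub_eq_zero] at h0
        exact h0.symm
    by_cases hrV : (a : k) - r ∈ V
    · have hu := h1 hrV
      obtain ⟨u, hu⟩ := hu
      have hne : (a : k) - r ≠ 0 := by
        intro h0
        have : (u : V) = 0 := by rw [hu]; exact Subtype.ext h0
        exact u.ne_zero this
      refine ⟨hne, ?_⟩
      have h2 : ((↑u⁻¹ : V) : k) = ((a : k) - r)⁻¹ := by
        apply eq_inv_of_mul_eq_one_left
        have h3 : (↑u⁻¹ : V) * u = 1 := Units.inv_mul u
        have h4 := congrArg (fun x : V => (x : k)) h3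
        simpa [hu] using h4
      rw [← h2]; exact (↑u⁻¹ : V).2
    · refine ⟨?_, ?_⟩
      · intro h0; rw [h0] at hrV; exact hrV V.zero_mem
      · exact (V.mem_or_inv_mem _).resolve_left hrV
  have hprod : ∀ m : Multiset k, (∀ r ∈ m, (a : k) - r ≠ 0 ∧ ((a : k) - r)⁻¹ ∈ V) →
      ∃ E : V[X], (m.map (fun r => X - C r)).prod =
        C ((m.map (fun r => (a : k) - r)).prod) * E.map (algebraMap V k) := by
    intro m
    induction m using Multiset.induction_on with
    | empty => intro _; exact ⟨1, by simp⟩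
    | cons r m ih =>
      intro hm
      obtain ⟨E, hE⟩ := ih (fun r hr => hm r (Multiset.mem_cons_of_mem hr))
      obtain ⟨h1, h2⟩ := hm r (Multiset.mem_cons_self _ _)
      refine ⟨(1 + C ⟨_, h2⟩ * (X - C a)) * E, ?_⟩
      rw [Multiset.map_cons, Multiset.prod_cons, Multiset.map_cons, Multiset.prod_cons, hE]
      have h3 : (X - C r : k[X]) = C ((a : k) - r) *
          ((1 + C ⟨_, h2⟩ * (X - C a) : V[X]).map (algebraMap V k)) := by
        have h5 : (C ((a : k) - r) * C ((a : k) - r)⁻¹ : k[X]) = 1 := by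
          rw [← C_mul, mul_inv_cancel₀ h1, C_1]
        have h4 : ((1 + C ⟨_, h2⟩ * (X - C a) : V[X]).map (algebraMap V k)) =
            1 + C ((a : k) - r)⁻¹ * (X - C (a : k)) := by
          rw [Polynomial.map_add, Polynomial.map_mul, Polynomial.map_sub, map_C, map_C, map_X,
            Polynomial.map_one]
          rfl
        rw [h4, mul_add, ← mul_assoc, h5, C_sub]; ring
      rw [h3, Polynomial.map_mul, C_mul]; ring
  obtain ⟨E, hE⟩ := hprod _ hout
  have hfE : f = C (f.eval (a : k)) * E.map (algebraMap V k) := by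
    have h1 : f.eval (a : k) = f.leadingCoeff * ((f.roots.map (fun r => (a : k) - r)).prod) := by
      conv_lhs => rw [hsp]
      rw [eval_mul, eval_C, eval_multiset_prod, Multiset.map_map]
      congr 3
      ext r; simp
    rw [h1, C_mul, mul_assoc, ← hE]; exact hsp
  have hBE : B = C (B.eval a) * E := by
    apply map_V_inj
    rw [Polynomial.map_mul, map_C, ← hf]
    conv_lhs => rw [hfE]
    congr 2
    rw [hf, ← coe_eval]; rfl
  rw [hBE, Polynomial.map_mul, map_C, residue_eval, ha]; simp

lemma lift_roots [IsAlgClosed k] (Q : ℕ) (a : V) : ∀ (B : V[X]), B.map (residue V) ≠ 0 →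
    (X - C (residue V a)) ^ Q ∣ B.map (residue V) →
    ∃ R : Multiset V, R.card = Q ∧ (∀ r ∈ R, residue V r = residue V a) ∧
      (R.map (fun r => X - C r)).prod ∣ B := by
  induction Q with
  | zero => intro B _ _; exact ⟨0, by simp, by simp, by simp⟩
  | succ Q ih =>
    intro B hB hd
    obtain ⟨r, hr, hra⟩ := exists_root_disc B hB a (by
      obtain ⟨W, hW⟩ := hd
      rw [hW, pow_succ]; simp)
    obtain ⟨B', rfl⟩ := dvd_iff_isRoot.2 hr
    rw [Polynomial.map_mul] at hB hd
    have h1 : (X - C r : V[X]).map (residue V) = X - C (residue V a) := by simp [hra]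
    rw [h1, pow_succ'] at hd
    have h2 := (mul_dvd_mul_iff_left (X_sub_C_ne_zero (residue V a))).1 hd
    obtain ⟨R, hR1, hR2, hR3⟩ := ih B' (right_ne_zero_of_mul hB) h2
    refine ⟨r ::ₘ R, by simp [hR1], ?_, ?_⟩
    · intro r' hr'
      rcases Multiset.mem_cons.1 hr' with rfl | h
      · exact hra
      · exact hR2 _ h
    · rw [Multiset.map_cons, Multiset.prod_cons]
      exact mul_dvd_mul_left _ hR3

lemma disc_count [IsAlgClosed k] (Q : ℕ) (a : V) (B : V[X]) (hB : B.map (residue V) ≠ 0)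
    (hd : (X - C (residue V a)) ^ Q ∣ B.map (residue V)) :
    ∃ S : Finset k, (∀ x ∈ S, Cong V x a ∧ (B.map (algebraMap V k)).eval x = 0) ∧
      Q ≤ ∑ x ∈ S, (B.map (algebraMap V k)).rootMultiplicity x := by
  obtain ⟨R, hR1, hR2, hR3⟩ := lift_roots Q a B hB hd
  have hB0 : B.map (algebraMap V k) ≠ 0 := by
    intro h0
    have : B = 0 := map_V_inj (by rw [h0, Polynomial.map_zero])
    rw [this] at hB; simp at hB
  set R' := R.map (algebraMap V k) with hR'
  have hle : R' ≤ (B.map (algebraMap V k)).roots := by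
    have h1 : (R'.map (fun r => X - C r)).prod ∣ B.map (algebraMap V k) := by
      have := Polynomial.map_dvd (algebraMap V k) hR3
      rw [Polynomial.map_multiset_prod, Multiset.map_map] at this
      rw [hR', Multiset.map_map]
      refine (Eq.dvd ?_).trans this
      congr 1
      apply Multiset.map_congr rfl
      intro r _
      simp
    exact (Multiset.prod_X_sub_C_dvd_iff_le_roots hB0 R').1 h1
  refine ⟨R'.toFinset, ?_, ?_⟩
  · intro x hx
    rw [Multiset.mem_toFinset] at hx
    refine ⟨?_, (mem_roots'.1 (Multiset.mem_of_le hle hx)).2⟩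
    obtain ⟨r, hr, rfl⟩ := Multiset.mem_map.1 hx
    exact ⟨r, a, rfl, rfl, hR2 r hr⟩
  · have h1 : R'.card = Q := by rw [hR', Multiset.card_map, hR1]
    rw [← h1, ← Multiset.toFinset_sum_count_eq]
    apply Finset.sum_le_sum
    intro x _
    rw [← count_roots]
    exact Multiset.count_le_of_le x hle

lemma exists_scale (s : Finset k) (hs : ∃ x ∈ s, x ≠ 0) :
    ∃ μ : k, μ ≠ 0 ∧ (∀ x ∈ s, μ * x ∈ V) ∧ ∃ x ∈ s, μ * x = 1 := by
  obtain ⟨x, hx, hmax⟩ := s.exists_max_image V.valuation (by obtain ⟨x, hx, _⟩ := hs; exact ⟨x, hx⟩)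
  have hx0 : x ≠ 0 := by
    rintro rfl
    obtain ⟨y, hy, hy0⟩ := hs
    have := hmax y hy
    rw [map_zero, le_zero_iff, Valuation.zero_iff] at this
    exact hy0 this
  refine ⟨x⁻¹, inv_ne_zero hx0, ?_, x, hx, inv_mul_cancel₀ hx0⟩
  intro y hy
  rw [← V.valuation_le_one_iff, map_mul, map_inv₀]
  have h0 : 0 < V.valuation x := by
    rw [zero_lt_iff]; exact (Valuation.ne_zero_iff _).2 hx0
  rw [inv_mul_le_one₀ h0]
  exact hmax y hy

lemma exists_lift_biv (F : k[X][X]) (hF : ∀ i j, (F.coeff i).coeff j ∈ V) :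
    ∃ GV : V[X][X], GV.map (mapRingHom (algebraMap V k)) = F := by
  have : F ∈ lifts (mapRingHom (algebraMap V k)) := by
    rw [lifts_iff_coeff_lifts]
    intro i
    have h1 : F.coeff i ∈ lifts (algebraMap V k) := by
      rw [lifts_iff_coeff_lifts]
      intro j
      exact ⟨⟨_, hF i j⟩, rfl⟩
    obtain ⟨g, hg⟩ := h1
    exact ⟨g, hg⟩
  obtain ⟨g, hg⟩ := this
  exact ⟨g, hg⟩

lemma exists_prim_lift (G : k[X][X]) (hG : G ≠ 0) :
    ∃ (μ : k) (GV : V[X][X]), μ ≠ 0 ∧ GV.map (mapRingHom (algebraMap V k)) = C (C μ) * G ∧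
      GV.map (mapRingHom (residue V)) ≠ 0 := by
  let s : Finset k := G.support.biUnion fun i => (G.coeff i).support.image fun j => (G.coeff i).coeff j
  have hs : ∀ i j, (G.coeff i).coeff j ≠ 0 → (G.coeff i).coeff j ∈ s := by
    intro i j h
    simp only [s, Finset.mem_biUnion, mem_support_iff, Finset.mem_image]
    refine ⟨i, ?_, j, h, rfl⟩
    intro h0; rw [h0] at h; simp at h
  obtain ⟨μ, hμ, h1, h2⟩ := exists_scale (V := V) s (by
    refine ⟨(G.leadingCoeff).leadingCoeff, ?_, ?_⟩
    · exact hs _ _ (leadingCoeff_ne_zero.2 (leadingCoeff_ne_zero.2 hG))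
    · exact leadingCoeff_ne_zero.2 (leadingCoeff_ne_zero.2 hG))
  obtain ⟨GV, hGV⟩ := exists_lift_biv (V := V) (C (C μ) * G) (by
    intro i j
    rw [coeff_C_mul, coeff_C_mul]
    by_cases h : (G.coeff i).coeff j = 0
    · rw [h, mul_zero]; exact V.zero_mem
    · exact h1 _ (hs i j h))
  refine ⟨μ, GV, hμ, hGV, ?_⟩
  obtain ⟨x, hx, hx1⟩ := h2
  simp only [s, Finset.mem_biUnion, Finset.mem_image] at hx
  obtain ⟨i, _, j, _, rfl⟩ := hx
  intro h0
  have h3 : ((GV.coeff i).coeff j : k) = 1 := by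
    rw [← hx1, ← coeff_C_mul, ← coeff_C_mul, ← hGV]; simp
  have h4 : (GV.coeff i).coeff j = 1 := by exact_mod_cast h3
  have h5 := congrArg (fun f => (coeff f i).coeff j) h0
  simp [h4] at h5

end M4b
end ArbPCF

namespace ArbPCF
section M4c
set_option linter.unusedSectionVars false
variable {k : Type*} [Field k] {V : ValuationSubring k}

open IsLocalRing

lemma map_evalEval' {R S : Type*} [CommRing R] [CommRing S] (f : R →+* S) (F : R[X][X]) (x y : R) :
    (F.map (mapRingHom f)).evalEval (f x) (f y) = f (F.evalEval x y) := by
  rw [evalEval, evalEval, eval_map]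
  have h1 : C (f y) = mapRingHom f (C y) := by simp
  rw [h1, eval₂_at_apply, coe_mapRingHom, eval_map, eval₂_at_apply]

lemma map_eval_C' {R S : Type*} [CommRing R] [CommRing S] (f : R →+* S) (F : R[X][X]) (y : R) :
    (F.map (mapRingHom f)).eval (C (f y)) = (F.eval (C y)).map f := by
  rw [eval_map]
  have h1 : C (f y) = mapRingHom f (C y) := by simp
  rw [h1, eval₂_at_apply, coe_mapRingHom]

lemma exists_good_z [IsAlgClosed k] {p q : k[X]} {T : ℕ → Set k} {Φ : k → k}
    (h : TreeData p q T Φ) (Q : ℕ) (hQ : ∀ x y : (ResidueField V)[X], (x - y) ^ Q = x ^ Q - y ^ Q)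
    (hT : ∀ n, ∀ x ∈ T n, ∃ a b : V, (a : k) = x ∧ (b : k) = Φ x ∧ residue V b = residue V a ^ Q)
    (hTd : ∀ m n, ∀ x ∈ T m, ∀ y ∈ T n, Cong V x y → m = n)
    {G : k[X][X]} (hG : G ≠ 0) (hvG : Van T Φ G) (Z : Finset k)
    (hZc : G.natDegree < Z.card)
    (hZ : ∀ z ∈ Z, ∃ a : V, (a : k) = z ∧ residue V a ^ Q = residue V a)
    (hZd : ∀ z ∈ Z, ∀ z' ∈ Z, Cong V z z' → z = z') :
    ∃ z ∈ Z, ∃ S : Finset k, (∀ x ∈ S, Cong V x z ∧ 1 ≤ ordG G z x) ∧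
      Q ≤ ∑ x ∈ S, ordG G z x := by
  obtain ⟨μ, GV, hμ, hGV, hGbar⟩ := exists_prim_lift (V := V) G hG
  set Gb := GV.map (mapRingHom (residue V)) with hGb
  obtain ⟨n0, hn0⟩ := hvG
  have h1 : Gb.eval (X ^ Q) = 0 := by
    choose t ht using h.ne
    choose a b ha hb hab using hT
    apply eq_zero_of_infinite_isRoot
    refine Set.infinite_of_injective_forall_mem (f := fun n : ℕ => residue V (a (n0 + n) _ (ht (n0+n)))) ?_ ?_
    · intro m n hmn
      have := hTd (n0 + m) (n0 + n) _ (ht _) _ (ht _) ⟨_, _, ha _ _ (ht _), ha _ _ (ht _), hmn⟩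
      omega
    · intro n
      have h2 := hn0 (n0 + n) (by omega) _ (ht _)
      have h3 : (GV.map (mapRingHom (algebraMap V k))).evalEval (t (n0+n)) (Φ (t (n0+n))) = 0 := by
        rw [hGV, evalEval, eval_mul, eval_C, eval_mul, eval_C]
        rw [evalEval] at h2
        rw [h2, mul_zero]
      have h4 := map_evalEval' (algebraMap V k) GV (a _ _ (ht (n0+n))) (b _ _ (ht (n0+n)))
      have h5 : GV.evalEval (a _ _ (ht (n0+n))) (b _ _ (ht (n0+n))) = 0 := by
        apply FaithfulSMul.algebraMap_injective V k
        rw [← h4, map_zero]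
        change evalEval ((a _ _ (ht (n0+n)) : V) : k) ((b _ _ (ht (n0+n)) : V) : k) _ = 0
        rw [ha, hb]; exact h3
      have h6 := map_evalEval' (residue V) GV (a _ _ (ht (n0+n))) (b _ _ (ht (n0+n)))
      rw [h5, map_zero, hab] at h6
      change eval _ _ = 0
      rw [evalEval, ← coe_evalRingHom, ← eval₂_at_apply] at h6
      rw [← coe_evalRingHom, ← eval₂_at_apply]
      simpa using h6
  obtain ⟨H, hH⟩ := dvd_iff_isRoot.2 (show Gb.IsRoot (X ^ Q) from h1)
  have hdeg : Gb.natDegree < Z.card := by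
    refine lt_of_le_of_lt ?_ hZc
    have h2 : G.natDegree = GV.natDegree := by
      have h3 := congrArg natDegree hGV
      rw [natDegree_C_mul (by simpa using hμ), natDegree_map_eq_of_injective] at h3
      · exact h3.symm
      · exact map_V_inj
    rw [h2]; exact natDegree_map_le
  choose! a ha haQ using hZ
  have h2 : ∃ z ∈ Z, Gb.eval (C (residue V (a z))) ≠ 0 := by
    by_contra hcon
    push Not at hcon
    apply hGbar
    apply eq_zero_of_natDegree_lt_card_of_eval_eq_zero' Gb (Z.image fun z => C (residue V (a z)))
    · intro i hi
      obtain ⟨z, hz, rfl⟩ := Finset.mem_image.1 hi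
      exact hcon z hz
    · rw [Finset.card_image_of_injOn]
      · exact hdeg
      · intro z hz z' hz' he
        have he' : residue V (a z) = residue V (a z') := C_injective he
        exact hZd z hz z' hz' ⟨_, _, ha z hz, ha z' hz', he'⟩
  obtain ⟨z, hz, hne⟩ := h2
  refine ⟨z, hz, ?_⟩
  have h3 : (GV.eval (C (a z))).map (residue V) = Gb.eval (C (residue V (a z))) :=
    (map_eval_C' _ _ _).symm
  have h4 : (GV.eval (C (a z))).map (algebraMap V k) = C μ * G.eval (C z) := by
    have := map_eval_C' (algebraMap V k) GV (a z)
    rw [← this, hGV, eval_mul, eval_C]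
    congr 3
    exact ha z hz
  obtain ⟨S, hS1, hS2⟩ := disc_count Q (a z) (GV.eval (C (a z))) (by rwa [h3]) (by
    rw [h3, hH, eval_mul, eval_sub, eval_X, eval_C, hQ, ← C_pow, haQ z hz]
    apply Dvd.dvd.mul_right
    rw [← neg_sub, neg_dvd])
  have h5 : ∀ x, (C μ * G.eval (C z)).rootMultiplicity x = ordG G z x := by
    intro x
    rw [ordG, ← count_roots, ← count_roots, roots_C_mul _ hμ]
  have hGz : G.eval (C z) ≠ 0 := by
    intro h0
    rw [h0, mul_zero] at h4
    rw [← h3] at hne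
    apply hne
    rw [map_V_inj (a₁ := GV.eval (C (a z))) (a₂ := 0) (by rw [h4, Polynomial.map_zero]), Polynomial.map_zero]
  rw [h4] at hS1 hS2
  refine ⟨S, ?_, ?_⟩
  · intro x hx
    obtain ⟨h6, h7⟩ := hS1 x hx
    rw [ha z hz] at h6
    refine ⟨h6, ?_⟩
    rw [ordG, Nat.succ_le_iff, rootMultiplicity_pos hGz]
    rw [eval_mul, eval_C] at h7
    exact (mul_eq_zero.1 h7).resolve_left hμ
  · simpa only [h5] using hS2

lemma disc_iter_inj {p q : k[X]} {pV qV : V[X]} (hp : pV.map (algebraMap V k) = p)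
    (hq : qV.map (algebraMap V k) = q) (n : ℕ) : ∀ {w x y : k}, Cong V x w → Cong V y w →
    (∀ i < n, UnitAt V qV ((phi p q)^[i] w)) → (∀ i < n, UnitAt V (WrR pV qV) ((phi p q)^[i] w)) →
    (phi p q)^[n] x = (phi p q)^[n] y → x = y := by
  induction n with
  | zero => intro w x y _ _ _ _ h; exact h
  | succ n ih =>
    intro w x y hx hy hu hw he
    rw [Function.iterate_succ_apply, Function.iterate_succ_apply] at he
    have hu0 := hu 0 (by omega)
    have hw0 := hw 0 (by omega)
    have h1 := ih (hx.symm.phi hp hq hu0).2.symm (hy.symm.phi hp hq hu0).2.symm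
      (fun i hi => hu (i+1) (by omega)) (fun i hi => hw (i+1) (by omega)) he
    exact disc_inj hp hq (hx.trans hy.symm) (hu0.cong hx.symm) (hw0.cong hx.symm) h1

theorem main_ineq [IsAlgClosed k] [CharZero k] {p q : k[X]} (hpq : Good p q)
    {pV qV : V[X]} (hp : pV.map (algebraMap V k) = p)
    (hq : qV.map (algebraMap V k) = q) {T : ℕ → Set k} {Φ : k → k}
    (h : TreeData p q T Φ) (Q : ℕ) (hQ : ∀ x y : (ResidueField V)[X], (x - y) ^ Q = x ^ Q - y ^ Q)
    (hT : ∀ n, ∀ x ∈ T n, ∃ a b : V, (a : k) = x ∧ (b : k) = Φ x ∧ residue V b = residue V a ^ Q)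
    (hTd : ∀ m n, ∀ x ∈ T m, ∀ y ∈ T n, Cong V x y → m = n)
    {N : k[X][X]} (hN : N ≠ 0) (hvN : Van T Φ N) (dx dy : ℕ)
    (hdx : ∀ i, (N.coeff i).natDegree ≤ dx) (hdy : N.natDegree ≤ dy)
    (Z : Finset k) (hZc : dy < Z.card)
    (hZ : ∀ z ∈ Z, ∃ a : V, (a : k) = z ∧ residue V a ^ Q = residue V a)
    (hZd : ∀ z ∈ Z, ∀ z' ∈ Z, Cong V z z' → z = z')
    (j0 N' : ℕ) (c : k) (hZj : ∀ z ∈ Z, (phi p q)^[j0] z = c)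
    (hZq : ∀ z ∈ Z, ∀ i < j0, UnitAt V qV ((phi p q)^[i] z))
    (hcW : (Wr p q).eval c = 0) (hcq : ∀ i ≤ N', UnitAt V qV ((phi p q)^[i] c))
    (hcu : ∀ i, 1 ≤ i → i ≤ N' → UnitAt V (WrR pV qV) ((phi p q)^[i] c))
    (hci : ∀ m n, (phi p q)^[m] c = (phi p q)^[n] c → m = n) :
    N' * Q ≤ p.natDegree ^ (2 * (j0 + 1)) *
      (4 * dx * dy + N' * ((2 * p.natDegree - 2) * (j0 + 1))) := by
  obtain ⟨G, hG, hvG, hgen⟩ := h.exists_gen hN hvN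
  have hGN := hgen N hvN
  have hGd : G.natDegree ≤ dy := (natDegree_le_of_dvd hGN hN).trans hdy
  obtain ⟨z, hz, S, hS, hSQ⟩ := exists_good_z h Q hQ hT hTd hG hvG Z (by omega) hZ hZd
  set d := p.natDegree with hd
  set J := j0 + 1 with hJ
  set φ := phi p q with hφ
  have hzc : ∀ i, φ^[i + j0] z = φ^[i] c := by
    intro i; rw [Function.iterate_add_apply, hZj z hz]
  have hzq : ∀ i < j0 + N' + 1, UnitAt V qV (φ^[i] z) := by
    intro i hi
    by_cases h1 : i < j0
    · exact hZq z hz i h1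
    · obtain ⟨j, rfl⟩ : ∃ j, i = j + j0 := ⟨i - j0, by omega⟩
      rw [hzc]; exact hcq j (by omega)
  have hxc : ∀ x ∈ S, ∀ i ≤ j0 + N' + 1, Cong V (φ^[i] x) (φ^[i] z) := by
    intro x hx
    exact (hS x hx).1.iter hp hq _ hzq
  have hxq : ∀ x ∈ S, ∀ i < j0 + N' + 1, q.eval (φ^[i] x) ≠ 0 := by
    intro x hx i hi
    have := ((hzq i hi).cong (hxc x hx i hi.le).symm).ne
    rwa [hq] at this
  have hzq' : ∀ i < j0 + N' + 1, q.eval (φ^[i] z) ≠ 0 := by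
    intro i hi
    have := (hzq i hi).ne
    rwa [hq] at this
  set m : k → ℕ := fun u => ordG G (φ^[J] z) u with hm
  have B1 : ∀ x ∈ S, 2 * ordG G z x ≤ (∏ i ∈ Finset.range J, ram p q (φ^[i] x)) * m (φ^[J] x) := by
    intro x hx
    have h1 := ord_chain hpq h hG hvG hgen j0 (x := x) (y := z)
      (fun i hi => hxq x hx i (by omega)) (fun i hi => hzq' i (by omega))
    have h2 := ord_le_crit hpq h hG hvG hgen (x0 := φ^[j0] x) (hxq x hx j0 (by omega))
      (y := φ^[j0] z) (hzq' j0 (by omega)) (by rw [hZj z hz]; exact hcW)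
    rw [hJ, Finset.prod_range_succ, mul_assoc, hm]
    simp only [hJ, Function.iterate_succ_apply']
    calc 2 * ordG G z x ≤ 2 * (_ * _) := Nat.mul_le_mul_left 2 h1
      _ = _ * (2 * _) := by ring
      _ ≤ _ := Nat.mul_le_mul_left _ h2
  have hprod : ∀ x, (∏ i ∈ Finset.range J, ram p q (φ^[i] x)) ≤ d ^ J := by
    intro x
    refine (Finset.prod_le_pow_card _ _ d (fun i _ => ram_le hpq _)).trans ?_
    rw [Finset.card_range]
  have hd1 : 1 ≤ d ^ J := Nat.one_le_pow _ _ (by have := hpq.two_le; omega)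
  set E : Finset k := ((Wr p q).roots.toFinset ×ˢ Finset.range J).image
    (fun w => φ^[J - w.2] w.1) with hE
  have hEc : E.card ≤ (2 * d - 2) * J := by
    refine Finset.card_image_le.trans ?_
    rw [Finset.card_product, Finset.card_range]
    apply Nat.mul_le_mul_right
    exact (Multiset.toFinset_card_le _).trans ((card_roots' _).trans hpq.Wr_natDegree)
  have B2 : ∀ x ∈ S, ordG G z x ≤ d ^ J *
      (2 * (m (φ^[J] x) - 1) + if φ^[J] x ∈ E then 1 else 0) := by
    intro x hx
    have h1 := B1 x hx
    have h0 := (hS x hx).2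
    by_cases hw : ∀ i < J, (Wr p q).eval (φ^[i] x) ≠ 0
    · have h2 : (∏ i ∈ Finset.range J, ram p q (φ^[i] x)) = 1 := by
        apply Finset.prod_eq_one
        intro i hi
        rw [Finset.mem_range] at hi
        exact ram_eq_one hpq (hxq x hx i (by omega)) (hw i hi)
      rw [h2, one_mul] at h1
      refine le_trans ?_ (Nat.mul_le_mul hd1 (Nat.le_add_right _ _))
      omega
    · push Not at hw
      obtain ⟨i, hi, hw⟩ := hw
      have h2 : φ^[J] x ∈ E := by
        rw [hE, Finset.mem_image]
        refine ⟨(φ^[i] x, i), ?_, ?_⟩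
        · rw [Finset.mem_product, Multiset.mem_toFinset, mem_roots hpq.Wr_ne, Finset.mem_range]
          exact ⟨hw, hi⟩
        · change φ^[J - i] (φ^[i] x) = _
          rw [← Function.iterate_add_apply, Nat.sub_add_cancel hi.le]
      rw [if_pos h2]
      have h3 : 2 * ordG G z x ≤ d ^ J * m (φ^[J] x) := h1.trans (Nat.mul_le_mul_right _ (hprod x))
      have h4 : 1 ≤ m (φ^[J] x) := by
        rw [Nat.succ_le_iff, Nat.pos_iff_ne_zero]
        intro h5; rw [h5] at h3; omega
      refine le_trans (by omega) (h3.trans (Nat.mul_le_mul_left _ ?_))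
      omega
  set U := S.image (φ^[J]) with hU
  set Xs := ∑ u ∈ U, (m u - 1) with hXs
  have B3 : Q ≤ d ^ (2 * J) * (2 * Xs + (2 * d - 2) * J) := by
    refine hSQ.trans ((Finset.sum_le_sum B2).trans ?_)
    rw [← Finset.sum_fiberwise_of_maps_to (t := U) (g := φ^[J])
      (fun x hx => Finset.mem_image_of_mem _ hx)]
    have h1 : ∀ u ∈ U, (∑ x ∈ S with φ^[J] x = u, d ^ J *
        (2 * (m (φ^[J] x) - 1) + if φ^[J] x ∈ E then 1 else 0)) ≤
        d ^ J * (d ^ J * (2 * (m u - 1) + if u ∈ E then 1 else 0)) := by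
      intro u _
      rw [Finset.sum_congr rfl (g := fun _ => d ^ J * (2 * (m u - 1) + if u ∈ E then 1 else 0))
        (by intro x hx; rw [(Finset.mem_filter.1 hx).2])]
      rw [Finset.sum_const, smul_eq_mul]
      apply Nat.mul_le_mul_right
      refine le_trans ?_ (Lev_ncard_le hpq u J)
      rw [← Set.ncard_coe_finset]
      apply Set.ncard_le_ncard _ (hpq.Lev_finite _)
      intro x hx
      rw [Finset.mem_coe, Finset.mem_filter] at hx
      exact (mem_Lev_iff J x).2 ⟨fun i hi => hxq x hx.1 i (by omega), hx.2⟩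
    refine (Finset.sum_le_sum h1).trans ?_
    rw [← Finset.mul_sum, ← Finset.mul_sum, ← mul_assoc, ← pow_add, ← two_mul]
    apply Nat.mul_le_mul_left
    rw [Finset.sum_add_distrib, ← Finset.mul_sum]
    apply Nat.add_le_add_left
    refine le_trans ?_ hEc
    rw [Finset.sum_boole, Nat.cast_id]
    exact Finset.card_le_card (fun x hx => (Finset.mem_filter.1 hx).2)
  have hUc : ∀ u ∈ U, Cong V u (φ^[J] z) := by
    intro u hu
    obtain ⟨x, hx, rfl⟩ := Finset.mem_image.1 hu
    by_cases hN0 : N' = 0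
    · exact hxc x hx J (by omega)
    · exact hxc x hx J (by omega)
  have B4 : ∀ n < N', Xs ≤ exc (G.eval (C (φ^[n + J] z))) := by
    intro n hn
    have e1 : ∀ i, φ^[i] (φ^[J] z) = φ^[i + 1] c := by
      intro i
      rw [← Function.iterate_add_apply, hJ, ← hzc, add_assoc, add_comm 1 j0]
    have u1 : ∀ i < n, UnitAt V qV (φ^[i] (φ^[J] z)) := by
      intro i hi; rw [e1]; exact hcq _ (by omega)
    have u2 : ∀ i < n, UnitAt V (WrR pV qV) (φ^[i] (φ^[J] z)) := by
      intro i hi; rw [e1]; exact hcu _ (by omega) (by omega)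
    have hinj : ∀ u ∈ U, ∀ u' ∈ U, φ^[n] u = φ^[n] u' → u = u' := by
      intro u hu u' hu' he
      exact disc_iter_inj hp hq n (hUc u hu) (hUc u' hu') u1 u2 he
    have hmm : ∀ u ∈ U, m u ≤ ordG G (φ^[n + J] z) (φ^[n] u) := by
      intro u hu
      have c1 := (hUc u hu).iter hp hq n u1
      have c2 : ∀ i < n, q.eval (φ^[i] u) ≠ 0 := by
        intro i hi
        have := ((u1 i hi).cong (c1 i hi.le).symm).ne
        rwa [hq] at this
      have c3 : ∀ i < n, q.eval (φ^[i] (φ^[J] z)) ≠ 0 := by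
        intro i hi
        have := (u1 i hi).ne
        rwa [hq] at this
      have h1 := ord_chain hpq h hG hvG hgen n c2 c3
      rw [Finset.prod_eq_one, one_mul, ← Function.iterate_add_apply] at h1
      · exact h1
      · intro i hi
        rw [Finset.mem_range] at hi
        apply ram_eq_one hpq (c2 i hi)
        have := ((u2 i hi).cong (c1 i hi.le).symm).ne
        rwa [WrV hp hq] at this
    calc Xs ≤ ∑ u ∈ U, (ordG G (φ^[n + J] z) (φ^[n] u) - 1) := by
          apply Finset.sum_le_sum
          intro u hu
          have := hmm u hu
          omega
      _ = ∑ v ∈ U.image φ^[n], (ordG G (φ^[n + J] z) v - 1) := by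
          exact (Finset.sum_image (f := fun v => ordG G (φ^[n + J] z) v - 1)
            (fun u hu u' hu' he => hinj u hu u' hu' he)).symm
      _ ≤ exc (G.eval (C (φ^[n + J] z))) := by
          rw [exc]
          apply Finset.sum_le_sum_of_ne_zero
          intro v _ hv
          rw [Multiset.mem_toFinset, ← Multiset.count_pos, count_roots]
          change 0 < ordG G (φ^[n + J] z) v
          omega
  have hne : ∀ y, G.eval (C y) ≠ 0 := h.gen_eval_C_ne hG hvG hgen
  have B5 : N' * Xs ≤ 2 * dx * dy := by
    have h1 := gen_disc_bound G (h.gen_squarefree hG hvG hgen) hne hN hGN dx dy hdx hdy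
      ((Finset.range N').image (fun n => φ^[n + J] z))
    rw [Finset.sum_image] at h1
    · refine le_trans ?_ h1
      have := Finset.card_nsmul_le_sum (Finset.range N')
        (fun n => exc (G.eval (C (φ^[n + J] z)))) Xs (fun n hn => B4 n (Finset.mem_range.1 hn))
      rwa [Finset.card_range, smul_eq_mul] at this
    · intro a _ b _ hab
      have e1 : ∀ i, φ^[i + J] z = φ^[i + 1] c := by
        intro i
        rw [hJ, ← hzc, add_assoc, add_comm 1 j0]
      simp only [e1] at hab
      have := hci _ _ hab
      omega
  calc N' * Q ≤ N' * (d ^ (2 * J) * (2 * Xs + (2 * d - 2) * J)) := Nat.mul_le_mul_left _ B3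
    _ = d ^ (2 * J) * (2 * (N' * Xs) + N' * ((2 * d - 2) * J)) := by ring
    _ ≤ _ := by
      apply Nat.mul_le_mul_left
      apply Nat.add_le_add_right
      calc 2 * (N' * Xs) ≤ 2 * (2 * dx * dy) := Nat.mul_le_mul_left _ B5
        _ = 4 * dx * dy := by ring

end M4c
end ArbPCF

namespace ArbPCF
section M5a
set_option linter.unusedSectionVars false

/-- homogenized evaluation -/
noncomputable def hE {R : Type*} [CommRing R] (f : R[X]) (d : ℕ) (A B : R[X]) : R[X] :=
  ∑ j ∈ Finset.range (d + 1), C (f.coeff j) * A ^ j * B ^ (d - j)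

/-- homogenized iterates -/
noncomputable def AB {R : Type*} [CommRing R] (p q : R[X]) (d : ℕ) : ℕ → R[X] × R[X]
  | 0 => (X, 1)
  | i + 1 => (hE p d (AB p q d i).1 (AB p q d i).2, hE q d (AB p q d i).1 (AB p q d i).2)

noncomputable def Ne {R : Type*} [CommRing R] (p q : R[X]) {d k : ℕ} (ε : Fin k → Fin d) : R[X] :=
  ∏ i : Fin k, (AB p q d i).1 ^ (ε i : ℕ) * (AB p q d i).2 ^ (d - 1 - (ε i : ℕ))

noncomputable def NN {R : Type*} [CommRing R] (p q : R[X]) {d k l : ℕ}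
    (n : (Fin k → Fin d) × (Fin l → Fin d) → ℤ) : R[X][X] :=
  ∑ e, (n e : R[X][X]) * (C (Ne p q e.1) * (Ne p q e.2).map C)

variable {R S : Type*} [CommRing R] [CommRing S] (f : R →+* S) (p q : R[X])

lemma hE_map (g : R[X]) (d : ℕ) (A B : R[X]) :
    (hE g d A B).map f = hE (g.map f) d (A.map f) (B.map f) := by
  simp [hE, Polynomial.map_sum]

lemma AB_map (d i : ℕ) :
    (AB (p.map f) (q.map f) d i) = ((AB p q d i).1.map f, (AB p q d i).2.map f) := by
  induction i with
  | zero => simp [AB]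
  | succ i ih => simp only [AB, ih, hE_map]

lemma Ne_map {d k : ℕ} (ε : Fin k → Fin d) : Ne (p.map f) (q.map f) ε = (Ne p q ε).map f := by
  simp [Ne, Polynomial.map_prod, AB_map]

lemma NN_map {d k l : ℕ} (n : (Fin k → Fin d) × (Fin l → Fin d) → ℤ) :
    NN (p.map f) (q.map f) n = (NN p q n).map (mapRingHom f) := by
  simp only [NN, Polynomial.map_sum, Polynomial.map_mul, Polynomial.map_intCast, map_C,
    coe_mapRingHom, Ne_map, Polynomial.map_map]
  apply Finset.sum_congr rfl
  intro e _
  congr 3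
  ext x : 1
  simp

lemma hE_deg {g A B : R[X]} {d m : ℕ} (hA : A.natDegree ≤ m) (hB : B.natDegree ≤ m) :
    (hE g d A B).natDegree ≤ d * m := by
  rw [hE]
  apply natDegree_sum_le_of_forall_le
  intro j hj
  have hj : j ≤ d := by simpa [Nat.lt_succ_iff] using hj
  calc _ ≤ (C (g.coeff j)).natDegree + j * m + (d - j) * m := by
        refine natDegree_mul_le_of_le (natDegree_mul_le_of_le le_rfl ?_) ?_
        · exact natDegree_pow_le_of_le _ hA
        · exact natDegree_pow_le_of_le _ hB
    _ = d * m := by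
        rw [natDegree_C, zero_add, ← add_mul]
        congr 1
        omega

lemma AB_deg (d i : ℕ) : (AB p q d i).1.natDegree ≤ d ^ i ∧ (AB p q d i).2.natDegree ≤ d ^ i := by
  induction i with
  | zero => exact ⟨by simpa [AB] using natDegree_X_le, by simp [AB]⟩
  | succ i ih =>
    rw [pow_succ, mul_comm]
    exact ⟨hE_deg ih.1 ih.2, hE_deg ih.1 ih.2⟩

lemma Ne_deg {d k : ℕ} (hd : 1 ≤ d) (ε : Fin k → Fin d) : (Ne p q ε).natDegree + 1 ≤ d ^ k := by
  have h1 : (Ne p q ε).natDegree ≤ ∑ i : Fin k, (d - 1) * d ^ (i : ℕ) := by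
    rw [Ne]
    refine (natDegree_prod_le _ _).trans (Finset.sum_le_sum fun i _ => ?_)
    have hε : (ε i : ℕ) + (d - 1 - ε i) = d - 1 := by have := (ε i).2; omega
    calc _ ≤ (ε i : ℕ) * d ^ (i : ℕ) + (d - 1 - ε i) * d ^ (i : ℕ) :=
          natDegree_mul_le_of_le (natDegree_pow_le_of_le _ (AB_deg p q d i).1)
            (natDegree_pow_le_of_le _ (AB_deg p q d i).2)
      _ = _ := by rw [← add_mul, hε]
  have h2 : ∀ k, ∑ i : Fin k, (d - 1) * d ^ (i : ℕ) + 1 = d ^ k := by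
    intro k
    rw [Fin.sum_univ_eq_sum_range (fun i => (d - 1) * d ^ i)]
    induction k with
    | zero => simp
    | succ k ih =>
      rw [Finset.sum_range_succ, add_right_comm, ih, pow_succ]
      obtain ⟨e, rfl⟩ := Nat.exists_eq_add_of_le hd
      simp; ring
  have := h2 k
  omega

lemma NN_evalEval {d k l : ℕ} (n : (Fin k → Fin d) × (Fin l → Fin d) → ℤ) (x y : R) :
    (NN p q n).evalEval x y = ∑ e, (n e : R) * ((Ne p q e.1).eval x * (Ne p q e.2).eval y) := by
  simp only [NN, evalEval, eval_finsetSum, eval_mul, eval_C, eval_intCast]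
  apply Finset.sum_congr rfl
  intro e _
  congr 2
  rw [eval_map, eval₂_at_apply, eval_C]

lemma NN_coeff_deg {d k l : ℕ} (hd : 1 ≤ d) (n : (Fin k → Fin d) × (Fin l → Fin d) → ℤ) (i : ℕ) :
    ((NN p q n).coeff i).natDegree ≤ d ^ k - 1 := by
  rw [NN, finsetSum_coeff]
  apply natDegree_sum_le_of_forall_le
  intro e _
  rw [← C_eq_intCast, coeff_C_mul, coeff_C_mul, coeff_map]
  refine (natDegree_mul_le_of_le (natDegree_intCast _).le
    (natDegree_mul_le_of_le le_rfl (natDegree_C _).le)).trans ?_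
  have := Ne_deg p q hd e.1
  omega

lemma NN_deg {d k l : ℕ} (hd : 1 ≤ d) (n : (Fin k → Fin d) × (Fin l → Fin d) → ℤ) :
    (NN p q n).natDegree ≤ d ^ l - 1 := by
  rw [NN]
  apply natDegree_sum_le_of_forall_le
  intro e _
  refine (natDegree_mul_le_of_le (natDegree_intCast _).le
    (natDegree_mul_le_of_le (natDegree_C _).le natDegree_map_le)).trans ?_
  have := Ne_deg p q hd e.2
  omega

lemma NN_sub {d k l : ℕ} (n n' : (Fin k → Fin d) × (Fin l → Fin d) → ℤ) :
    NN p q (n - n') = NN p q n - NN p q n' := by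
  simp [NN, sub_mul]

end M5a

section M5a2
set_option linter.unusedSectionVars false
variable {k : Type*} [Field k] {p q : k[X]}

lemma hE_eval {g A B : k[X]} {d : ℕ} (hg : g.natDegree ≤ d) {x : k} (hB : B.eval x ≠ 0) :
    (hE g d A B).eval x = B.eval x ^ d * g.eval (A.eval x / B.eval x) := by
  rw [hE, eval_finsetSum, eval_eq_sum_range' (Nat.lt_succ_of_le hg), Finset.mul_sum]
  apply Finset.sum_congr rfl
  intro j hj
  have hj : j ≤ d := by simpa [Nat.lt_succ_iff] using hj
  simp only [eval_mul, eval_C, eval_pow, div_pow]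
  rw [← pow_sub_mul_pow _ hj]
  field_simp

/-- values of the homogenized iterates -/
lemma Good.AB_eval (h : Good p q) (x : k) (n : ℕ) (hx : ∀ i < n, q.eval ((phi p q)^[i] x) ≠ 0) :
    (AB p q p.natDegree n).2.eval x ≠ 0 ∧
    (AB p q p.natDegree n).1.eval x =
      (phi p q)^[n] x * (AB p q p.natDegree n).2.eval x := by
  induction n with
  | zero => simp [AB]
  | succ n ih =>
    obtain ⟨h1, h2⟩ := ih (fun i hi => hx i (by omega))
    have h3 : (AB p q p.natDegree n).1.eval x / (AB p q p.natDegree n).2.eval x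
        = (phi p q)^[n] x := by rw [h2]; field_simp
    have hq := hx n (by omega)
    simp only [AB]
    rw [hE_eval h.lt.le h1, hE_eval le_rfl h1, h3, Function.iterate_succ_apply']
    refine ⟨mul_ne_zero (pow_ne_zero _ h1) hq, ?_⟩
    rw [phi]; field_simp

lemma Good.AB2_succ (h : Good p q) (x : k) (n : ℕ)
    (hx : ∀ i < n, q.eval ((phi p q)^[i] x) ≠ 0) :
    (AB p q p.natDegree (n+1)).2.eval x =
      (AB p q p.natDegree n).2.eval x ^ p.natDegree * q.eval ((phi p q)^[n] x) := by
  obtain ⟨h1, h2⟩ := h.AB_eval x n hx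
  have h3 : (AB p q p.natDegree n).1.eval x / (AB p q p.natDegree n).2.eval x
        = (phi p q)^[n] x := by rw [h2]; field_simp
  simp only [AB]
  rw [hE_eval h.lt.le h1, h3]

lemma Good.Ne_eval (h : Good p q) (x : k) (n : ℕ) (hx : ∀ i < n, q.eval ((phi p q)^[i] x) ≠ 0)
    (ε : Fin n → Fin p.natDegree) :
    (Ne p q ε).eval x = (∏ i : Fin n, (AB p q p.natDegree i).2.eval x ^ (p.natDegree - 1)) *
      ∏ i : Fin n, ((phi p q)^[i] x) ^ (ε i : ℕ) := by
  rw [Ne, eval_prod, ← Finset.prod_mul_distrib]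
  apply Finset.prod_congr rfl
  intro i _
  obtain ⟨h1, h2⟩ := h.AB_eval x i (fun j hj => hx j (by omega))
  have hε : p.natDegree - 1 = (p.natDegree - 1 - ε i) + ε i := by have := (ε i).2; omega
  rw [eval_mul, eval_pow, eval_pow, h2, mul_pow]
  conv_rhs => rw [hε, pow_add]
  ring

lemma Good.indep (h : Good p q) [IsAlgClosed k] [CharZero k] (n : ℕ) :
    ∀ (c : (Fin n → Fin p.natDegree) → k) (S : Set k), S.Finite →
    (∀ x ∉ S, ∑ ε, c ε * ∏ i : Fin n, ((phi p q)^[i] x) ^ (ε i : ℕ) = 0) → c = 0 := by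
  induction n with
  | zero =>
    intro c S hS hc
    obtain ⟨x, hx⟩ := hS.infinite_compl.nonempty
    have := hc x hx
    funext ε
    have e1 : ε = default := Subsingleton.elim _ _
    simpa [e1] using this
  | succ n ih =>
    intro c S hS hc
    have key : ∀ a : Fin p.natDegree, (fun ε' : Fin n → Fin p.natDegree => c (Fin.cons a ε')) = 0 := by
      intro a0
      have hWf : {x | (Wr p q).eval x = 0}.Finite := by
        refine ((Wr p q).roots.toFinset.finite_toSet).subset ?_
        intro x hx
        simpa [Polynomial.mem_roots h.Wr_ne] using hx
      refine ih _ ((phi p q) '' (S ∪ {x | (Wr p q).eval x = 0})) ((hS.union hWf).image _) ?_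
      intro t ht
      set G : Fin p.natDegree → k := fun a =>
        ∑ ε' : Fin n → Fin p.natDegree, c (Fin.cons a ε') *
          ∏ i : Fin n, ((phi p q)^[i] t) ^ (ε' i : ℕ) with hG
      change G a0 = 0
      have hroot : ∀ x, p.eval x = t * q.eval x →
          x ∉ S ∧ (Wr p q).eval x ≠ 0 ∧ phi p q x = t := by
        intro x hx
        obtain ⟨h1, h2⟩ := h.phi_eq_iff.2 hx
        refine ⟨fun hs => ht ⟨x, Or.inl hs, h2⟩, fun hs => ht ⟨x, Or.inr hs, h2⟩, h2⟩
      have hnd := h.fib_nodup (t := t) (fun x hx => (hroot x hx).2.1)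
      set P : k[X] := ∑ a : Fin p.natDegree, C (G a) * X ^ (a : ℕ) with hP
      have hPe : ∀ x ∈ (p - C t * q).roots.toFinset, P.eval x = 0 := by
        intro x hx
        rw [Multiset.mem_toFinset, h.mem_fib] at hx
        obtain ⟨h1, h2, h3⟩ := hroot x hx
        have := hc x h1
        rw [← (Fin.consEquiv (fun _ => Fin p.natDegree)).sum_comp, Fintype.sum_prod_type] at this
        rw [hP, eval_finsetSum, ← this]
        apply Finset.sum_congr rfl
        intro a _
        rw [eval_mul, eval_C, eval_pow, eval_X, hG]
        simp only [Finset.sum_mul]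
        apply Finset.sum_congr rfl
        intro ε' _
        simp only [Fin.consEquiv, Equiv.coe_fn_mk, Fin.prod_univ_succ, Fin.cons_zero, Fin.cons_succ,
          Fin.val_zero, Function.iterate_zero, id, Fin.val_succ, Function.iterate_succ_apply, h3]
        ring
      have hdeg : P.degree < p.natDegree := by
        rw [hP]
        refine (degree_sum_le _ _).trans_lt ?_
        rw [Finset.sup_lt_iff (WithBot.bot_lt_coe _)]
        intro a _
        refine (degree_C_mul_X_pow_le _ _).trans_lt ?_
        exact_mod_cast a.2
      have hcard : (p - C t * q).roots.toFinset.card = p.natDegree := by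
        rw [Multiset.toFinset_card_of_nodup hnd, ← h.fib_natDegree t]
        exact (splits_iff_card_roots.1 (IsAlgClosed.splits _))
      have hP0 : P = 0 := by
        refine Polynomial.eq_zero_of_degree_lt_of_eval_finset_eq_zero _ ?_ hPe
        rw [hcard]; exact hdeg
      have := congrArg (fun f => coeff f a0) hP0
      simp only [hP, finsetSum_coeff, coeff_C_mul, coeff_X_pow, coeff_zero] at this
      rw [Finset.sum_eq_single a0] at this
      · simpa using this
      · intro b _ hb
        rw [if_neg, mul_zero]
        intro h'; exact hb (Fin.ext h'.symm)
      · simp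
    funext ε
    have := congrFun (key (ε 0)) (Fin.tail ε)
    simpa [Fin.cons_self_tail] using this

lemma Good.bad_finite (h : Good p q) [IsAlgClosed k] [CharZero k] (n : ℕ) :
    {x | ∃ i < n, q.eval ((phi p q)^[i] x) = 0}.Finite := by
  induction n with
  | zero => simp
  | succ n ih =>
    have hq0 : {x | q.eval x = 0}.Finite := by
      refine (q.roots.toFinset.finite_toSet).subset ?_
      intro x hx
      simpa [Polynomial.mem_roots h.q_ne] using hx
    have hset : {x | ∃ i < n + 1, q.eval ((phi p q)^[i] x) = 0} ⊆
        {x | q.eval x = 0} ∪ ⋃ t ∈ {x | ∃ i < n, q.eval ((phi p q)^[i] x) = 0},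
          {x | p.eval x = t * q.eval x} := by
      rintro x ⟨i, hi, hx⟩
      by_cases hqx : q.eval x = 0
      · exact Or.inl hqx
      · right
        rcases i with _ | i
        · exact absurd (by simpa using hx) hqx
        · simp only [Set.mem_iUnion]
          refine ⟨phi p q x, ⟨i, by omega, by simpa using hx⟩, ?_⟩
          exact h.phi_eq_iff.1 ⟨hqx, rfl⟩
    refine (hq0.union (ih.biUnion fun t _ => ?_)).subset hset
    refine ((p - C t * q).roots.toFinset.finite_toSet).subset ?_
    intro x hx
    rw [Finset.mem_coe, Multiset.mem_toFinset, h.mem_fib]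
    exact hx

lemma Good.NN_ne (h : Good p q) [IsAlgClosed k] [CharZero k] {m l : ℕ}
    (n : (Fin m → Fin p.natDegree) × (Fin l → Fin p.natDegree) → ℤ) (hn : n ≠ 0) :
    NN p q n ≠ 0 := by
  intro h0
  apply hn
  have key : ∀ x y, (∀ i < m, q.eval ((phi p q)^[i] x) ≠ 0) →
      (∀ i < l, q.eval ((phi p q)^[i] y) ≠ 0) →
      ∑ e : (Fin m → Fin p.natDegree) × (Fin l → Fin p.natDegree), (n e : k) *
        ((∏ i : Fin m, ((phi p q)^[i] x) ^ (e.1 i : ℕ)) *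
          (∏ i : Fin l, ((phi p q)^[i] y) ^ (e.2 i : ℕ))) = 0 := by
    intro x y hx hy
    have h1 := NN_evalEval p q n x y
    rw [h0, evalEval_zero] at h1
    have hA : (∏ i : Fin m, (AB p q p.natDegree i).2.eval x ^ (p.natDegree - 1)) ≠ 0 :=
      Finset.prod_ne_zero_iff.2 fun i _ =>
        pow_ne_zero _ (h.AB_eval x i (fun j hj => hx j (by omega))).1
    have hB : (∏ i : Fin l, (AB p q p.natDegree i).2.eval y ^ (p.natDegree - 1)) ≠ 0 :=
      Finset.prod_ne_zero_iff.2 fun i _ =>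
        pow_ne_zero _ (h.AB_eval y i (fun j hj => hy j (by omega))).1
    apply mul_left_cancel₀ (mul_ne_zero hA hB)
    rw [mul_zero, h1, Finset.mul_sum]
    apply Finset.sum_congr rfl
    intro e _
    rw [h.Ne_eval x m hx, h.Ne_eval y l hy]
    ring
  have step : ∀ y ∉ {x | ∃ i < l, q.eval ((phi p q)^[i] x) = 0},
      (fun ε : Fin m → Fin p.natDegree => ∑ η : Fin l → Fin p.natDegree,
        (n (ε, η) : k) * (∏ i : Fin l, ((phi p q)^[i] y) ^ (η i : ℕ))) = 0 := by
    intro y hy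
    refine h.indep m _ _ (h.bad_finite m) ?_
    intro x hx
    have := key x y (fun i hi h' => hx ⟨i, hi, h'⟩) (fun i hi h' => hy ⟨i, hi, h'⟩)
    rw [Fintype.sum_prod_type] at this
    rw [← this]
    apply Finset.sum_congr rfl
    intro ε _
    rw [Finset.sum_mul]
    apply Finset.sum_congr rfl
    intro η _
    ring
  funext ⟨ε, η⟩
  have := h.indep l (fun η => (n (ε, η) : k)) _ (h.bad_finite l) (fun y hy => congrFun (step y hy) ε)
  have := congrFun this η
  simpa using this

end M5a2
end ArbPCF

namespace ArbPCF
section M5b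
set_option linter.unusedSectionVars false
variable {A : Type*} [CommRing A]

lemma taylor_coeff_deg {F : A[X][X]} {a b Q : ℕ} (ha : ∀ i, (F.coeff i).natDegree ≤ a)
    (hb : F.natDegree ≤ b) (j : ℕ) :
    ((taylor (X ^ Q) F).coeff j).natDegree ≤ a + Q * b := by
  rw [taylor_coeff, eval_eq_sum_range]
  apply natDegree_sum_le_of_forall_le
  intro i hi
  have hi' : i ≤ b := by
    rw [Finset.mem_range, Nat.lt_succ_iff] at hi
    exact hi.trans ((natDegree_hasseDeriv_le _ _).trans ((Nat.sub_le _ _).trans hb))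
  rw [hasseDeriv_coeff]
  refine natDegree_mul_le_of_le ((natDegree_mul_le_of_le (natDegree_natCast _).le (ha _)).trans
    (zero_add _).le) ?_
  rw [← pow_mul]
  exact (natDegree_X_pow_le _).trans (Nat.mul_le_mul_left _ hi')

theorem siegel (p q : A[X]) (I : Ideal A) [Finite (A ⧸ I)] (Q T d k l : ℕ) (hd : 1 ≤ d)
    (hQ : 1 ≤ Q) (hcard : Nat.card (A ⧸ I) ≤ Q ^ T) (hl : 2 * T ^ 2 ≤ d ^ l)
    (hk : Q * d ^ l ≤ d ^ k) :
    ∃ n : (Fin k → Fin d) × (Fin l → Fin d) → ℤ, n ≠ 0 ∧ (∀ e, |n e| ≤ Q) ∧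
      ∀ j < T, ∀ i, ((taylor (X ^ Q) (NN p q n)).coeff j).coeff i ∈ I := by
  have := Fintype.ofFinite (A ⧸ I)
  set D := d ^ k + Q * d ^ l with hD
  let F : ((Fin k → Fin d) × (Fin l → Fin d) → Fin (Q + 1)) → (Fin T → Fin D → A ⧸ I) :=
    fun m j i => Ideal.Quotient.mk I
      (((taylor (X ^ Q) (NN p q (fun e => ((m e : ℕ) : ℤ)))).coeff j).coeff i)
  have hlt : Fintype.card (Fin T → Fin D → A ⧸ I) <
      Fintype.card ((Fin k → Fin d) × (Fin l → Fin d) → Fin (Q + 1)) := by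
    simp only [Fintype.card_fun, Fintype.card_fin, Fintype.card_prod]
    rw [Nat.card_eq_fintype_card] at hcard
    have hpos : d ^ k * d ^ l ≠ 0 := by positivity
    calc (Fintype.card (A ⧸ I) ^ D) ^ T ≤ ((Q ^ T) ^ D) ^ T := by gcongr
      _ = Q ^ (T * D * T) := by rw [← pow_mul, ← pow_mul, mul_assoc]
      _ ≤ Q ^ (d ^ k * d ^ l) := by
        apply Nat.pow_le_pow_right hQ
        calc T * D * T = T ^ 2 * D := by ring
          _ ≤ T ^ 2 * (2 * d ^ k) := by gcongr; omega
          _ = d ^ k * (2 * T ^ 2) := by ring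
          _ ≤ _ := by gcongr
      _ < (Q + 1) ^ (d ^ k * d ^ l) := by
        apply Nat.pow_lt_pow_left (by omega) hpos
  obtain ⟨m, m', hne, he⟩ := Fintype.exists_ne_map_eq_of_card_lt F hlt
  refine ⟨(fun e => ((m e : ℕ) : ℤ)) - (fun e => ((m' e : ℕ) : ℤ)), ?_, ?_, ?_⟩
  · intro h0
    apply hne
    funext e
    have := congrFun h0 e
    simp only [Pi.sub_apply, Pi.zero_apply] at this
    apply Fin.ext
    omega
  · intro e
    simp only [Pi.sub_apply]
    have h1 := (m e).2
    have h2 := (m' e).2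
    rw [abs_le]
    constructor <;> omega
  · intro j hj i
    by_cases hi : i < D
    · have := congrFun (congrFun he ⟨j, hj⟩) ⟨i, hi⟩
      simp only [F] at this
      rw [Ideal.Quotient.mk_eq_mk_iff_sub_mem] at this
      rw [NN_sub, map_sub, coeff_sub, coeff_sub]
      exact this
    · rw [coeff_eq_zero_of_natDegree_lt]
      · exact I.zero_mem
      · refine (taylor_coeff_deg (NN_coeff_deg p q hd _) (NN_deg p q hd _) j).trans_lt ?_
        have h1 : 1 ≤ d ^ k := Nat.one_le_pow _ _ hd
        have h2 : 1 ≤ d ^ l := Nat.one_le_pow _ _ hd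
        have h3 : Q * (d ^ l - 1) ≤ Q * d ^ l := by gcongr; omega
        omega

theorem siegel_dvd {B : Type*} [CommRing B] [Algebra A B] (N : A[X][X]) (π : A) (Q T : ℕ)
    (hN : ∀ j < T, ∀ i, ((taylor (X ^ Q) N).coeff j).coeff i ∈ Ideal.span {π ^ T})
    (x y : B) (hxy : algebraMap A B π ∣ y - x ^ Q) :
    algebraMap A B π ^ T ∣ (N.map (mapRingHom (algebraMap A B))).evalEval x y := by
  set f := algebraMap A B
  have h1 : (N.map (mapRingHom f)).evalEval x y =
      eval₂ (eval₂RingHom f x) y N := by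
    rw [← eval₂_evalRingHom, eval₂_map]
    congr 1
    ext <;> simp
  have h2 : eval₂ (eval₂RingHom f x) y N = ∑ j ∈ Finset.range (N.natDegree + 1),
      ((taylor (X ^ Q) N).coeff j).eval₂ f x * (y - x ^ Q) ^ j := by
    have := sum_taylor_eq N (X ^ Q)
    conv_lhs => rw [← this]
    rw [Polynomial.sum_over_range' _ _ (N.natDegree + 1) (by rw [natDegree_taylor]; omega)]
    · simp [eval₂_finsetSum, eval₂_mul, eval₂_pow]
    · simp
  rw [h1, h2]
  apply Finset.dvd_sum
  intro j _
  by_cases hj : j < T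
  · apply Dvd.dvd.mul_right
    rw [eval₂_eq_sum_range]
    apply Finset.dvd_sum
    intro i _
    apply Dvd.dvd.mul_right
    obtain ⟨c, hc⟩ := Ideal.mem_span_singleton.1 (hN j hj i)
    rw [hc, map_mul, map_pow]
    exact Dvd.intro _ rfl
  · apply Dvd.dvd.mul_left
    exact (pow_dvd_pow _ (by omega)).trans (pow_dvd_pow_of_dvd hxy j)

end M5b
end ArbPCF

namespace ArbPCF
section M6a
set_option linter.unusedSectionVars false
open NumberField Height

variable {L : Type*} [Field L] [NumberField L]

noncomputable def Ht (F : (L → ℝ) → ℝ) : ℝ :=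
  (∏ v : InfinitePlace L, F (fun x => v x) ^ v.mult) * ∏ᶠ v : FinitePlace L, F (fun x => v x)

def FS (F : (L → ℝ) → ℝ) : Prop :=
  Function.HasFiniteMulSupport fun v : FinitePlace L => F (fun x => v x)

noncomputable def mx (x : L) (v : L → ℝ) : ℝ := max (v x) 1

lemma one_le_mx (x : L) (v : L → ℝ) : 1 ≤ mx x v := le_max_right _ _
lemma le_mx (x : L) (v : L → ℝ) : v x ≤ mx x v := le_max_left _ _
lemma mx_pos (x : L) (v : L → ℝ) : 0 < mx x v := zero_lt_one.trans_le (one_le_mx x v)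

lemma FS_mx (x : L) : FS (mx x) := by
  unfold FS mx
  rcases eq_or_ne x 0 with rfl | hx
  · simp [Function.HasFiniteMulSupport]
  · exact (FinitePlace.hasFiniteMulSupport hx).max (by simp [Function.HasFiniteMulSupport])

lemma FS_ev {x : L} (hx : x ≠ 0) : FS (fun v : L → ℝ => v x) := FinitePlace.hasFiniteMulSupport hx

lemma FS.mul {F G : (L → ℝ) → ℝ} (hF : FS F) (hG : FS G) : FS (fun v => F v * G v) :=
  Function.HasFiniteMulSupport.mul hF hG

lemma FS.pow {F : (L → ℝ) → ℝ} (hF : FS F) (n : ℕ) : FS (fun v => F v ^ n) :=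
  Function.HasFiniteMulSupport.pow hF n

lemma FS.prod {ι : Type*} (s : Finset ι) {F : ι → (L → ℝ) → ℝ} (hF : ∀ i, FS (F i)) :
    FS (fun v => ∏ i ∈ s, F i v) :=
  Function.HasFiniteMulSupport.prod hF s

lemma Ht_mx (x : L) : Ht (mx x) = mulHeight₁ x := by
  rw [NumberField.mulHeight₁_eq]; rfl

lemma Ht_ev {x : L} (hx : x ≠ 0) : Ht (fun v : L → ℝ => v x) = 1 := prod_abs_eq_one hx

lemma Ht_mul {F G : (L → ℝ) → ℝ} (hF : FS F) (hG : FS G) :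
    Ht (fun v => F v * G v) = Ht F * Ht G := by
  unfold Ht
  rw [finprod_mul_distrib hF hG]
  simp only [mul_pow, Finset.prod_mul_distrib]
  ring

lemma Ht_pow {F : (L → ℝ) → ℝ} (hF : FS F) (n : ℕ) : Ht (fun v => F v ^ n) = Ht F ^ n := by
  unfold Ht
  rw [mul_pow, finprod_pow hF, ← Finset.prod_pow]
  simp only [← pow_mul, mul_comm n]

lemma Ht_prod {ι : Type*} (s : Finset ι) {F : ι → (L → ℝ) → ℝ} (hF : ∀ i, FS (F i)) :
    Ht (fun v => ∏ i ∈ s, F i v) = ∏ i ∈ s, Ht (F i) := by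
  unfold Ht
  rw [finprod_prod_comm s _ (fun i _ => hF i), Finset.prod_mul_distrib]
  simp only [← Finset.prod_pow]
  rw [Finset.prod_comm]

lemma Ht_le {F G : (L → ℝ) → ℝ} (hF : FS F) (hG : FS G) (c : ℝ) (hc : 0 ≤ c)
    (hF0 : ∀ v : InfinitePlace L, 0 ≤ F (fun x => v x))
    (hF1 : ∀ v : FinitePlace L, 0 ≤ F (fun x => v x))
    (h0 : ∀ v : InfinitePlace L, F (fun x => v x) ≤ c * G (fun x => v x))
    (h1 : ∀ v : FinitePlace L, F (fun x => v x) ≤ G (fun x => v x)) :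
    Ht F ≤ c ^ Module.finrank ℚ L * Ht G := by
  unfold Ht
  have e : c ^ Module.finrank ℚ L = ∏ v : InfinitePlace L, c ^ v.mult := by
    rw [Finset.prod_pow_eq_pow_sum, InfinitePlace.sum_mult_eq]
  rw [e, ← mul_assoc, ← Finset.prod_mul_distrib]
  apply mul_le_mul
  · apply Finset.prod_le_prod
    · intro v _; exact pow_nonneg (hF0 v) _
    · intro v _; rw [← mul_pow]; exact pow_le_pow_left₀ (hF0 v) (h0 v) _
  · exact finprod_le_finprod hF hF1 hG h1
  · exact finprod_induction (p := fun x => 0 ≤ x) zero_le_one (fun _ _ => mul_nonneg) hF1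
  · apply Finset.prod_nonneg
    intro v _
    rw [← mul_pow]
    exact pow_nonneg ((hF0 v).trans (h0 v)) _

lemma fin_int_le_one (x : 𝓞 L) (v : FinitePlace L) : v (x : L) ≤ 1 := by
  rw [← FinitePlace.norm_embedding_eq]
  exact FinitePlace.norm_le_one L _ x

lemma fin_intCast_le_one (n : ℤ) (v : FinitePlace L) : v (n : L) ≤ 1 := by
  have := fin_int_le_one (n : 𝓞 L) v
  simpa using this

lemma inf_intCast (n : ℤ) (v : InfinitePlace L) : v (n : L) = |(n : ℝ)| := by
  rw [← InfinitePlace.norm_embedding_eq]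
  simp

lemma fin_sum_le {ι : Type*} (s : Finset ι) (f : ι → L) (v : FinitePlace L) {c : ℝ} (hc : 0 ≤ c)
    (h : ∀ i ∈ s, v (f i) ≤ c) : v (∑ i ∈ s, f i) ≤ c := by
  induction s using Finset.induction_on with
  | empty => simpa using hc
  | insert a s ha ih =>
    rw [Finset.sum_insert ha]
    refine (FinitePlace.add_le v _ _).trans (max_le (h a (by simp)) (ih fun i hi => h i (by simp [hi])))

lemma inf_sum_le {ι : Type*} (s : Finset ι) (f : ι → L) (v : InfinitePlace L) {c : ℝ}
    (h : ∀ i ∈ s, v (f i) ≤ c) : v (∑ i ∈ s, f i) ≤ s.card * c := by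
  calc v (∑ i ∈ s, f i) ≤ ∑ i ∈ s, v (f i) := by
        exact AbsoluteValue.sum_le v.1 s f
    _ ≤ _ := by simpa using Finset.sum_le_card_nsmul s _ c h

/-- heights of elements of the base field -/
lemma height_base {K : Type*} [Field K] [NumberField K] (c : K) : ∃ B : ℝ, 1 ≤ B ∧
    ∀ (L : Type*) [Field L] [NumberField L] [Algebra K L],
      mulHeight₁ (algebraMap K L c) ≤ B ^ Module.finrank ℚ L := by
  have h_integ : ∀ a : 𝓞 K, ∃ B : ℝ, 1 ≤ B ∧
    ∀ (L : Type _) [Field L] [NumberField L] [Algebra K L],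
      mulHeight₁ (algebraMap K L a) ≤ B ^ Module.finrank ℚ L := by
    intro a
    refine ⟨1 + ∑ v : InfinitePlace K, max (v a) 1, ?_, ?_⟩
    · have : 0 ≤ ∑ v : InfinitePlace K, max (v a) 1 :=
        Finset.sum_nonneg fun v _ => zero_le_one.trans (le_max_right _ _)
      linarith
    · intro L _ _ _
      rw [← Ht_mx]
      refine (Ht_le (G := fun _ => 1) (FS_mx _) (by simp [FS, Function.HasFiniteMulSupport])
        (1 + ∑ v : InfinitePlace K, max (v a) 1) ?_ ?_ ?_ ?_ ?_).trans ?_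
      · have : 0 ≤ ∑ v : InfinitePlace K, max (v a) 1 :=
          Finset.sum_nonneg fun v _ => zero_le_one.trans (le_max_right _ _)
        linarith
      · intro v; exact (mx_pos _ _).le
      · intro v; exact (mx_pos _ _).le
      · intro v
        rw [mul_one, mx, ← InfinitePlace.comap_apply]
        have := Finset.single_le_sum (f := fun v : InfinitePlace K => max (v (a : K)) 1)
          (fun v _ => zero_le_one.trans (le_max_right _ _))
          (Finset.mem_univ (v.comap (algebraMap K L)))
        linarith
      · intro v
        rw [mx]
        apply max_le _ le_rfl
        have : (algebraMap K L a) = ((algebraMap (𝓞 K) (𝓞 L) a : 𝓞 L) : L) := by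
          exact (IsScalarTower.algebraMap_apply (𝓞 K) K L a).symm.trans
            (IsScalarTower.algebraMap_apply (𝓞 K) (𝓞 L) L a)
        rw [this]
        exact fin_int_le_one _ _
      · simp only [Ht, one_pow, Finset.prod_const_one, finprod_one, mul_one]
        exact le_rfl
  obtain ⟨a, b, hb, rfl⟩ := IsFractionRing.div_surjective (𝓞 K) c
  obtain ⟨B1, h1, H1⟩ := h_integ a
  obtain ⟨B2, h2, H2⟩ := h_integ b
  refine ⟨B1 * B2, one_le_mul_of_one_le_of_one_le h1 h2, ?_⟩
  intro L _ _ _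
  rw [map_div₀, div_eq_mul_inv, mul_pow]
  refine (mulHeight₁_mul_le _ _).trans ?_
  rw [mulHeight₁_inv]
  exact mul_le_mul (H1 L) (H2 L) (mulHeight₁_nonneg _) (by positivity)

end M6a
end ArbPCF

namespace ArbPCF
section M6b
set_option linter.unusedSectionVars false
open NumberField Height

lemma Good.bez {K : Type*} [Field K] {p q : K[X]} (h : Good p q) :
    ∃ (m : ℕ) (U V U' V' : K[X]), U.natDegree ≤ m ∧ V.natDegree ≤ m ∧ U'.natDegree ≤ m ∧
      V'.natDegree ≤ m ∧ U * p + V * q = 1 ∧ U' * p + V' * q = X ^ (m + p.natDegree) := by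
  obtain ⟨U, V, hUV⟩ := h.cop
  have hd := h.two_le
  have hlt := h.lt
  set d := p.natDegree with hd'
  set m := max (max U.natDegree V.natDegree) d with hm
  have hmd : d ≤ m := le_max_right _ _
  set V' := (X ^ (m + d) * V) %ₘ p with hV'
  set U' := X ^ (m + d) * U + ((X ^ (m + d) * V) /ₘ p) * q with hU'
  have hVd : V'.natDegree < d := by
    apply natDegree_modByMonic_lt _ h.monic
    intro h1
    rw [h1] at hd'
    simp at hd'
    omega
  have key : U' * p + V' * q = X ^ (m + d) := by
    have h1 := modByMonic_add_div (X ^ (m + d) * V) p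
    rw [← hV'] at h1
    calc U' * p + V' * q = X ^ (m+d) * (U * p)
          + (V' + p * ((X ^ (m + d) * V) /ₘ p)) * q := by rw [hU']; ring
      _ = X ^ (m+d) * (U * p + V * q) := by rw [h1]; ring
      _ = _ := by rw [hUV, mul_one]
  refine ⟨m, U, V, U', V', ?_, ?_, ?_, by omega, hUV, key⟩
  · exact (le_max_left _ _).trans (le_max_left _ _)
  · exact (le_max_right _ _).trans (le_max_left _ _)
  · rcases eq_or_ne U' 0 with h0 | h0
    · simp [h0]
    have e : U' * p = X ^ (m + d) - V' * q := by rw [← key]; ring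
    have h2 : (U' * p).natDegree = U'.natDegree + d := by
      rw [natDegree_mul h0 h.monic.ne_zero]
    have h3 : (X ^ (m + d) - V' * q).natDegree ≤ m + d := by
      refine (natDegree_sub_le _ _).trans (max_le (natDegree_X_pow_le _) ?_)
      refine natDegree_mul_le.trans ?_
      omega
    rw [← e, h2] at h3
    omega

variable {L : Type*} [Field L] [NumberField L]

/-- uniform description of a place: `A` bounds sums of at most `n` terms -/
structure Plc (v : L → ℝ) (n : ℕ) (A : ℝ) : Prop where
  mul : ∀ x y, v (x * y) = v x * v y
  one : v 1 = 1
  zero : v 0 = 0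
  nonneg : ∀ x, 0 ≤ v x
  sum : ∀ (s : Finset ℕ) (f : ℕ → L) (c : ℝ), s.card ≤ n → 0 ≤ c → (∀ i ∈ s, v (f i) ≤ c) →
    v (∑ i ∈ s, f i) ≤ A * c

lemma Plc.inf (v : InfinitePlace L) (n : ℕ) : Plc (fun x => v x) n n where
  mul x y := map_mul v x y
  one := map_one v
  zero := map_zero v
  nonneg x := apply_nonneg v x
  sum s f c hs hc h := (inf_sum_le s f v h).trans
    (mul_le_mul_of_nonneg_right (by exact_mod_cast hs) hc)

lemma Plc.fin (v : FinitePlace L) (n : ℕ) : Plc (fun x => v x) n 1 where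
  mul x y := map_mul v x y
  one := map_one v
  zero := map_zero v
  nonneg x := apply_nonneg v x
  sum s f c hs hc h := by rw [one_mul]; exact fin_sum_le s f v hc h

variable {v : L → ℝ} {n : ℕ} {A : ℝ}

lemma Plc.pow (hv : Plc v n A) (x : L) (k : ℕ) : v (x ^ k) = v x ^ k := by
  induction k with
  | zero => simp [hv.one]
  | succ k ih => rw [pow_succ, hv.mul, ih, pow_succ]

lemma Plc.prod (hv : Plc v n A) {ι : Type*} (s : Finset ι) (f : ι → L) :
    v (∏ i ∈ s, f i) = ∏ i ∈ s, v (f i) := by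
  induction s using Finset.induction_on with
  | empty => simp [hv.one]
  | insert a s ha ih => rw [Finset.prod_insert ha, hv.mul, ih, Finset.prod_insert ha]

lemma one_le_prod_mx {ι : Type*} (s : Finset ι) (f : ι → L) (v : L → ℝ) :
    1 ≤ ∏ i ∈ s, mx (f i) v := by
  induction s using Finset.induction_on with
  | empty => simp
  | insert a s ha ih =>
    rw [Finset.prod_insert ha]; exact one_le_mul_of_one_le_of_one_le (one_le_mx _ _) ih

lemma mx_le_prod {ι : Type*} (s : Finset ι) (f : ι → L) (v : L → ℝ) {i : ι} (hi : i ∈ s) :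
    mx (f i) v ≤ ∏ i ∈ s, mx (f i) v := by
  rw [← Finset.mul_prod_erase s _ hi]
  exact le_mul_of_one_le_right (mx_pos _ _).le (one_le_prod_mx _ _ _)

noncomputable def cst (f : L[X]) (m : ℕ) (v : L → ℝ) : ℝ := ∏ i ∈ Finset.range (m + 1), mx (f.coeff i) v

lemma one_le_cst (f : L[X]) (m : ℕ) (v : L → ℝ) : 1 ≤ cst f m v := one_le_prod_mx _ _ _

lemma Plc.eval_le (hv : Plc v n A) (f : L[X]) (m : ℕ) (hf : f.natDegree ≤ m) (hn : m + 1 ≤ n)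
    (x : L) : v (f.eval x) ≤ A * (cst f m v * mx x v ^ m) := by
  rw [eval_eq_sum_range' (n := m + 1) (by omega)]
  apply hv.sum
  · simpa using hn
  · have := one_le_cst f m v
    have := mx_pos x v
    positivity
  · intro i hi
    rw [hv.mul, hv.pow]
    apply mul_le_mul
    · exact (le_mx _ _).trans (mx_le_prod _ (fun i => f.coeff i) v hi)
    · refine (pow_le_pow_left₀ (hv.nonneg _) (le_mx x v) i).trans ?_
      exact pow_le_pow_right₀ (one_le_mx _ _) (by simp at hi; omega)
    · exact pow_nonneg (hv.nonneg _) _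
    · exact zero_le_one.trans (one_le_cst _ _ _)

lemma Plc.add_le (hv : Plc v n A) (hn : 2 ≤ n) {x y : L} {c : ℝ} (hc : 0 ≤ c) (hx : v x ≤ c)
    (hy : v y ≤ c) : v (x + y) ≤ A * c := by
  have := hv.sum (Finset.range 2) (fun i => if i = 0 then x else y) c (by simpa using hn) hc (by
    intro i hi; split_ifs <;> assumption)
  simpa [Finset.sum_range_succ] using this

/-- the local inequality -/
lemma Plc.local_ineq (hv : Plc v n A) (hA : 0 ≤ A) {p q U V U' V' : L[X]} {m d : ℕ} (hn : m + 2 ≤ n)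
    (hU : U.natDegree ≤ m) (hV : V.natDegree ≤ m) (hU' : U'.natDegree ≤ m) (hV' : V'.natDegree ≤ m)
    (h1 : U * p + V * q = 1) (h2 : U' * p + V' * q = X ^ (m + d)) (x : L) (hq : q.eval x ≠ 0) :
    mx x v ^ (m + d) ≤ (A * A) * ((cst U m v * cst V m v * (cst U' m v * cst V' m v)) *
      mx x v ^ m * (v (q.eval x) * mx (p.eval x / q.eval x) v)) := by
  set M := mx x v with hM
  have hM1 : 1 ≤ M := one_le_mx x v
  set W := v (q.eval x) * mx (p.eval x / q.eval x) v with hW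
  have hqW : v (q.eval x) ≤ W := le_mul_of_one_le_right (hv.nonneg _) (one_le_mx _ _)
  have hpW : v (p.eval x) ≤ W := by
    have : v (p.eval x) = v (q.eval x) * v (p.eval x / q.eval x) := by
      rw [← hv.mul, mul_div_cancel₀ _ hq]
    rw [this]
    exact mul_le_mul_of_nonneg_left (le_mx _ _) (hv.nonneg _)
  have hW0 : 0 ≤ W := (hv.nonneg _).trans hqW
  have a1 := one_le_cst U m v
  have a2 := one_le_cst V m v
  have a3 := one_le_cst U' m v
  have a4 := one_le_cst V' m v
  set c1 := cst U m v
  set c2 := cst V m v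
  set c3 := cst U' m v
  set c4 := cst V' m v
  have b12 : 1 ≤ c1 * c2 := one_le_mul_of_one_le_of_one_le a1 a2
  have b34 : 1 ≤ c3 * c4 := one_le_mul_of_one_le_of_one_le a3 a4
  have d1 : c1 ≤ c1 * c2 * (c3 * c4) := (le_mul_of_one_le_right (by linarith) a2).trans
    (le_mul_of_one_le_right (by linarith) b34)
  have d2 : c2 ≤ c1 * c2 * (c3 * c4) := (le_mul_of_one_le_left (by linarith) a1).trans
    (le_mul_of_one_le_right (by linarith) b34)
  have d3 : c3 ≤ c1 * c2 * (c3 * c4) := (le_mul_of_one_le_right (by linarith) a4).trans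
    (le_mul_of_one_le_left (by linarith) b12)
  have d4 : c4 ≤ c1 * c2 * (c3 * c4) := (le_mul_of_one_le_left (by linarith) a3).trans
    (le_mul_of_one_le_left (by linarith) b12)
  set D := c1 * c2 * (c3 * c4) with hD
  have hD0 : 0 ≤ D := by linarith
  have key : ∀ (f g : L[X]), f.natDegree ≤ m → g.natDegree ≤ m → cst f m v ≤ D → cst g m v ≤ D →
      v (f.eval x * p.eval x + g.eval x * q.eval x) ≤ (A * A) * (D * M ^ m * W) := by
    intro f g hf hg hfD hgD
    rw [mul_assoc A A]
    have hM0 : 0 ≤ M ^ m := by positivity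
    apply hv.add_le (by omega)
    · positivity
    · rw [hv.mul]
      calc _ ≤ (A * (D * M ^ m)) * W := by
            apply mul_le_mul _ hpW (hv.nonneg _) (by positivity)
            refine (hv.eval_le f m hf (by omega) x).trans ?_
            gcongr
        _ = _ := by ring
    · rw [hv.mul]
      calc _ ≤ (A * (D * M ^ m)) * W := by
            apply mul_le_mul _ hqW (hv.nonneg _) (by positivity)
            refine (hv.eval_le g m hg (by omega) x).trans ?_
            gcongr
        _ = _ := by ring
  have e1 : U.eval x * p.eval x + V.eval x * q.eval x = 1 := by
    rw [← eval_mul, ← eval_mul, ← eval_add, h1, eval_one]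
  have e2 : U'.eval x * p.eval x + V'.eval x * q.eval x = x ^ (m + d) := by
    rw [← eval_mul, ← eval_mul, ← eval_add, h2, eval_pow, eval_X]
  have f1 := key U V hU hV d1 d2
  have f2 := key U' V' hU' hV' d3 d4
  rw [e1, hv.one] at f1
  rw [e2, hv.pow] at f2
  rcases max_cases (v x) 1 with ⟨h, _⟩ | ⟨h, _⟩
  · have : M = v x := h
    rw [← this] at f2
    exact f2
  · have : M = 1 := h
    conv_lhs => rw [this, one_pow]
    exact f1

lemma FS_cst (f : L[X]) (m : ℕ) : FS (cst f m) := FS.prod _ fun i => FS_mx _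

lemma Ht_cst (f : L[X]) (m : ℕ) :
    Ht (cst f m) = ∏ i ∈ Finset.range (m + 1), mulHeight₁ (f.coeff i) := by
  have := Ht_prod (Finset.range (m + 1)) (F := fun i => mx (f.coeff i)) fun i => FS_mx _
  simp only [Ht_mx] at this
  exact this

lemma height_ineq {p q U V U' V' : L[X]} {m d : ℕ}
    (hU : U.natDegree ≤ m) (hV : V.natDegree ≤ m) (hU' : U'.natDegree ≤ m) (hV' : V'.natDegree ≤ m)
    (h1 : U * p + V * q = 1) (h2 : U' * p + V' * q = X ^ (m + d)) (x : L) (hq : q.eval x ≠ 0) :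
    mulHeight₁ x ^ d ≤ ((m + 2 : ℕ) * (m + 2 : ℕ) : ℝ) ^ Module.finrank ℚ L *
      ((Ht (cst U m) * Ht (cst V m)) * (Ht (cst U' m) * Ht (cst V' m))) *
        mulHeight₁ (p.eval x / q.eval x) := by
  have FC := ((FS_cst U m).mul (FS_cst V m)).mul ((FS_cst U' m).mul (FS_cst V' m))
  have FQ := (FS_ev hq).mul (FS_mx (p.eval x / q.eval x))
  have FG := (FC.mul ((FS_mx x).pow m)).mul FQ
  have := Ht_le ((FS_mx x).pow (m + d)) FG ((m + 2 : ℕ) * (m + 2 : ℕ) : ℝ) (by positivity)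
    (fun v => pow_nonneg (mx_pos _ _).le _) (fun v => pow_nonneg (mx_pos _ _).le _)
    (fun v => (Plc.inf v (m + 2)).local_ineq (by positivity) le_rfl hU hV hU' hV' h1 h2 x hq)
    (fun v => by
      have := (Plc.fin v (m + 2)).local_ineq (by positivity) le_rfl hU hV hU' hV' h1 h2 x hq
      rw [mul_one, one_mul] at this
      exact this)
  rw [Ht_pow (FS_mx x), Ht_mul (FC.mul ((FS_mx x).pow m)) FQ, Ht_mul FC ((FS_mx x).pow m),
    Ht_mul ((FS_cst U m).mul (FS_cst V m)) ((FS_cst U' m).mul (FS_cst V' m)),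
    Ht_mul (FS_cst U m) (FS_cst V m), Ht_mul (FS_cst U' m) (FS_cst V' m), Ht_pow (FS_mx x),
    Ht_mul (FS_ev hq) (FS_mx _), Ht_ev hq, Ht_mx, Ht_mx, one_mul, pow_add] at this
  have hp : 0 < mulHeight₁ x ^ m := pow_pos (mulHeight₁_pos _) _
  refine le_of_mul_le_mul_left (this.trans (le_of_eq ?_)) hp
  ring

end M6b
end ArbPCF

namespace ArbPCF
section M6c
set_option linter.unusedSectionVars false
open NumberField Height

universe u w

lemma cst_base {K : Type u} [Field K] [NumberField K] (f : K[X]) (m : ℕ) : ∃ B : ℝ, 1 ≤ B ∧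
    ∀ (L : Type w) [Field L] [NumberField L] [Algebra K L],
      Ht (cst (f.map (algebraMap K L)) m) ≤ B ^ Module.finrank ℚ L := by
  choose B hB HB using fun i : ℕ => height_base.{u, w} (f.coeff i)
  refine ⟨∏ i ∈ Finset.range (m + 1), B i, ?_, ?_⟩
  · have : (1 : ℝ) = ∏ i ∈ Finset.range (m + 1), 1 := by simp
    rw [this]
    exact Finset.prod_le_prod (fun _ _ => zero_le_one) (fun i _ => hB i)
  · intro L _ _ _
    rw [Ht_cst, ← Finset.prod_pow]
    apply Finset.prod_le_prod (fun _ _ => mulHeight₁_nonneg _)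
    intro i _
    rw [coeff_map]
    exact HB i L

/-- (6.2) -/
lemma Good.height_phi {K : Type u} [Field K] [NumberField K] {p q : K[X]} (h : Good p q) :
    ∃ C : ℝ, 1 ≤ C ∧ ∀ (L : Type w) [Field L] [NumberField L] [Algebra K L] (x : L),
      (q.map (algebraMap K L)).eval x ≠ 0 →
      mulHeight₁ x ^ p.natDegree ≤ C ^ Module.finrank ℚ L *
        mulHeight₁ (phi (p.map (algebraMap K L)) (q.map (algebraMap K L)) x) := by
  obtain ⟨m, U, V, U', V', hU, hV, hU', hV', h1, h2⟩ := h.bez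
  obtain ⟨B1, b1, H1⟩ := cst_base.{u, w} U m
  obtain ⟨B2, b2, H2⟩ := cst_base.{u, w} V m
  obtain ⟨B3, b3, H3⟩ := cst_base.{u, w} U' m
  obtain ⟨B4, b4, H4⟩ := cst_base.{u, w} V' m
  refine ⟨((m + 2 : ℕ) * (m + 2 : ℕ) : ℝ) * ((B1 * B2) * (B3 * B4)), ?_, ?_⟩
  · have e : (1 : ℝ) ≤ (m + 2 : ℕ) := by exact_mod_cast (by omega)
    exact one_le_mul_of_one_le_of_one_le (one_le_mul_of_one_le_of_one_le e e)
      (one_le_mul_of_one_le_of_one_le (one_le_mul_of_one_le_of_one_le b1 b2)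
        (one_le_mul_of_one_le_of_one_le b3 b4))
  · intro L _ _ _ x hx
    set f := algebraMap K L
    have key := height_ineq (p := p.map f) (q := q.map f) (U := U.map f) (V := V.map f)
      (U' := U'.map f) (V' := V'.map f) (m := m) (d := p.natDegree)
      (natDegree_map_le.trans hU) (natDegree_map_le.trans hV) (natDegree_map_le.trans hU')
      (natDegree_map_le.trans hV')
      (by rw [← Polynomial.map_mul, ← Polynomial.map_mul, ← Polynomial.map_add, h1, Polynomial.map_one])
      (by rw [← Polynomial.map_mul, ← Polynomial.map_mul, ← Polynomial.map_add, h2,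
        Polynomial.map_pow, map_X]) x hx
    refine key.trans ?_
    apply mul_le_mul_of_nonneg_right _ (mulHeight₁_nonneg _)
    rw [mul_pow _ ((B1 * B2) * (B3 * B4)), mul_pow (B1 * B2), mul_pow B1, mul_pow B3]
    have n1 : ∀ g : L[X], 0 ≤ Ht (cst g m) := by
      intro g; rw [Ht_cst]; exact Finset.prod_nonneg fun _ _ => mulHeight₁_nonneg _
    apply mul_le_mul_of_nonneg_left _ (by positivity)
    have q1 := H1 L
    have q2 := H2 L
    have q3 := H3 L
    have q4 := H4 L
    exact mul_le_mul (mul_le_mul q1 q2 (n1 _) (by positivity))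
      (mul_le_mul q3 q4 (n1 _) (by positivity)) (mul_nonneg (n1 _) (n1 _)) (by positivity)

/-- (6.3) -/
lemma Good.height_Lev {K : Type u} [Field K] [NumberField K] {p q : K[X]} (h : Good p q) (γ : K) :
    ∃ C : ℝ, 1 ≤ C ∧ ∀ (L : Type w) [Field L] [NumberField L] [Algebra K L] (n : ℕ) (x : L),
      x ∈ Lev (p.map (algebraMap K L)) (q.map (algebraMap K L)) (algebraMap K L γ) n →
      mulHeight₁ x ≤ C ^ Module.finrank ℚ L := by
  obtain ⟨C', hC', H'⟩ := Good.height_phi.{u, w} h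
  obtain ⟨B, hB, HB⟩ := height_base.{u, w} γ
  refine ⟨max C' B, le_max_of_le_left hC', ?_⟩
  intro L _ _ _ n
  induction n with
  | zero =>
    intro x hx
    rw [mem_Lev_zero] at hx
    rw [hx]
    exact (HB L).trans (pow_le_pow_left₀ (by linarith) (le_max_right _ _) _)
  | succ n ih =>
    intro x hx
    obtain ⟨hx1, hx2⟩ := hx
    have h1 := H' L x hx1
    have h2 := ih _ hx2
    set D := max C' B ^ Module.finrank ℚ L with hD
    have hD1 : 1 ≤ D := one_le_pow₀ (le_max_of_le_left hC')
    have h3 : C' ^ Module.finrank ℚ L ≤ D := pow_le_pow_left₀ (by linarith) (le_max_left _ _) _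
    have h4 : mulHeight₁ x ^ p.natDegree ≤ D ^ p.natDegree := by
      calc _ ≤ D * D := h1.trans (mul_le_mul h3 h2 (mulHeight₁_nonneg _) (by linarith))
        _ = D ^ 2 := by ring
        _ ≤ _ := pow_le_pow_right₀ hD1 h.two_le
    exact le_of_pow_le_pow_left₀ (by have := h.two_le; omega) (by linarith) h4

variable {L : Type w} [Field L]

noncomputable def theta {d k l : ℕ} (n : (Fin k → Fin d) × (Fin l → Fin d) → ℤ) (xs : Fin k → L)
    (ys : Fin l → L) : L :=
  ∑ e, (n e : L) * ((∏ i, xs i ^ (e.1 i : ℕ)) * ∏ j, ys j ^ (e.2 j : ℕ))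

variable [NumberField L]

lemma mon_le {v : L → ℝ} {m : ℕ} {A : ℝ} (hv : Plc v m A) {d k : ℕ} (xs : Fin k → L)
    (e : Fin k → Fin d) : v (∏ i, xs i ^ (e i : ℕ)) ≤ ∏ i, mx (xs i) v ^ (d - 1) := by
  rw [hv.prod]
  apply Finset.prod_le_prod
  · intro i _; exact hv.nonneg _
  · intro i _
    rw [hv.pow]
    refine (pow_le_pow_left₀ (hv.nonneg _) (le_mx _ v) _).trans ?_
    exact pow_le_pow_right₀ (one_le_mx _ _) (by have := (e i).2; omega)

lemma term_le {v : L → ℝ} {m : ℕ} {A : ℝ} (hv : Plc v m A) {d k l : ℕ} (xs : Fin k → L)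
    (ys : Fin l → L) (e : (Fin k → Fin d) × (Fin l → Fin d)) (a : L) {c : ℝ} (hc : v a ≤ c) :
    v (a * ((∏ i, xs i ^ (e.1 i : ℕ)) * ∏ j, ys j ^ (e.2 j : ℕ))) ≤
      c * ((∏ i, mx (xs i) v ^ (d - 1)) * ∏ j, mx (ys j) v ^ (d - 1)) := by
  rw [hv.mul, hv.mul]
  have h1 : 0 ≤ ∏ i, mx (xs i) v ^ (d - 1) :=
    Finset.prod_nonneg fun i _ => pow_nonneg (mx_pos _ _).le _
  exact mul_le_mul hc (mul_le_mul (mon_le hv _ _) (mon_le hv _ _) (hv.nonneg _) h1)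
    (mul_nonneg (hv.nonneg _) (hv.nonneg _)) ((hv.nonneg _).trans hc)

/-- (6.4) -/
lemma theta_height {d k l Q : ℕ} (hd : 1 ≤ d) (hQ : 1 ≤ Q)
    (n : (Fin k → Fin d) × (Fin l → Fin d) → ℤ) (hn : ∀ e, |n e| ≤ Q)
    (xs : Fin k → L) (ys : Fin l → L) :
    mulHeight₁ (theta n xs ys) ≤ ((d ^ (k + l) * Q : ℕ) : ℝ) ^ Module.finrank ℚ L *
      ((∏ i, mulHeight₁ (xs i) ^ (d - 1)) * ∏ j, mulHeight₁ (ys j) ^ (d - 1)) := by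
  have F1 : ∀ {m : ℕ} (xs : Fin m → L), FS fun v => ∏ i, mx (xs i) v ^ (d - 1) :=
    fun xs => FS.prod _ fun i => (FS_mx _).pow _
  have E1 : ∀ {m : ℕ} (xs : Fin m → L), Ht (fun v => ∏ i, mx (xs i) v ^ (d - 1)) =
      ∏ i, mulHeight₁ (xs i) ^ (d - 1) := by
    intro m xs
    rw [Ht_prod Finset.univ (F := fun i v => mx (xs i) v ^ (d - 1)) fun i => (FS_mx _).pow _]
    apply Finset.prod_congr rfl
    intro i _
    rw [Ht_pow (FS_mx _), Ht_mx]
  have G1 : ∀ {m : ℕ} (xs : Fin m → L) (v : L → ℝ), 1 ≤ ∏ i, mx (xs i) v ^ (d - 1) := by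
    intro m xs v
    have : (1 : ℝ) = ∏ i : Fin m, 1 := by simp
    rw [this]
    exact Finset.prod_le_prod (fun _ _ => zero_le_one) fun i _ => one_le_pow₀ (one_le_mx _ _)
  rw [← Ht_mx, ← E1, ← E1, ← Ht_mul (F1 xs) (F1 ys)]
  have hc1 : (1 : ℝ) ≤ ((d ^ (k + l) * Q : ℕ) : ℝ) := by
    exact_mod_cast Nat.mul_pos (pow_pos hd _) hQ
  apply Ht_le (FS_mx _) ((F1 xs).mul (F1 ys)) _ (by positivity)
  · intro v; exact (mx_pos _ _).le
  · intro v; exact (mx_pos _ _).le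
  · intro v
    have g := one_le_mul_of_one_le_of_one_le (G1 xs fun x => v x) (G1 ys fun x => v x)
    apply max_le
    · unfold theta
      refine (inf_sum_le _ _ v (c := Q * ((∏ i, mx (xs i) (fun x => v x) ^ (d - 1)) *
        ∏ j, mx (ys j) (fun x => v x) ^ (d - 1))) ?_).trans (le_of_eq ?_)
      · intro e _
        refine term_le (Plc.inf v 1) xs ys e _ ?_
        refine (inf_intCast (n e) v).le.trans ?_
        exact_mod_cast hn e
      · simp only [Finset.card_univ, Fintype.card_prod, Fintype.card_fun, Fintype.card_fin]
        push_cast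
        ring
    · exact one_le_mul_of_one_le_of_one_le hc1 g
  · intro v
    have g := one_le_mul_of_one_le_of_one_le (G1 xs fun x => v x) (G1 ys fun x => v x)
    apply max_le
    · unfold theta
      refine fin_sum_le _ _ v (by linarith) ?_
      intro e _
      have := term_le (Plc.fin v 1) xs ys e (n e : L) (c := 1) (fin_intCast_le_one _ v)
      rwa [one_mul] at this
    · exact g

/-- (6.5) -/
lemma theta_lower {K : Type u} [Field K] [NumberField K] [Algebra K L] (θ : L) (hθ : θ ≠ 0)
    (a : 𝓞 K) (ha : a ≠ 0) (h T : ℕ)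
    (hw : ∀ w : FinitePlace L, w (algebraMap K L a) < 1 →
      w θ ^ h ≤ w (algebraMap K L a) ^ T) :
    |((Algebra.norm ℚ (a : K) : ℚ) : ℝ)| ^ (T * Module.finrank K L) ≤ mulHeight₁ θ ^ h := by
  have haK : (a : K) ≠ 0 := by simpa using ha
  have haL : algebraMap K L a ≠ 0 := by simpa using ha
  set b := algebraMap K L a with hb
  have h_integ : ∀ w : FinitePlace L, w b ≤ 1 := by
    intro w
    have : b = ((algebraMap (𝓞 K) (𝓞 L) a : 𝓞 L) : L) := by
      exact (IsScalarTower.algebraMap_apply (𝓞 K) K L a).symm.trans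
        (IsScalarTower.algebraMap_apply (𝓞 K) (𝓞 L) L a)
    rw [this]
    exact fin_int_le_one _ _
  have hN : Algebra.norm ℚ b = Algebra.norm ℚ (a : K) ^ Module.finrank K L := by
    rw [hb, ← Algebra.norm_norm (S := K), Algebra.norm_algebraMap, map_pow]
  have hN0 : Algebra.norm ℚ b ≠ 0 := Algebra.norm_ne_zero_iff.2 haL
  have h1 := FinitePlace.prod_eq_inv_abs_norm haL
  have hle : (∏ᶠ w : FinitePlace L, (1 : ℝ)) ≤
      ∏ᶠ w : FinitePlace L, (w b ^ T * mx θ⁻¹ (fun x => w x) ^ h) := by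
    apply finprod_le_finprod
    · simp [Function.HasFiniteMulSupport]
    · intro w; exact zero_le_one
    · exact ((FS_ev haL).pow T).mul ((FS_mx θ⁻¹).pow h)
    · intro w
      have hwb : 0 < w b := FinitePlace.pos_iff.2 haL
      have hwθ : 0 < w θ := FinitePlace.pos_iff.2 hθ
      rcases (h_integ w).lt_or_eq with hlt | heq
      · have h2 := hw w hlt
        have h3 : (w θ)⁻¹ ≤ mx θ⁻¹ (fun x => w x) := by
          refine le_trans (le_of_eq ?_) (le_mx _ _)
          exact (map_inv₀ w θ).symm
        calc (1 : ℝ) = w θ ^ h * (w θ)⁻¹ ^ h := by rw [← mul_pow, mul_inv_cancel₀ hwθ.ne', one_pow]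
          _ ≤ w b ^ T * mx θ⁻¹ (fun x => w x) ^ h := by
            apply mul_le_mul h2 (pow_le_pow_left₀ (inv_nonneg.2 hwθ.le) h3 h) _ _
            · exact pow_nonneg (inv_nonneg.2 hwθ.le) _
            · exact pow_nonneg hwb.le _
      · simp only [heq, one_pow, one_mul]
        exact one_le_pow₀ (one_le_mx _ _)
  have h2 := finprod_pow (FS_ev haL) T
  have h3 := finprod_pow (FS_mx θ⁻¹) h
  simp only at h2 h3
  rw [finprod_one, finprod_mul_distrib ((FS_ev haL).pow T) ((FS_mx θ⁻¹).pow h)] at hle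
  simp only at hle
  rw [← h2, ← h3, h1] at hle
  have h5 : ∏ᶠ w : FinitePlace L, mx θ⁻¹ (fun x => w x) ≤ mulHeight₁ θ := by
    rw [← mulHeight₁_inv θ, ← Ht_mx, Ht]
    apply le_mul_of_one_le_left
    · exact finprod_induction (p := fun x => 0 ≤ x) zero_le_one (fun _ _ => mul_nonneg)
        fun w => (mx_pos _ _).le
    · have : (1 : ℝ) = ∏ i : InfinitePlace L, 1 := by simp only [Finset.prod_const_one]
      rw [this]
      exact Finset.prod_le_prod (fun _ _ => zero_le_one) fun i _ => one_le_pow₀ (one_le_mx _ _)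
  have h6 : 0 ≤ ∏ᶠ w : FinitePlace L, mx θ⁻¹ (fun x => w x) :=
    finprod_induction (p := fun x => 0 ≤ x) zero_le_one (fun _ _ => mul_nonneg)
        fun w => (mx_pos _ _).le
  have h7 := pow_le_pow_left₀ h6 h5 h
  have h8 : |((Algebra.norm ℚ (a : K) : ℚ) : ℝ)| ^ (T * Module.finrank K L) =
      |((Algebra.norm ℚ b : ℚ) : ℝ)| ^ T := by
    rw [hN]; push_cast; rw [abs_pow, ← pow_mul, mul_comm]
  rw [h8]
  have h9 : 0 < |((Algebra.norm ℚ b : ℚ) : ℝ)| := by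
    rw [abs_pos]; exact_mod_cast hN0
  refine le_trans ?_ h7
  have h10 : (|((Algebra.norm ℚ b : ℚ) : ℝ)|⁻¹) ^ T = (|((Algebra.norm ℚ b : ℚ) : ℝ)| ^ T)⁻¹ := inv_pow _ _
  push_cast at hle h10 ⊢
  rw [h10, inv_mul_eq_div, le_div_iff₀ (pow_pos h9 _), one_mul] at hle
  exact hle

end M6c
end ArbPCF

namespace ArbPCF
section M7a
set_option linter.unusedSectionVars false
open IsLocalRing

open scoped Pointwise

variable (A : Type*) {K k : Type*} [CommRing A] [IsDomain A] [IsLocalRing A] [IsIntegrallyClosed A]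
  [Field K] [Algebra A K] [IsFractionRing A K] [Field k] [Algebra K k] [Algebra A k]
  [IsScalarTower A K k] [IsGalois K k]

/-- `V` dominates the local ring `A` -/
structure Dom (V : ValuationSubring k) : Prop where
  mem : ∀ a : A, algebraMap A k a ∈ V
  non : ∀ a ∈ maximalIdeal A, algebraMap A k a ∈ V.nonunits

include K in
lemma exists_dom : ∃ V : ValuationSubring k, Dom A V := by
  have hinj : Function.Injective (algebraMap A k) := by
    rw [IsScalarTower.algebraMap_eq A K k]
    exact (algebraMap K k).injective.comp (IsFractionRing.injective A K)
  let R : Subring k := (algebraMap A k).range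
  let e : A ≃+* R := RingEquiv.ofBijective (algebraMap A k).rangeRestrict
    ⟨fun x y h => hinj (congrArg Subtype.val h), (algebraMap A k).rangeRestrict_surjective⟩
  have hI : (maximalIdeal A).comap (e.symm : R →+* A) ≠ ⊤ :=
    Ideal.comap_ne_top _ (Ideal.IsPrime.ne_top inferInstance)
  obtain ⟨V, h1, h2⟩ := Ideal.image_subset_nonunits_valuationSubring _ hI
  refine ⟨V, fun a => h1 ⟨a, rfl⟩, fun a ha => h2 ⟨e a, ?_, rfl⟩⟩
  simp [Ideal.mem_comap, ha]

variable {A}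

lemma Dom.int {V : ValuationSubring k} (h : Dom A V) {x : k} (hx : IsIntegral A x) : x ∈ V := by
  let f : A →+* V := (algebraMap A k).codRestrict V.toSubring h.mem
  have : IsIntegral V x := by
    obtain ⟨g, hg, hx⟩ := hx
    refine ⟨g.map f, hg.map _, ?_⟩
    rw [eval₂_map]
    exact hx
  obtain ⟨y, hy⟩ := IsIntegrallyClosed.isIntegral_iff.1 this
  rw [← hy]
  exact y.2

/-- the centre of `V` -/
noncomputable def cen (V : ValuationSubring k) (h : Dom A V) : Ideal (integralClosure A k) :=
  (maximalIdeal V).comap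
    ((algebraMap (integralClosure A k) k).codRestrict V.toSubring fun x => h.int x.2)

lemma mem_cen {V : ValuationSubring k} (h : Dom A V) (x : integralClosure A k) :
    x ∈ cen V h ↔ (x : k) ∈ V.nonunits := by
  rw [cen, Ideal.mem_comap, ValuationSubring.mem_nonunits_iff_exists_mem_maximalIdeal]
  constructor
  · intro hx; exact ⟨h.int x.2, hx⟩
  · rintro ⟨_, hx⟩; exact hx

instance {V : ValuationSubring k} (h : Dom A V) : (cen V h).IsPrime := by
  unfold cen; infer_instance

lemma cen_under {V : ValuationSubring k} (h : Dom A V) : (cen V h).under A = maximalIdeal A := by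
  symm
  apply (maximalIdeal.isMaximal A).eq_of_le (Ideal.IsPrime.ne_top inferInstance)
  intro a ha
  rw [Ideal.mem_comap, mem_cen]
  exact h.non a ha

noncomputable local instance act : MulSemiringAction (k ≃ₐ[K] k) (integralClosure A k) :=
  IsIntegralClosure.MulSemiringAction A K k (integralClosure A k)

lemma act_coe (g : k ≃ₐ[K] k) (b : integralClosure A k) : ((g • b : integralClosure A k) : k) = g b :=
  algebraMap_galRestrict_apply A g b

local instance : SMulCommClass (k ≃ₐ[K] k) A (integralClosure A k) := by
  refine ⟨fun g a b => ?_⟩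
  apply Subtype.ext
  rw [act_coe]
  simp only [Algebra.smul_def]
  rw [MulMemClass.coe_mul, MulMemClass.coe_mul, act_coe, map_mul]
  congr 1
  change g (algebraMap A k a) = algebraMap A k a
  rw [IsScalarTower.algebraMap_apply A K k, AlgEquiv.commutes]

local instance : Algebra.IsInvariant A (integralClosure A k) (k ≃ₐ[K] k) := by
  refine ⟨fun b hb => ?_⟩
  have h1 : ∀ g : k ≃ₐ[K] k, g (b : k) = b := fun g => by rw [← act_coe, hb g]
  obtain ⟨c, hc⟩ := (InfiniteGalois.mem_range_algebraMap_iff_fixed (k := K) (b : k)).2 h1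
  have h2 : IsIntegral A (b : k) := b.2
  rw [← hc, isIntegral_algebraMap_iff (algebraMap K k).injective] at h2
  obtain ⟨a, rfl⟩ := IsIntegrallyClosed.algebraMap_eq_of_integral h2
  refine ⟨a, Subtype.ext ?_⟩
  rw [← hc, ← IsScalarTower.algebraMap_apply A K k]
  rfl

local instance : TopologicalSpace (integralClosure A k) := ⊥
local instance : DiscreteTopology (integralClosure A k) := ⟨rfl⟩
local instance : ContinuousSMul (k ≃ₐ[K] k) (integralClosure A k) := by
  rw [continuousSMul_iff_stabilizer_isOpen]
  intro b
  have h1 := stabilizer_isOpen_of_isIntegral (K := K) (b : k)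
  convert h1 using 1
  ext g
  simp only [SetLike.mem_coe, MulAction.mem_stabilizer_iff]
  rw [Subtype.ext_iff, act_coe]
  rfl

/-- transitivity: an integral element all of whose conjugates are units at `V` is a unit -/
lemma Dom.inv_int {V : ValuationSubring k} (h : Dom A V) {x : k} (hx : IsIntegral A x)
    (hu : ∀ g : k ≃ₐ[K] k, g x ∉ V.nonunits) : IsIntegral A x⁻¹ := by
  let b : integralClosure A k := ⟨x, hx⟩
  by_cases hb : IsUnit b
  · obtain ⟨c, hc⟩ := hb.exists_right_inv
    have : x * c = 1 := congrArg Subtype.val hc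
    rw [inv_eq_of_mul_eq_one_right this]
    exact c.2
  · exfalso
    obtain ⟨M, hM, hbM⟩ := exists_max_ideal_of_mem_nonunits hb
    have h1 : M.under A = maximalIdeal A :=
      eq_maximalIdeal (Ideal.isMaximal_comap_of_isIntegral_of_isMaximal M)
    obtain ⟨g, hg⟩ := Algebra.IsInvariant.exists_smul_of_under_eq_of_profinite (G := k ≃ₐ[K] k)
      M (cen V h) (h1.trans (cen_under h).symm)
    apply hu g
    have : g • b ∈ cen V h := by
      rw [hg]
      exact Ideal.smul_mem_pointwise_smul _ _ _ hbM
    rw [mem_cen, act_coe] at this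
    exact this

/-- existence of a Frobenius -/
lemma Dom.frob [Finite (ResidueField A)] {V : ValuationSubring k} (h : Dom A V) :
    ∃ Φ : k ≃ₐ[K] k, ∀ x : k, IsIntegral A x →
      Φ x - x ^ (Nat.card (ResidueField A)) ∈ V.nonunits := by
  have : (cen V h).LiesOver (maximalIdeal A) := ⟨(cen_under h).symm⟩
  have hmax : (cen V h).IsMaximal := Ideal.isMaximal_of_isIntegral_of_isMaximal_comap _ (by
    have := cen_under h
    rw [Ideal.under] at this
    rw [this]; infer_instance)
  let : Field (A ⧸ maximalIdeal A) := Ideal.Quotient.field _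
  let : Field (integralClosure A k ⧸ cen V h) := Ideal.Quotient.field _
  have : Finite (A ⧸ maximalIdeal A) := ‹Finite (ResidueField A)›
  let : Fintype (A ⧸ maximalIdeal A) := Fintype.ofFinite _
  have : Algebra.IsIntegral (A ⧸ maximalIdeal A) (integralClosure A k ⧸ cen V h) := inferInstance
  have : Algebra.IsAlgebraic (A ⧸ maximalIdeal A) (integralClosure A k ⧸ cen V h) :=
    Algebra.IsIntegral.isAlgebraic
  obtain ⟨⟨Φ, hΦ⟩, hs⟩ := Ideal.Quotient.stabilizerHom_surjective_of_profinite (G := k ≃ₐ[K] k)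
    (maximalIdeal A) (cen V h)
    (FiniteField.frobeniusAlgEquivOfAlgebraic (A ⧸ maximalIdeal A) (integralClosure A k ⧸ cen V h))
  refine ⟨Φ, fun x hx => ?_⟩
  let b : integralClosure A k := ⟨x, hx⟩
  have h1 := DFunLike.congr_fun hs (Ideal.Quotient.mk _ b)
  have h2 : Ideal.Quotient.mk (cen V h) (Φ • b) =
    (Ideal.Quotient.mk (cen V h) b) ^ (Fintype.card (A ⧸ maximalIdeal A)) := h1
  rw [← map_pow, Ideal.Quotient.eq, mem_cen] at h2
  have h3 : Nat.card (ResidueField A) = Fintype.card (A ⧸ maximalIdeal A) :=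
    Nat.card_eq_fintype_card (α := A ⧸ maximalIdeal A)
  rw [h3]
  have h4 : ((Φ • b - b ^ Fintype.card (A ⧸ maximalIdeal A) : integralClosure A k) : k) =
      Φ x - x ^ Fintype.card (A ⧸ maximalIdeal A) := by
    rw [AddSubgroupClass.coe_sub, act_coe]; rfl
  rw [← h4]
  exact h2

end M7a
end ArbPCF

namespace ArbPCF
section M7b
set_option linter.unusedSectionVars false
open IsLocalRing

lemma frob_poly {A R : Type*} [CommRing A] [CommRing R] [Algebra A R] (π : A) (Q : ℕ)
    (hQp : ∃ l f : ℕ, l.Prime ∧ Q = l ^ f ∧ π ∣ (l : A)) (hQa : ∀ a : A, π ∣ a ^ Q - a)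
    (f : A[X]) (x : R) :
    algebraMap A R π ∣ (f.map (algebraMap A R)).eval (x ^ Q)
      - (f.map (algebraMap A R)).eval x ^ Q := by
  obtain ⟨l, e, hl, hQ, hd⟩ := hQp
  have hl' : algebraMap A R π ∣ (l : R) := by
    have := map_dvd (algebraMap A R) hd
    simpa using this
  induction f using Polynomial.induction_on' with
  | add f g hf hg =>
    rw [Polynomial.map_add, eval_add, eval_add]
    have h2 := exists_add_pow_prime_pow_eq hl ((f.map (algebraMap A R)).eval x)
      ((g.map (algebraMap A R)).eval x) e
    obtain ⟨r, hr⟩ := h2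
    rw [← hQ] at hr
    rw [hr]
    have h3 := dvd_add hf hg
    have h4 : algebraMap A R π ∣ (l : R) * ((f.map (algebraMap A R)).eval x) *
      ((g.map (algebraMap A R)).eval x) * r := by
      rw [mul_assoc, mul_assoc]; exact hl'.mul_right _
    convert dvd_sub h3 h4 using 1
    ring
  | monomial n a =>
    simp only [map_monomial, eval_monomial]
    have h1 := map_dvd (algebraMap A R) (hQa a)
    rw [map_sub, map_pow] at h1
    have : algebraMap A R a * (x ^ Q) ^ n - (algebraMap A R a * x ^ n) ^ Q =
      -((algebraMap A R a ^ Q - algebraMap A R a) * (x ^ n) ^ Q) := by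
      rw [mul_pow, ← pow_mul, ← pow_mul, mul_comm Q n]; ring
    rw [this, dvd_neg]
    exact h1.mul_right _

variable {A K k : Type*} [CommRing A] [IsDomain A] [IsLocalRing A] [IsIntegrallyClosed A]
  [Field K] [Algebra A K] [IsFractionRing A K] [Field k] [Algebra K k] [Algebra A k]
  [IsScalarTower A K k] [IsGalois K k]

lemma sig_int (σ : k ≃ₐ[K] k) {x : k} (hx : IsIntegral A x) : IsIntegral A (σ x) :=
  hx.map ((σ : k →ₐ[K] k).restrictScalars A)

lemma sig_A (σ : k ≃ₐ[K] k) (a : A) : σ (algebraMap A k a) = algebraMap A k a := by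
  rw [IsScalarTower.algebraMap_apply A K k, AlgEquiv.commutes]

lemma sig_eval (σ : k ≃ₐ[K] k) (f : A[X]) (x : k) :
    σ ((f.map (algebraMap A k)).eval x) = (f.map (algebraMap A k)).eval (σ x) := by
  have := Polynomial.hom_eval₂ f (algebraMap A k) (σ : k →+* k) x
  rw [eval_map, eval_map]
  have h2 : (σ : k →+* k).comp (algebraMap A k) = algebraMap A k := by
    ext a
    exact sig_A σ a
  rw [h2] at this
  exact this

structure Setup (pA qA : A[X]) (γ : A) (V : ValuationSubring k) (Φ : k ≃ₐ[K] k) (π : A) (Q : ℕ) :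
    Prop where
  dom : Dom A V
  monic : pA.Monic
  cop : IsCoprime pA qA
  good : Good (pA.map (algebraMap A k)) (qA.map (algebraMap A k))
  frob : ∀ x, IsIntegral A x → Φ x - x ^ Q ∈ V.nonunits
  max : maximalIdeal A = Ideal.span {π}
  Qp : ∃ l f : ℕ, l.Prime ∧ Q = l ^ f ∧ π ∣ (l : A)
  Qa : ∀ a : A, π ∣ a ^ Q - a
  g1 : ∀ m, 1 ≤ m → ∀ t ∈ Lev (pA.map (algebraMap A k)) (qA.map (algebraMap A k))
    (algebraMap A k γ) m, t - algebraMap A k γ ∉ V.nonunits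
  g2 : ∀ m, 1 ≤ m → ∀ t ∈ Lev (pA.map (algebraMap A k)) (qA.map (algebraMap A k))
    (algebraMap A k γ) m,
    (Wr (pA.map (algebraMap A k)) (qA.map (algebraMap A k))).eval t ∉ V.nonunits
  comm : ∀ σ τ : k ≃ₐ[K] k, ∀ m, ∀ t ∈ Lev (pA.map (algebraMap A k)) (qA.map (algebraMap A k))
    (algebraMap A k γ) m, σ (τ t) = τ (σ t)

variable {pA qA : A[X]} {γ : A} {V : ValuationSubring k} {Φ : k ≃ₐ[K] k} {π : A} {Q : ℕ}

lemma lev_sig (σ : k ≃ₐ[K] k) (m : ℕ) : ∀ t, t ∈ Lev (pA.map (algebraMap A k))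
    (qA.map (algebraMap A k)) (algebraMap A k γ) m → σ t ∈ Lev (pA.map (algebraMap A k))
    (qA.map (algebraMap A k)) (algebraMap A k γ) m := by
  induction m with
  | zero =>
    intro t ht
    rw [mem_Lev_zero] at ht ⊢
    rw [ht, sig_A]
  | succ m ih =>
    intro t ht
    rw [Lev_succ] at ht ⊢
    constructor
    · rw [← sig_eval]
      simpa using ht.1
    · have := ih _ ht.2
      rw [phi, map_div₀, sig_eval, sig_eval] at this
      exact this

namespace Setup
variable (h : Setup (K := K) pA qA γ V Φ π Q)
include h

lemma lev_int (m : ℕ) : ∀ t, t ∈ Lev (pA.map (algebraMap A k))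
    (qA.map (algebraMap A k)) (algebraMap A k γ) m → IsIntegral A t := by
  induction m with
  | zero =>
    intro t ht
    rw [mem_Lev_zero] at ht
    rw [ht]; exact isIntegral_algebraMap
  | succ m ih =>
    intro x hx
    obtain ⟨t, ht, hxt⟩ := (h.good.Lev_succ' _ _).1 hx
    have h1 := ih t ht
    let B := integralClosure A k
    let b : B := ⟨t, h1⟩
    have h2 : (pA.map (algebraMap A B) - C b * qA.map (algebraMap A B)).Monic := by
      apply Monic.sub_of_left (h.monic.map _)
      by_cases hq : qA = 0
      · have := h.good.q_ne
        simp [hq] at this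
      have hinj : Function.Injective (algebraMap A k) := by
        rw [IsScalarTower.algebraMap_eq A K k]
        exact (algebraMap K k).injective.comp (IsFractionRing.injective A K)
      have h5 := h.good.lt
      rw [natDegree_map_eq_of_injective hinj, natDegree_map_eq_of_injective hinj] at h5
      have h7 : (C b * qA.map (algebraMap A B)).degree ≤ qA.natDegree := by
        apply degree_le_of_natDegree_le
        exact (natDegree_C_mul_le _ _).trans natDegree_map_le
      rw [h.monic.degree_map, degree_eq_natDegree h.monic.ne_zero]
      exact lt_of_le_of_lt h7 (by exact_mod_cast h5)
    have h3 : IsIntegral B x := by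
      refine ⟨_, h2, ?_⟩
      rw [eval₂_sub, eval₂_mul, eval₂_C, eval₂_map, eval₂_map, ← IsScalarTower.algebraMap_eq,
        ← eval_map, ← eval_map, hxt]
      exact sub_self _
    exact isIntegral_trans x h3

lemma eval_int (f : A[X]) {x : k} (hx : IsIntegral A x) :
    IsIntegral A ((f.map (algebraMap A k)).eval x) := by
  rw [eval_map]
  have := (aeval (⟨x, hx⟩ : integralClosure A k) f).2
  rw [← aeval_def]
  convert this using 1
  rw [← Subalgebra.coe_val, ← aeval_algHom_apply]
  rfl

lemma q_inv (m : ℕ) (x : k) (hx : x ∈ Lev (pA.map (algebraMap A k))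
    (qA.map (algebraMap A k)) (algebraMap A k γ) (m+1)) :
    IsIntegral A ((qA.map (algebraMap A k)).eval x)⁻¹ := by
  obtain ⟨u, v, huv⟩ := h.cop
  have h1 := h.lev_int _ x hx
  have h2 := h.lev_int _ _ hx.2
  have h3 := congrArg (fun f => (f.map (algebraMap A k)).eval x) huv
  simp only [Polynomial.map_add, Polynomial.map_mul, Polynomial.map_one, eval_add, eval_mul,
    eval_one] at h3
  have h4 : ((qA.map (algebraMap A k)).eval x)⁻¹ = (u.map (algebraMap A k)).eval x *
      phi (pA.map (algebraMap A k)) (qA.map (algebraMap A k)) x + (v.map (algebraMap A k)).eval x := by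
    have := hx.1
    rw [phi]
    field_simp
    rw [← h3]; ring
  rw [h4]
  exact ((h.eval_int u h1).mul h2).add (h.eval_int v h1)

lemma non_mul {x y : k} (hx : x ∈ V.nonunits) (hy : IsIntegral A y) : x * y ∈ V.nonunits := by
  rw [ValuationSubring.mem_nonunits_iff] at *
  rw [map_mul]
  have := (V.valuation_le_one_iff _).2 (h.dom.int hy)
  exact lt_of_le_of_lt (mul_le_of_le_one_right' this) hx

lemma frob_lev (m : ℕ) : ∀ x, x ∈ Lev (pA.map (algebraMap A k))
    (qA.map (algebraMap A k)) (algebraMap A k γ) m →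
    ∃ c : k, IsIntegral A c ∧ Φ x - x ^ Q = algebraMap A k π * c := by
  induction m with
  | zero =>
    intro x hx
    rw [mem_Lev_zero] at hx
    obtain ⟨c, hc⟩ := h.Qa γ
    refine ⟨algebraMap A k (-c), isIntegral_algebraMap, ?_⟩
    rw [hx, sig_A, ← map_pow, ← map_sub, ← map_mul]
    congr 1
    linear_combination -hc
  | succ m ih =>
    intro x hx
    obtain ⟨t, ht, hxt⟩ := (h.good.Lev_succ' _ _).1 hx
    have hxi := h.lev_int _ x hx
    have hti := h.lev_int _ t ht
    let B := integralClosure A k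
    let bx : B := ⟨x, hxi⟩
    let bt : B := ⟨t, hti⟩
    let by' : B := ⟨Φ x, sig_int Φ hxi⟩
    let bs : B := ⟨Φ t, sig_int Φ hti⟩
    let f := algebraMap A B
    have hcoe : ∀ (F : A[X]) (b : B), (((F.map f).eval b : B) : k) =
        (F.map (algebraMap A k)).eval (b : k) := by
      intro F b
      rw [IsScalarTower.algebraMap_eq A B k, ← Polynomial.map_map]
      exact (eval_map_apply (algebraMap B k) b).symm
    obtain ⟨c0, hc0, hct⟩ := ih t ht
    have hct' : f π ∣ bs - bt ^ Q := ⟨⟨c0, hc0⟩, Subtype.ext hct⟩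
    have e1 : (pA.map f).eval bx = bt * (qA.map f).eval bx := by
      apply Subtype.ext
      rw [MulMemClass.coe_mul, hcoe, hcoe]
      exact hxt
    have e2 : (pA.map f).eval by' = bs * (qA.map f).eval by' := by
      apply Subtype.ext
      rw [MulMemClass.coe_mul, hcoe, hcoe]
      change _ = Φ t * _
      rw [← sig_eval, ← sig_eval, hxt, map_mul]
    let g : B[X] := pA.map f - C bs * qA.map f
    have hg0 : g.eval by' = 0 := by
      simp only [g, eval_sub, eval_mul, eval_C, e2, sub_self]
    have hgx : f π ∣ g.eval (bx ^ Q) := by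
      have i1 := frob_poly (R := B) π Q h.Qp h.Qa pA bx
      have i2 := frob_poly (R := B) π Q h.Qp h.Qa qA bx
      have i3 : g.eval (bx ^ Q) = ((pA.map f).eval (bx ^ Q) - (pA.map f).eval bx ^ Q)
          - bs * ((qA.map f).eval (bx ^ Q) - (qA.map f).eval bx ^ Q)
          - (bs - bt ^ Q) * (qA.map f).eval bx ^ Q := by
        rw [e1]
        simp only [g, eval_sub, eval_mul, eval_C]
        ring
      rw [i3]
      exact dvd_sub (dvd_sub i1 (i2.mul_left _)) (hct'.mul_right _)
    obtain ⟨r, hr⟩ := binomExpansion g by' (bx ^ Q - by')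
    rw [add_sub_cancel, hg0, zero_add] at hr
    set e : B := bx ^ Q - by' with he
    set u : B := g.derivative.eval by' + r * e with hu
    have hru : g.eval (bx ^ Q) = e * u := by rw [hr, hu]; ring
    have hek : (e : k) = x ^ Q - Φ x := rfl
    have hui : IsIntegral A (u : k)⁻¹ := by
      apply h.dom.inv_int (K := K) u.2
      intro σ hσ
      have hsx := lev_sig (K := K) σ _ _ hx
      have j1 : σ (e : k) ∈ V.nonunits := by
        rw [hek, map_sub, map_pow, h.comm σ Φ _ x hx]
        have := h.frob (σ x) (sig_int σ hxi)
        rw [ValuationSubring.mem_nonunits_iff] at this ⊢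
        rwa [← Valuation.map_neg, neg_sub] at this
      have j2 : σ (g.derivative.eval by' : B) ∈ V.nonunits := by
        have j3 := h.non_mul j1 (sig_int σ r.2)
        have j4 : σ (g.derivative.eval by' : B) = σ (u : k) - σ (e : k) * σ (r : k) := by
          rw [hu, ← map_mul, ← map_sub]
          congr 1
          simp only [AddMemClass.coe_add, MulMemClass.coe_mul]
          ring
        rw [j4, ValuationSubring.mem_nonunits_iff]
        rw [ValuationSubring.mem_nonunits_iff] at hσ j3
        exact lt_of_le_of_lt (Valuation.map_sub _ _ _) (max_lt hσ j3)
      have hy := lev_sig (K := K) σ _ _ (lev_sig (K := K) Φ _ _ hx)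
      apply h.g2 (m+1) (by omega) _ hy
      have j5 := h.non_mul j2 (h.eval_int qA (h.lev_int _ _ hy))
      convert j5 using 1
      have j6 : (pA.map (algebraMap A k)).eval (Φ x) = Φ t * (qA.map (algebraMap A k)).eval (Φ x) := by
        rw [← sig_eval, ← sig_eval, hxt, map_mul]
      have j7 := h.good.Wr_eval j6
      have j8 : Wr (pA.map (algebraMap A k)) (qA.map (algebraMap A k)) =
        (WrR pA qA).map (algebraMap A k) := by
        rw [WrR, Wr]; simp [derivative_map]
      rw [← sig_eval, ← map_mul, j8, ← sig_eval, ← j8, j7]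
      congr 2
      simp only [g, derivative_sub, derivative_mul, derivative_C, zero_mul, zero_add, eval_sub,
        eval_mul, eval_C, derivative_map]
      rw [AddSubgroupClass.coe_sub, MulMemClass.coe_mul, hcoe, hcoe]
    have hu0 : (u : k) ≠ 0 := by
      intro h0
      have hy := lev_sig (K := K) Φ _ _ hx
      have j6 : (pA.map (algebraMap A k)).eval (Φ x) = Φ t * (qA.map (algebraMap A k)).eval (Φ x) := by
        rw [← sig_eval, ← sig_eval, hxt, map_mul]
      have j7 := h.good.Wr_eval j6
      apply h.g2 (m+1) (by omega) _ hy
      have j3 := h.non_mul (h.frob x hxi) r.2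
      have j4 : ((g.derivative.eval by' : B) : k) = (Φ x - x ^ Q) * r := by
        have : ((g.derivative.eval by' : B) : k) + r * (e : k) = 0 := by
          rw [← h0, hu]; rfl
        rw [hek] at this
        linear_combination this
      have j5 := h.non_mul (j4 ▸ j3) (h.eval_int qA (h.lev_int _ _ hy))
      convert j5 using 1
      rw [j7]
      congr 1
      simp only [g, derivative_sub, derivative_mul, derivative_C, zero_mul, zero_add, eval_sub,
        eval_mul, eval_C, derivative_map]
      rw [AddSubgroupClass.coe_sub, MulMemClass.coe_mul, hcoe, hcoe]
    obtain ⟨c, hc⟩ := hgx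
    rw [hru] at hc
    refine ⟨-((c : k) * (u : k)⁻¹), ((c.2 : IsIntegral A (c:k)).mul hui).neg, ?_⟩
    have hc' : (e : k) * (u : k) = algebraMap A k π * (c : k) := congrArg Subtype.val hc
    have : (e : k) = algebraMap A k π * ((c : k) * (u : k)⁻¹) := by
      rw [← mul_assoc, ← hc', mul_assoc, mul_inv_cancel₀ hu0, mul_one]
    rw [hek] at this
    linear_combination -this

end Setup
end M7b
end ArbPCF

namespace ArbPCF
section M7c
set_option linter.unusedSectionVars false
open IsLocalRing

variable {A K k : Type*} [CommRing A] [IsDomain A] [IsLocalRing A] [IsIntegrallyClosed A]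
  [Field K] [Algebra A K] [IsFractionRing A K] [Field k] [Algebra K k] [Algebra A k]
  [IsScalarTower A K k] [IsGalois K k]

variable {pA qA : A[X]} {γ : A} {V : ValuationSubring k} {Φ : k ≃ₐ[K] k} {π : A} {Q : ℕ}

namespace Setup
variable (h : Setup (K := K) pA qA γ V Φ π Q)
include h

lemma ab_inv (m n : ℕ) (hmn : n ≤ m) (x : k) (hx : x ∈ Lev (pA.map (algebraMap A k))
    (qA.map (algebraMap A k)) (algebraMap A k γ) m) :
    IsIntegral A ((AB (pA.map (algebraMap A k)) (qA.map (algebraMap A k))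
      (pA.map (algebraMap A k)).natDegree n).2.eval x)⁻¹ := by
  induction n with
  | zero => simpa [AB] using isIntegral_one
  | succ n ih =>
    have h1 := (mem_Lev_iff _ _).1 hx
    rw [h.good.AB2_succ x n (fun i hi => h1.1 i (by omega)), mul_inv, ← inv_pow]
    apply IsIntegral.mul
    · exact (ih (by omega)).pow _
    · obtain ⟨j, rfl⟩ : ∃ j, m = j + 1 + n := ⟨m - 1 - n, by omega⟩
      exact h.q_inv j _ (Lev_iter hx)

lemma NN_theta (m k0 l0 : ℕ) (hk : k0 ≤ m) (hl : l0 ≤ m) (x : k)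
    (hx : x ∈ Lev (pA.map (algebraMap A k))
    (qA.map (algebraMap A k)) (algebraMap A k γ) m)
    (n : (Fin k0 → Fin (pA.map (algebraMap A k)).natDegree) ×
      (Fin l0 → Fin (pA.map (algebraMap A k)).natDegree) → ℤ) :
    ∃ u : k, u ≠ 0 ∧ IsIntegral A u⁻¹ ∧
      (NN (pA.map (algebraMap A k)) (qA.map (algebraMap A k)) n).evalEval x (Φ x) =
      u * theta n (fun i => (phi (pA.map (algebraMap A k)) (qA.map (algebraMap A k)))^[i] x)
        (fun i => (phi (pA.map (algebraMap A k)) (qA.map (algebraMap A k)))^[i] (Φ x)) := by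
  have hy := lev_sig (K := K) Φ _ _ hx
  have hx1 := (mem_Lev_iff _ _).1 hx
  have hy1 := (mem_Lev_iff _ _).1 hy
  set p := pA.map (algebraMap A k)
  set q := qA.map (algebraMap A k)
  refine ⟨(∏ i : Fin k0, (AB p q p.natDegree i).2.eval x ^ (p.natDegree - 1)) *
    (∏ i : Fin l0, (AB p q p.natDegree i).2.eval (Φ x) ^ (p.natDegree - 1)), ?_, ?_, ?_⟩
  · apply mul_ne_zero <;> rw [Finset.prod_ne_zero_iff] <;> intro i _ <;> apply pow_ne_zero
    · exact (h.good.AB_eval x i (fun j hj => hx1.1 j (by omega))).1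
    · exact (h.good.AB_eval (Φ x) i (fun j hj => hy1.1 j (by omega))).1
  · rw [mul_inv, ← Finset.prod_inv_distrib, ← Finset.prod_inv_distrib]
    apply IsIntegral.mul <;> apply IsIntegral.prod <;> intro i _ <;> rw [← inv_pow] <;>
      apply IsIntegral.pow
    · exact h.ab_inv m i (by omega) x hx
    · exact h.ab_inv m i (by omega) _ hy
  · rw [NN_evalEval, theta, Finset.mul_sum]
    apply Finset.sum_congr rfl
    intro e _
    rw [h.good.Ne_eval x k0 (fun j hj => hx1.1 j (by omega)),
      h.good.Ne_eval (Φ x) l0 (fun j hj => hy1.1 j (by omega))]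
    ring

lemma theta_dvd (m k0 l0 T : ℕ) (hk : k0 ≤ m) (hl : l0 ≤ m) (x : k)
    (hx : x ∈ Lev (pA.map (algebraMap A k))
    (qA.map (algebraMap A k)) (algebraMap A k γ) m)
    (n : (Fin k0 → Fin (pA.map (algebraMap A k)).natDegree) ×
      (Fin l0 → Fin (pA.map (algebraMap A k)).natDegree) → ℤ)
    (hn : ∀ j < T, ∀ i, ((taylor (X ^ Q) (NN pA qA n)).coeff j).coeff i ∈ Ideal.span {π ^ T}) :
    ∃ c : k, IsIntegral A c ∧
      theta n (fun i => (phi (pA.map (algebraMap A k)) (qA.map (algebraMap A k)))^[i] x)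
        (fun i => (phi (pA.map (algebraMap A k)) (qA.map (algebraMap A k)))^[i] (Φ x)) =
      algebraMap A k π ^ T * c := by
  obtain ⟨u, hu, hui, he⟩ := h.NN_theta m k0 l0 hk hl x hx n
  let B := integralClosure A k
  have hxi := h.lev_int _ x hx
  let bx : B := ⟨x, hxi⟩
  let bp : B := ⟨Φ x, sig_int Φ hxi⟩
  obtain ⟨c0, hc0, hct⟩ := h.frob_lev m x hx
  have h1 : algebraMap A B π ∣ bp - bx ^ Q := ⟨⟨c0, hc0⟩, Subtype.ext hct⟩
  obtain ⟨c, hc⟩ := siegel_dvd (B := B) (NN pA qA n) π Q T hn bx bp h1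
  have h2 : (NN (pA.map (algebraMap A k)) (qA.map (algebraMap A k)) n).evalEval x (Φ x) =
      algebraMap A k π ^ T * (c : k) := by
    have h3 := congrArg (algebraMap B k) hc
    rw [map_mul, map_pow, ← IsScalarTower.algebraMap_apply] at h3
    change _ = algebraMap A k π ^ T * (c : k) at h3
    rw [← h3, ← NN_map, NN_evalEval, NN_evalEval, map_sum]
    apply Finset.sum_congr rfl
    intro e _
    rw [map_mul, map_mul, map_intCast, ← eval_map_apply, ← eval_map_apply, ← Ne_map, ← Ne_map,
      Polynomial.map_map, Polynomial.map_map, ← IsScalarTower.algebraMap_eq]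
    rfl
  refine ⟨u⁻¹ * c, hui.mul c.2, ?_⟩
  rw [h2] at he
  field_simp
  rw [he, mul_comm]

lemma tree [IsAlgClosed k] : TreeData (pA.map (algebraMap A k)) (qA.map (algebraMap A k))
    (Lev (pA.map (algebraMap A k)) (qA.map (algebraMap A k)) (algebraMap A k γ)) Φ := by
  have key : ∀ m n x, m < n → x ∈ Lev (pA.map (algebraMap A k)) (qA.map (algebraMap A k))
      (algebraMap A k γ) m → x ∉ Lev (pA.map (algebraMap A k)) (qA.map (algebraMap A k))
      (algebraMap A k γ) n := by
    intro m n x hmn hm hn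
    obtain ⟨j, rfl⟩ : ∃ j, n = (j + 1) + m := ⟨n - m - 1, by omega⟩
    have h1 := Lev_iter hn
    rw [((mem_Lev_iff _ _).1 hm).2] at h1
    apply h.g1 (j+1) (by omega) _ h1
    rw [sub_self, ValuationSubring.mem_nonunits_iff, map_zero]
    exact zero_lt_one
  refine ⟨fun n x => h.good.Lev_succ' n x, fun n => h.good.Lev_nonempty n, ?_, ?_, ?_, ?_⟩
  · intro m n x hm hn
    rcases lt_trichotomy m n with h1 | h1 | h1
    · exact (key m n x h1 hm hn).elim
    · exact h1
    · exact (key n m x h1 hn hm).elim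
  · intro n x hx; exact lev_sig (K := K) Φ n x hx
  · intro n x t _ hxt
    rw [← sig_eval, ← sig_eval, hxt, map_mul]
  · intro n x hx h0
    apply h.g2 (n+1) (by omega) x hx
    rw [h0, ValuationSubring.mem_nonunits_iff, map_zero]
    exact zero_lt_one

lemma resQ (x y : (ResidueField V)[X]) : (x - y) ^ Q = x ^ Q - y ^ Q := by
  obtain ⟨l, f, hl, rfl, hd⟩ := h.Qp
  have h1 : (l : A) ∈ maximalIdeal A := by
    rw [h.max, Ideal.mem_span_singleton]; exact hd
  have h2 := h.dom.non _ h1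
  rw [map_natCast] at h2
  have h3 : ((l : ℕ) : ResidueField V) = 0 := by
    rw [← map_natCast (residue V), residue_eq_zero_iff]
    obtain ⟨_, h4⟩ := ValuationSubring.mem_nonunits_iff_exists_mem_maximalIdeal.1 h2
    exact h4
  have : Fact l.Prime := ⟨hl⟩
  have h5 : CharP (ResidueField V) l := by
    refine ringChar.of_eq ?_
    exact CharP.ringChar_of_prime_eq_zero hl h3
  have h6 : CharP (ResidueField V)[X] l := inferInstance
  exact sub_pow_char_pow x y f

lemma cong_iff {x y : k} (hx : x ∈ V) (hy : y ∈ V) : Cong V x y ↔ x - y ∈ V.nonunits := by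
  rw [ValuationSubring.mem_nonunits_iff_exists_mem_maximalIdeal]
  constructor
  · rintro ⟨a, b, rfl, rfl, h3⟩
    refine ⟨sub_mem hx hy, ?_⟩
    rw [← residue_eq_zero_iff]
    rw [← sub_eq_zero, ← map_sub] at h3
    exact h3
  · rintro ⟨h1, h2⟩
    refine ⟨⟨x, hx⟩, ⟨y, hy⟩, rfl, rfl, ?_⟩
    rw [← sub_eq_zero, ← map_sub, residue_eq_zero_iff]
    exact h2

lemma hT (n : ℕ) (x : k) (hx : x ∈ Lev (pA.map (algebraMap A k))
    (qA.map (algebraMap A k)) (algebraMap A k γ) n) :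
    ∃ a b : V, (a : k) = x ∧ (b : k) = Φ x ∧ residue V b = residue V a ^ Q := by
  have hxi := h.lev_int _ x hx
  have h1 := h.dom.int hxi
  have h2 := h.dom.int (sig_int Φ hxi)
  refine ⟨⟨x, h1⟩, ⟨_, h2⟩, rfl, rfl, ?_⟩
  obtain ⟨a, b, ha, hb, hab⟩ := (h.cong_iff h2 (pow_mem h1 Q)).2 (h.frob x hxi)
  rw [← map_pow]
  convert hab using 2
  · exact Subtype.ext ha.symm
  · exact Subtype.ext hb.symm

lemma unit_q {qV : V[X]} (hq : qV.map (algebraMap V k) = qA.map (algebraMap A k)) (n : ℕ) (x : k)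
    (hx : x ∈ Lev (pA.map (algebraMap A k))
    (qA.map (algebraMap A k)) (algebraMap A k γ) (n+1)) : UnitAt V qV x := by
  have hxi := h.dom.int (h.lev_int _ x hx)
  refine ⟨⟨x, hxi⟩, rfl, ?_⟩
  have h1 := h.dom.int (h.q_inv n x hx)
  refine IsUnit.of_mul_eq_one ⟨_, h1⟩ (Subtype.ext ?_)
  rw [MulMemClass.coe_mul, coe_eval, hq]
  exact mul_inv_cancel₀ hx.1

lemma hTd {pV qV : V[X]} (hp : pV.map (algebraMap V k) = pA.map (algebraMap A k))
    (hq : qV.map (algebraMap V k) = qA.map (algebraMap A k)) (m n : ℕ) (x : k)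
    (hx : x ∈ Lev (pA.map (algebraMap A k))
    (qA.map (algebraMap A k)) (algebraMap A k γ) m) (y : k)
    (hy : y ∈ Lev (pA.map (algebraMap A k))
    (qA.map (algebraMap A k)) (algebraMap A k γ) n) (hc : Cong V x y) : m = n := by
  have key : ∀ m n x y, m < n → x ∈ Lev (pA.map (algebraMap A k)) (qA.map (algebraMap A k))
      (algebraMap A k γ) m → y ∈ Lev (pA.map (algebraMap A k)) (qA.map (algebraMap A k))
      (algebraMap A k γ) n → ¬ Cong V y x := by
    intro m n x y hmn hm hn hc
    obtain ⟨j, rfl⟩ : ∃ j, n = (j + 1) + m := ⟨n - m - 1, by omega⟩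
    have h1 := Lev_iter hn
    apply h.g1 (j+1) (by omega) _ h1
    have h2 := Cong.iter hp hq hc m (fun i hi => by
      obtain ⟨r, rfl⟩ : ∃ r, m = (r + 1) + i := ⟨m - i - 1, by omega⟩
      exact h.unit_q hq r _ (Lev_iter hm)) m le_rfl
    rw [((mem_Lev_iff _ _).1 hm).2] at h2
    exact (h.cong_iff (h.dom.int (h.lev_int _ _ h1)) (h.dom.mem γ)).1 h2
  rcases lt_trichotomy m n with h1 | h1 | h1
  · exact (key m n x y h1 hx hy hc.symm).elim
  · exact h1
  · exact (key n m y x h1 hy hx hc).elim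

end Setup
end M7c
end ArbPCF

namespace ArbPCF
section M8a
set_option linter.unusedSectionVars false
open IsLocalRing NumberField IsDedekindDomain

variable {K : Type*} [Field K] [NumberField K]

lemma class_pow (v : HeightOneSpectrum (𝓞 K)) :
    ∃ (h : ℕ) (a : 𝓞 K), 1 ≤ h ∧ a ≠ 0 ∧ v.asIdeal ^ h = Ideal.span {a} ∧
      |((Algebra.norm ℚ (a : K) : ℚ) : ℝ)| = (Ideal.absNorm v.asIdeal : ℝ) ^ h := by
  let I : nonZeroDivisors (Ideal (𝓞 K)) := ⟨v.asIdeal, mem_nonZeroDivisors_of_ne_zero v.ne_bot⟩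
  have h1 : ClassGroup.mk0 I ^ (Fintype.card (ClassGroup (𝓞 K))) = 1 := pow_card_eq_one
  rw [← map_pow, ClassGroup.mk0_eq_one_iff] at h1
  have h2 : (v.asIdeal ^ (Fintype.card (ClassGroup (𝓞 K)))).IsPrincipal := h1
  obtain ⟨a, ha⟩ := h2
  have ha' : v.asIdeal ^ (Fintype.card (ClassGroup (𝓞 K))) = Ideal.span {a} := ha
  refine ⟨_, a, Fintype.card_pos, ?_, ha', ?_⟩
  · rintro rfl
    rw [Ideal.span_singleton_eq_bot.2 rfl] at ha'
    exact v.ne_bot (pow_eq_zero_iff (Fintype.card_pos.ne') |>.1 ha')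
  · have h3 := congrArg Ideal.absNorm ha'
    rw [map_pow, Ideal.absNorm_span_singleton] at h3
    rw [← Nat.cast_pow, h3, ← Algebra.coe_norm_int]
    simp

variable (v : HeightOneSpectrum (𝓞 K)) (A : Type*) [CommRing A] [IsDomain A] [IsLocalRing A]
  [Algebra (𝓞 K) A] [IsLocalization.AtPrime A v.asIdeal]

include v in
lemma loc_max : ∃ π : A, π ≠ 0 ∧ maximalIdeal A = Ideal.span {π} := by
  have : IsDiscreteValuationRing A :=
    IsLocalization.AtPrime.isDiscreteValuationRing_of_dedekind_domain (𝓞 K) v.ne_bot A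
  obtain ⟨π, hπ⟩ := IsDiscreteValuationRing.exists_irreducible A
  exact ⟨π, hπ.ne_zero, hπ.maximalIdeal_eq⟩

lemma loc_card (T : ℕ) : Nat.card (A ⧸ (maximalIdeal A) ^ T) = Ideal.absNorm v.asIdeal ^ T := by
  have : v.asIdeal.IsMaximal := v.isMaximal
  rw [← Nat.card_congr (IsLocalization.AtPrime.equivQuotMaximalIdealPow v.asIdeal A T).toEquiv,
    ← map_pow]
  rfl

lemma loc_card1 : Nat.card (ResidueField A) = Ideal.absNorm v.asIdeal := by
  have := loc_card v A 1
  rw [pow_one, pow_one] at this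
  exact this

include v in
lemma loc_fin : Finite (ResidueField A) := by
  apply Nat.finite_of_card_ne_zero
  rw [loc_card1 v A]
  exact fun h => v.ne_bot (Ideal.absNorm_eq_zero_iff.1 h)

lemma loc_Qp {π : A} (hπ : maximalIdeal A = Ideal.span {π}) :
    ∃ l f : ℕ, l.Prime ∧ Ideal.absNorm v.asIdeal = l ^ f ∧ π ∣ (l : A) := by
  have := loc_fin v A
  rw [← loc_card1 v A]
  let : Fintype (ResidueField A) := Fintype.ofFinite _
  obtain ⟨l, _, f, hl, hc⟩ := FiniteField.card' (ResidueField A)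
  refine ⟨l, f, hl, ?_, ?_⟩
  · rw [Nat.card_eq_fintype_card]; exact hc
  · rw [← Ideal.mem_span_singleton, ← hπ, ← residue_eq_zero_iff, map_natCast]
    have h1 : ((Fintype.card (ResidueField A) : ℕ) : ResidueField A) = 0 := Nat.cast_card_eq_zero _
    rw [hc, Nat.cast_pow] at h1
    exact pow_eq_zero_iff (PNat.ne_zero f) |>.1 h1

lemma loc_Qa {π : A} (hπ : maximalIdeal A = Ideal.span {π}) (a : A) :
    π ∣ a ^ (Ideal.absNorm v.asIdeal) - a := by
  have := loc_fin v A
  rw [← loc_card1 v A]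
  let : Fintype (ResidueField A) := Fintype.ofFinite _
  rw [← Ideal.mem_span_singleton, ← hπ, ← residue_eq_zero_iff, map_sub, map_pow,
    Nat.card_eq_fintype_card, FiniteField.pow_card, sub_self]

variable {L : Type*} [Field L] [NumberField L] [Algebra K L] [Algebra A L]
  [IsScalarTower (𝓞 K) K L]
  [IsScalarTower (𝓞 K) A L]

lemma place_int {h : ℕ} {a : 𝓞 K} (ha : v.asIdeal ^ h = Ideal.span {a})
    (w : FinitePlace L) (hw : w (algebraMap K L a) < 1) {x : L} (hx : IsIntegral A x) :
    w x ≤ 1 := by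
  obtain ⟨⟨s, hs⟩, hsx⟩ := IsIntegral.exists_multiple_integral_of_isLocalization
    (Rₘ := A) v.asIdeal.primeCompl x hx
  have h_integ : ∀ y : L, IsIntegral (𝓞 K) y → w y ≤ 1 := by
    intro y hy
    have : IsIntegral ℤ y := isIntegral_trans y hy
    exact fin_int_le_one ⟨y, this⟩ w
  have hK : ∀ y : 𝓞 K, w (algebraMap (𝓞 K) L y) ≤ 1 := fun y => h_integ _ isIntegral_algebraMap
  have h1 := h_integ _ hsx
  have hmax := v.isMaximal
  have hs' : s ∉ v.asIdeal := hs
  obtain ⟨s', i, hi, hsi⟩ := hmax.exists_inv hs'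
  have hi1 : w (algebraMap (𝓞 K) L i) < 1 := by
    have h2 : i ^ h ∈ Ideal.span {a} := ha ▸ Ideal.pow_mem_pow hi h
    obtain ⟨b, hb⟩ := Ideal.mem_span_singleton.1 h2
    have h3 : w (algebraMap (𝓞 K) L i) ^ h < 1 := by
      rw [← map_pow, ← map_pow, hb, map_mul, map_mul]
      calc _ ≤ w (algebraMap (𝓞 K) L a) * 1 := by
            gcongr
            exact hK b
        _ < 1 := by
            rw [mul_one, IsScalarTower.algebraMap_apply (𝓞 K) K L]; exact hw
    by_contra hc
    push Not at hc
    exact absurd h3 (not_lt.2 (one_le_pow₀ hc))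
  have hs1 : 1 ≤ w (algebraMap (𝓞 K) L s) := by
    by_contra hc
    push Not at hc
    have h4 : w (algebraMap (𝓞 K) L (s' * s)) < 1 := by
      rw [map_mul, map_mul]
      calc _ ≤ 1 * w (algebraMap (𝓞 K) L s) := by
            gcongr
            exact hK s'
        _ < 1 := by rw [one_mul]; exact hc
    have h5 := FinitePlace.add_le w (algebraMap (𝓞 K) L (s' * s)) (algebraMap (𝓞 K) L i)
    rw [← map_add, hsi, map_one, map_one] at h5
    exact absurd h5 (not_le.2 (max_lt h4 hi1))
  have h6 : w (algebraMap (𝓞 K) L s) * w x ≤ 1 := by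
    rw [← map_mul, ← Algebra.smul_def]; exact h1
  calc w x = 1 * w x := (one_mul _).symm
    _ ≤ w (algebraMap (𝓞 K) L s) * w x := by gcongr
    _ ≤ 1 := h6

end M8a
end ArbPCF

namespace ArbPCF
section M8b
set_option linter.unusedSectionVars false
open IsLocalRing NumberField IsDedekindDomain Height

universe uK uk uA

section maps
variable {L k : Type*} [Field L] [Field k] (f : L →+* k) {p q : L[X]}

lemma phi_map (x : L) : f (phi p q x) = phi (p.map f) (q.map f) (f x) := by
  rw [phi, phi, map_div₀, eval_map_apply, eval_map_apply]

lemma phi_iter_map (n : ℕ) (x : L) :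
    f ((phi p q)^[n] x) = (phi (p.map f) (q.map f))^[n] (f x) := by
  induction n generalizing x with
  | zero => rfl
  | succ n ih => rw [Function.iterate_succ_apply, ih, phi_map, Function.iterate_succ_apply]

lemma Lev_map {a x : L} (n : ℕ) :
    f x ∈ Lev (p.map f) (q.map f) (f a) n ↔ x ∈ Lev p q a n := by
  rw [mem_Lev_iff, mem_Lev_iff]
  simp only [← phi_iter_map, eval_map_apply, ne_eq, map_eq_zero, f.injective.eq_iff]

lemma theta_map {d k0 l0 : ℕ} (n : (Fin k0 → Fin d) × (Fin l0 → Fin d) → ℤ) (xs : Fin k0 → L)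
    (ys : Fin l0 → L) : f (theta n xs ys) = theta n (fun i => f (xs i)) (fun i => f (ys i)) := by
  simp only [theta, map_sum, map_mul, map_intCast, map_prod, map_pow]

end maps

variable {K : Type uK} [Field K] [NumberField K] (v : HeightOneSpectrum (𝓞 K))
  {A : Type uA} [CommRing A] [IsDomain A] [IsLocalRing A] [IsIntegrallyClosed A]
  [Algebra (𝓞 K) A] [IsLocalization.AtPrime A v.asIdeal] [Algebra A K] [IsFractionRing A K]
  [IsScalarTower (𝓞 K) A K]
  {k : Type uk} [Field k] [Algebra K k] [Algebra A k] [IsScalarTower A K k] [IsGalois K k]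

variable {pA qA : A[X]} {γ : A} {V : ValuationSubring k} {Φ : k ≃ₐ[K] k} {π : A}

lemma theta_ineq_aux (h : Setup (K := K) pA qA γ V Φ π (Ideal.absNorm v.asIdeal)) (C : ℝ)
    (hC1 : 1 ≤ C)
    (hC : ∀ (L : Type uk) [Field L] [NumberField L] [Algebra K L] (n : ℕ) (x : L),
      x ∈ Lev ((pA.map (algebraMap A K)).map (algebraMap K L))
        ((qA.map (algebraMap A K)).map (algebraMap K L)) (algebraMap K L (algebraMap A K γ)) n →
      mulHeight₁ x ≤ C ^ Module.finrank ℚ L)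
    (L : Type uk) [Field L] [NumberField L] [Algebra K L] [Algebra A L] [IsScalarTower (𝓞 K) K L]
    [IsScalarTower (𝓞 K) A L] [IsScalarTower A K L] [Algebra L k] [IsScalarTower K L k]
    [IsScalarTower A L k]
    (m k0 l0 T : ℕ) (hk : k0 ≤ m) (hl : l0 ≤ m) (x y : L)
    (hx : algebraMap L k x ∈ Lev (pA.map (algebraMap A k))
    (qA.map (algebraMap A k)) (algebraMap A k γ) m) (hy : algebraMap L k y = Φ (algebraMap L k x))
    (n : (Fin k0 → Fin (pA.map (algebraMap A k)).natDegree) ×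
      (Fin l0 → Fin (pA.map (algebraMap A k)).natDegree) → ℤ)
    (hnb : ∀ e, |n e| ≤ Ideal.absNorm v.asIdeal)
    (hn : ∀ j < T, ∀ i, ((taylor (X ^ Ideal.absNorm v.asIdeal) (NN pA qA n)).coeff j).coeff i ∈
      Ideal.span {π ^ T})
    (h0 : theta n (fun i => (phi (pA.map (algebraMap A k)) (qA.map (algebraMap A k)))^[i]
          (algebraMap L k x))
        (fun i => (phi (pA.map (algebraMap A k)) (qA.map (algebraMap A k)))^[i]
          (Φ (algebraMap L k x))) ≠ 0) :
    (Ideal.absNorm v.asIdeal : ℝ) ^ T ≤ (((pA.map (algebraMap A k)).natDegree ^ (k0 + l0) *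
      Ideal.absNorm v.asIdeal : ℕ) *
      C ^ (((pA.map (algebraMap A k)).natDegree - 1) * (k0 + l0))) ^ Module.finrank ℚ K := by
  set Q := Ideal.absNorm v.asIdeal with hQdef
  have hQ1 : 1 ≤ Q := Nat.one_le_iff_ne_zero.2 fun h => v.ne_bot (Ideal.absNorm_eq_zero_iff.1 h)
  have hd1 : 1 ≤ (pA.map (algebraMap A k)).natDegree := (by norm_num : 1 ≤ 2).trans h.good.two_le
  have hpm : ∀ F : A[X], F.map (algebraMap A k) = (F.map (algebraMap A L)).map (algebraMap L k) := by
    intro F; rw [Polynomial.map_map, ← IsScalarTower.algebraMap_eq]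
  have hpK : ∀ F : A[X], (F.map (algebraMap A K)).map (algebraMap K L) = F.map (algebraMap A L) := by
    intro F; rw [Polynomial.map_map, ← IsScalarTower.algebraMap_eq]
  set pL := pA.map (algebraMap A L) with hpL
  set qL := qA.map (algebraMap A L) with hqL
  let θ : L := theta n (fun i => (phi pL qL)^[i] x) (fun i => (phi pL qL)^[i] y)
  have hθk : algebraMap L k θ = theta n (fun i => (phi (pA.map (algebraMap A k))
      (qA.map (algebraMap A k)))^[i] (algebraMap L k x))
        (fun i => (phi (pA.map (algebraMap A k)) (qA.map (algebraMap A k)))^[i]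
          (Φ (algebraMap L k x))) := by
    rw [theta_map]
    simp only [phi_iter_map, hpm, hy, ← hpL, ← hqL]
  have hθ0 : θ ≠ 0 := by
    intro h
    rw [← hθk, h, map_zero] at h0
    exact h0 rfl
  have hπ : algebraMap A L π ≠ 0 := by
    intro hz
    obtain ⟨π', h1, h2⟩ := loc_max v A
    rw [IsScalarTower.algebraMap_apply A K L, map_eq_zero_iff _ (algebraMap K L).injective,
      map_eq_zero_iff _ (IsFractionRing.injective A K)] at hz
    rw [h.max, hz, Ideal.span_singleton_eq_bot.2 rfl] at h2
    exact h1 (Ideal.span_singleton_eq_bot.1 h2.symm)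
  obtain ⟨c, hc, hcθ⟩ := h.theta_dvd m k0 l0 T hk hl _ hx n hn
  rw [← hθk] at hcθ
  let cL : L := θ / algebraMap A L π ^ T
  have hcL : algebraMap L k cL = c := by
    simp only [cL]
    rw [map_div₀, hcθ, map_pow, ← IsScalarTower.algebraMap_apply]
    have : algebraMap A k π ≠ 0 := by
      rw [IsScalarTower.algebraMap_apply A L k]; simpa using hπ
    field_simp
  have hcLi : IsIntegral A cL := by
    rw [← hcL] at hc
    exact (isIntegral_algebraMap_iff (algebraMap L k).injective).1 hc
  have hθe : θ = algebraMap A L π ^ T * cL := by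
    simp only [cL]; field_simp
  obtain ⟨hh, a, hh1, ha0, hva, hN⟩ := class_pow v
  have hπa : ∃ b : A, π ^ hh = algebraMap (𝓞 K) A a * b := by
    have h1 := congrArg (Ideal.map (algebraMap (𝓞 K) A)) hva
    rw [Ideal.map_pow, IsLocalization.AtPrime.map_eq_maximalIdeal v.asIdeal A, Ideal.map_span, h.max,
      Ideal.span_singleton_pow, Set.image_singleton] at h1
    have h2 : π ^ hh ∈ Ideal.span {algebraMap (𝓞 K) A a} := by
      rw [← h1]; exact Ideal.mem_span_singleton_self _
    exact Ideal.mem_span_singleton.1 h2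
  obtain ⟨b, hb⟩ := hπa
  have hlow := theta_lower θ hθ0 a ha0 hh T (by
    intro w hw
    have w1 : w cL ≤ 1 := place_int v A hva w hw hcLi
    have w2 : w (algebraMap A L b) ≤ 1 := place_int v A hva w hw isIntegral_algebraMap
    have w3 : w (algebraMap A L π) ^ hh ≤ w (algebraMap K L a) := by
      rw [← map_pow, ← map_pow, hb, map_mul, map_mul, ← IsScalarTower.algebraMap_apply (𝓞 K) A L,
        IsScalarTower.algebraMap_apply (𝓞 K) K L]
      exact mul_le_of_le_one_right (apply_nonneg w _) w2
    rw [hθe, map_mul, mul_pow, map_pow, ← pow_mul, mul_comm T hh, pow_mul]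
    calc _ ≤ w (algebraMap K L a) ^ T * 1 := by
          gcongr
          exact pow_le_one₀ (apply_nonneg w _) w1
      _ = _ := mul_one _)
  have hHpos : 0 < mulHeight₁ θ := mulHeight₁_pos _
  have hlow2 : (Q : ℝ) ^ (T * Module.finrank K L) ≤ mulHeight₁ θ := by
    rw [hN, ← pow_mul, mul_comm hh, pow_mul] at hlow
    exact (pow_le_pow_iff_left₀ (by positivity) hHpos.le (by omega)).1 hlow
  have hup := theta_height hd1 hQ1 n hnb (fun i => (phi pL qL)^[i] x) (fun i => (phi pL qL)^[i] y)
  have hLev : ∀ z : L, algebraMap L k z ∈ Lev (pA.map (algebraMap A k))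
    (qA.map (algebraMap A k)) (algebraMap A k γ) m → ∀ i ≤ m,
      mulHeight₁ ((phi pL qL)^[i] z) ≤ C ^ Module.finrank ℚ L := by
    intro z hz i hi
    obtain ⟨j, rfl⟩ : ∃ j, m = j + i := ⟨m - i, by omega⟩
    rw [hpm, hpm, IsScalarTower.algebraMap_apply A L k, Lev_map] at hz
    apply hC L j
    rw [hpK, hpK, ← IsScalarTower.algebraMap_apply]
    exact Lev_iter hz
  have hy' : algebraMap L k y ∈ Lev (pA.map (algebraMap A k))
    (qA.map (algebraMap A k)) (algebraMap A k γ) m := by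
    rw [hy]; exact lev_sig (K := K) Φ _ _ hx
  have hprod : ∀ (z : L) (r : ℕ) (hr : r ≤ m), algebraMap L k z ∈ Lev (pA.map (algebraMap A k))
    (qA.map (algebraMap A k)) (algebraMap A k γ) m →
      ∏ i : Fin r, mulHeight₁ ((phi pL qL)^[i] z) ^ ((pA.map (algebraMap A k)).natDegree-1) ≤
        (C ^ Module.finrank ℚ L) ^ (((pA.map (algebraMap A k)).natDegree-1) * r) := by
    intro z r hr hz
    calc _ ≤ ∏ i : Fin r, (C ^ Module.finrank ℚ L) ^ ((pA.map (algebraMap A k)).natDegree-1) := by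
          apply Finset.prod_le_prod
          · intro i _; exact pow_nonneg (mulHeight₁_pos _).le _
          · intro i _
            exact pow_le_pow_left₀ (mulHeight₁_pos _).le (hLev z hz i (by omega)) _
      _ = _ := by rw [Finset.prod_const, Finset.card_univ, Fintype.card_fin, ← pow_mul]
  have hp1 := hprod x k0 hk hx
  have hp2 := hprod y l0 hl hy'
  have hfin : Module.finrank ℚ L = Module.finrank ℚ K * Module.finrank K L :=
    (Module.finrank_mul_finrank ℚ K L).symm
  have hall : mulHeight₁ θ ≤ (((((pA.map (algebraMap A k)).natDegree ^ (k0 + l0) * Q : ℕ) : ℝ) * C ^ (((pA.map (algebraMap A k)).natDegree-1) * (k0 + l0))) ^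
      Module.finrank ℚ K) ^ Module.finrank K L := by
    have hC' : (C ^ (((pA.map (algebraMap A k)).natDegree-1) * (k0 + l0))) ^ Module.finrank ℚ L =
        (C ^ Module.finrank ℚ L) ^ (((pA.map (algebraMap A k)).natDegree-1) * k0) *
        (C ^ Module.finrank ℚ L) ^ (((pA.map (algebraMap A k)).natDegree-1) * l0) := by
      rw [← pow_add, ← mul_add, ← pow_mul, ← pow_mul, mul_comm]
    rw [← pow_mul, ← hfin, mul_pow, hC']
    refine hup.trans ?_
    gcongr
  have hfp : Module.finrank K L ≠ 0 := Module.finrank_pos.ne'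
  rw [pow_mul] at hlow2
  exact (pow_le_pow_iff_left₀ (by positivity) (by positivity) hfp).1 (hlow2.trans hall)

lemma theta_ineq (h : Setup (K := K) pA qA γ V Φ π (Ideal.absNorm v.asIdeal)) (C : ℝ)
    (hC1 : 1 ≤ C)
    (hC : ∀ (L : Type uk) [Field L] [NumberField L] [Algebra K L] (n : ℕ) (x : L),
      x ∈ Lev ((pA.map (algebraMap A K)).map (algebraMap K L))
        ((qA.map (algebraMap A K)).map (algebraMap K L)) (algebraMap K L (algebraMap A K γ)) n →
      mulHeight₁ x ≤ C ^ Module.finrank ℚ L)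
    (m k0 l0 T : ℕ) (hk : k0 ≤ m) (hl : l0 ≤ m) (x : k)
    (hx : x ∈ Lev (pA.map (algebraMap A k))
    (qA.map (algebraMap A k)) (algebraMap A k γ) m)
    (n : (Fin k0 → Fin (pA.map (algebraMap A k)).natDegree) ×
      (Fin l0 → Fin (pA.map (algebraMap A k)).natDegree) → ℤ)
    (hnb : ∀ e, |n e| ≤ Ideal.absNorm v.asIdeal)
    (hn : ∀ j < T, ∀ i, ((taylor (X ^ Ideal.absNorm v.asIdeal) (NN pA qA n)).coeff j).coeff i ∈
      Ideal.span {π ^ T})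
    (h0 : theta n (fun i => (phi (pA.map (algebraMap A k)) (qA.map (algebraMap A k)))^[i] x)
        (fun i => (phi (pA.map (algebraMap A k)) (qA.map (algebraMap A k)))^[i] (Φ x)) ≠ 0) :
    (Ideal.absNorm v.asIdeal : ℝ) ^ T ≤ (((pA.map (algebraMap A k)).natDegree ^ (k0 + l0) *
      Ideal.absNorm v.asIdeal : ℕ) *
      C ^ (((pA.map (algebraMap A k)).natDegree - 1) * (k0 + l0))) ^ Module.finrank ℚ K := by
  let L : IntermediateField K k := IntermediateField.adjoin K {x, Φ x}
  have hfd : FiniteDimensional K L := by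
    apply IntermediateField.finiteDimensional_adjoin
    intro y _
    exact (IsGalois.integral K y)
  have hnf : NumberField L := NumberField.of_module_finite K L
  let : Algebra (𝓞 K) L := inferInstance
  have : IsScalarTower (𝓞 K) A L := by
    apply IsScalarTower.of_algebraMap_eq
    intro a
    apply Subtype.ext
    change algebraMap K k (algebraMap (𝓞 K) K a) = algebraMap A k (algebraMap (𝓞 K) A a)
    rw [IsScalarTower.algebraMap_apply (𝓞 K) A K, ← IsScalarTower.algebraMap_apply A K k]
  have : IsScalarTower A K L := by
    apply IsScalarTower.of_algebraMap_eq
    intro a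
    apply Subtype.ext
    exact IsScalarTower.algebraMap_apply A K k a
  have : IsScalarTower A L k := by
    apply IsScalarTower.of_algebraMap_eq
    intro a
    rfl
  have hxL : x ∈ L := IntermediateField.subset_adjoin K _ (by simp)
  have hyL : Φ x ∈ L := IntermediateField.subset_adjoin K _ (by simp)
  exact theta_ineq_aux v h C hC1 hC L m k0 l0 T hk hl ⟨x, hxL⟩ ⟨Φ x, hyL⟩ hx rfl n hnb hn h0

end M8b
end ArbPCF

namespace ArbPCF
section M8c
set_option linter.unusedSectionVars false
open IsLocalRing NumberField IsDedekindDomain Height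

universe uK uk uA

lemma core_num1 (Q d nK s k0 l T : ℕ) (C : ℝ) (hd : 2 ≤ d) (hQ : 1 ≤ Q) (hC1 : 1 ≤ C)
    (hs : C ≤ (d : ℝ) ^ s)
    (hk0 : d ^ k0 ≤ Q * d ^ (l+1)) (hT : T = nK * (2 + s * (d-1)) + 1)
    (h : (Q : ℝ) ^ T ≤ (((d ^ (k0 + l) * Q : ℕ) : ℝ) * C ^ ((d-1) * (k0 + l))) ^ nK) :
    Q ≤ (d ^ ((2 * l + 1) * (1 + s * (d-1)))) ^ nK := by
  have h1 : (((d ^ (k0 + l) * Q : ℕ) : ℝ) * C ^ ((d-1) * (k0 + l))) ^ nK ≤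
      ((d ^ (k0 + l) * Q * ((d ^ s) ^ ((d-1) * (k0 + l))) : ℕ) : ℝ) ^ nK := by
    push_cast
    gcongr
  have h2 := h.trans h1
  have h3 : Q ^ T ≤ (d ^ (k0 + l) * Q * ((d ^ s) ^ ((d-1) * (k0 + l)))) ^ nK := by
    exact_mod_cast h2
  have h4 : d ^ (k0 + l) * Q * ((d ^ s) ^ ((d-1) * (k0 + l))) =
      Q * (d ^ (k0 + l)) ^ (1 + s * (d-1)) := by
    rw [← pow_mul, ← pow_mul]
    have : (k0 + l) * (1 + s * (d-1)) = (k0 + l) + s * ((d-1) * (k0+l)) := by ring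
    rw [this, pow_add]; ring
  have h5 : d ^ (k0 + l) ≤ Q * d ^ (2 * l + 1) := by
    calc d ^ (k0 + l) = d ^ k0 * d ^ l := pow_add _ _ _
      _ ≤ Q * d ^ (l+1) * d ^ l := by gcongr
      _ = _ := by rw [mul_assoc, ← pow_add]; congr 2; ring
  have h6 : Q ^ T ≤ Q ^ (nK * (2 + s * (d-1))) * (d ^ ((2 * l + 1) * (1 + s * (d-1)))) ^ nK := by
    refine h3.trans ?_
    rw [h4]
    calc (Q * (d ^ (k0 + l)) ^ (1 + s * (d-1))) ^ nK
        ≤ (Q * (Q * d ^ (2 * l + 1)) ^ (1 + s * (d-1))) ^ nK := by gcongr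
      _ = _ := by
        rw [mul_pow Q (d ^ (2*l+1)), ← mul_assoc, ← pow_succ', mul_pow, ← pow_mul, ← pow_mul d]
        congr 2
        ring
  rw [hT, pow_succ] at h6
  exact Nat.le_of_mul_le_mul_left h6 (by positivity)

lemma core_num2 (Q d k0 l J : ℕ) (hd : 2 ≤ d) (hk0 : d ^ k0 ≤ Q * d ^ (l+1))
    (h : (8 * d ^ (2 * J + 2 * l + 1)) * Q ≤ d ^ (2 * J) *
      (4 * (d ^ k0 - 1) * (d ^ l - 1) + (8 * d ^ (2 * J + 2 * l + 1)) * ((2 * d - 2) * J))) :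
    Q ≤ 2 * d ^ (2 * J) * ((2 * d - 2) * J) := by
  have h1 : d ^ (2 * J) * (4 * (d ^ k0 - 1) * (d ^ l - 1)) ≤ (4 * d ^ (2 * J + 2 * l + 1)) * Q := by
    calc _ ≤ d ^ (2 * J) * (4 * (Q * d ^ (l+1)) * d ^ l) := by
          gcongr
          · omega
          · omega
      _ = _ := by ring
  rw [mul_add] at h
  have h2 : (4 * d ^ (2 * J + 2 * l + 1)) * Q ≤
      (4 * d ^ (2 * J + 2 * l + 1)) * (2 * d ^ (2 * J) * ((2 * d - 2) * J)) := by
    have e : d ^ (2 * J) * ((8 * d ^ (2 * J + 2 * l + 1)) * ((2 * d - 2) * J)) =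
      (4 * d ^ (2 * J + 2 * l + 1)) * (2 * d ^ (2 * J) * ((2 * d - 2) * J)) := by ring
    rw [e] at h
    linarith
  exact Nat.le_of_mul_le_mul_left h2 (by positivity)

/-- the value of `q` at `x` is a unit of `V` -/
def US {k : Type*} [Field k] (V : ValuationSubring k) (q : k[X]) (x : k) : Prop :=
  x ∈ V ∧ q.eval x ≠ 0 ∧ (q.eval x)⁻¹ ∈ V

lemma US.unitAt {k : Type*} [Field k] {V : ValuationSubring k} {q : k[X]} {x : k} (h : US V q x)
    {qV : V[X]} (hq : qV.map (algebraMap V k) = q) : UnitAt V qV x := by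
  refine ⟨⟨x, h.1⟩, rfl, ?_⟩
  refine IsUnit.of_mul_eq_one ⟨_, h.2.2⟩ (Subtype.ext ?_)
  rw [MulMemClass.coe_mul, coe_eval, hq]
  exact mul_inv_cancel₀ h.2.1

variable {K : Type uK} [Field K] [NumberField K] (v : HeightOneSpectrum (𝓞 K))
  {A : Type uA} [CommRing A] [IsDomain A] [IsLocalRing A] [IsIntegrallyClosed A]
  [Algebra (𝓞 K) A] [IsLocalization.AtPrime A v.asIdeal] [Algebra A K] [IsFractionRing A K]
  [IsScalarTower (𝓞 K) A K]
  {k : Type uk} [Field k] [Algebra K k] [Algebra A k] [IsScalarTower A K k] [IsGalois K k]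
  [IsAlgClosed k] [CharZero k]

variable {pA qA : A[X]} {γ : A} {V : ValuationSubring k} {Φ : k ≃ₐ[K] k} {π : A}

lemma core_local (h : Setup (K := K) pA qA γ V Φ π (Ideal.absNorm v.asIdeal)) (C : ℝ)
    (hC1 : 1 ≤ C)
    (hC : ∀ (L : Type uk) [Field L] [NumberField L] [Algebra K L] (n : ℕ) (x : L),
      x ∈ Lev ((pA.map (algebraMap A K)).map (algebraMap K L))
        ((qA.map (algebraMap A K)).map (algebraMap K L)) (algebraMap K L (algebraMap A K γ)) n →
      mulHeight₁ x ≤ C ^ Module.finrank ℚ L)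
    (p q : k[X]) (hpA : pA.map (algebraMap A k) = p) (hqA : qA.map (algebraMap A k) = q)
    (s T l j0 N' : ℕ) (hs : C ≤ (p.natDegree : ℝ) ^ s)
    (hT : T = Module.finrank ℚ K * (2 + s * (p.natDegree - 1)) + 1)
    (hl : 2 * T ^ 2 ≤ p.natDegree ^ l)
    (hN' : N' = 8 * p.natDegree ^ (2 * (j0+1) + 2 * l + 1))
    (hQ1 : (p.natDegree ^ ((2 * l + 1) * (1 + s * (p.natDegree - 1)))) ^ (Module.finrank ℚ K) <
      Ideal.absNorm v.asIdeal)
    (hQ2 : 2 * p.natDegree ^ (2 * (j0+1)) * ((2 * p.natDegree - 2) * (j0+1)) <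
      Ideal.absNorm v.asIdeal)
    (Z : Finset k) (hZc : p.natDegree ^ l ≤ Z.card) (hZV : ∀ z ∈ Z, z ∈ V)
    (hZ : ∀ z ∈ Z, z ^ (Ideal.absNorm v.asIdeal) - z ∈ V.nonunits)
    (hZd : ∀ z ∈ Z, ∀ z' ∈ Z, (z - z')⁻¹ ∈ V)
    (c : k) (hZj : ∀ z ∈ Z, (phi p q)^[j0] z = c)
    (hZq : ∀ z ∈ Z, ∀ i < j0, US V q ((phi p q)^[i] z))
    (hcW : (Wr p q).eval c = 0) (hcq : ∀ i ≤ N', US V q ((phi p q)^[i] c))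
    (hcu : ∀ i, 1 ≤ i → i ≤ N' → US V (Wr p q) ((phi p q)^[i] c))
    (hci : ∀ m n, (phi p q)^[m] c = (phi p q)^[n] c → m = n) : False := by
  have hgood : Good p q := by rw [← hpA, ← hqA]; exact h.good
  have hd2 := hgood.two_le
  obtain ⟨k0, hk1, hk2⟩ : ∃ k0, Ideal.absNorm v.asIdeal * p.natDegree ^ l ≤ p.natDegree ^ k0 ∧
      p.natDegree ^ k0 ≤ Ideal.absNorm v.asIdeal * p.natDegree ^ (l + 1) := by
    have hex : ∃ k0, Ideal.absNorm v.asIdeal * p.natDegree ^ l ≤ p.natDegree ^ k0 :=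
      ⟨_, (Nat.lt_pow_self (by omega)).le⟩
    refine ⟨Nat.find hex, Nat.find_spec hex, ?_⟩
    rcases hn : Nat.find hex with _ | r
    · rw [pow_zero]
      apply Nat.one_le_iff_ne_zero.2
      have : 0 < p.natDegree := by omega
      have : 0 < Ideal.absNorm v.asIdeal := by omega
      positivity
    · have := Nat.find_min hex (m := r) (by omega)
      rw [pow_succ, pow_succ, ← mul_assoc]
      exact Nat.mul_le_mul_right _ (by omega)
  have hfin : Finite (A ⧸ Ideal.span {π ^ T}) := by
    apply Nat.finite_of_card_ne_zero
    rw [← Ideal.span_singleton_pow, ← h.max, loc_card v A]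
    have : 0 < Ideal.absNorm v.asIdeal := by omega
    positivity
  obtain ⟨n, hn0, hnb, hn⟩ := siegel pA qA (Ideal.span {π ^ T}) (Ideal.absNorm v.asIdeal) T
    (pA.map (algebraMap A k)).natDegree k0 l (by rw [hpA]; omega) (by omega)
    (by rw [← Ideal.span_singleton_pow, ← h.max, loc_card v A]) (by rw [hpA]; exact hl)
    (by rw [hpA]; exact hk1)
  have hvan : Van (Lev (pA.map (algebraMap A k)) (qA.map (algebraMap A k)) (algebraMap A k γ)) Φ
      (NN (pA.map (algebraMap A k)) (qA.map (algebraMap A k)) n) := by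
    refine ⟨max k0 l, fun m hm x hx => ?_⟩
    obtain ⟨u, _, _, hu⟩ := h.NN_theta m k0 l (by omega) (by omega) x hx n
    rw [hu]
    by_contra hne
    have hth := theta_ineq v h C hC1 hC m k0 l T (by omega) (by omega) x hx n hnb hn
      (right_ne_zero_of_mul hne)
    rw [hpA] at hth
    exact absurd (core_num1 _ _ _ s k0 l T C hd2 (by omega) hC1 hs hk2 hT hth) (by omega)
  have hNne := h.good.NN_ne n hn0
  let f : A →+* V := (algebraMap A k).codRestrict V.toSubring h.dom.mem
  have hmf : ∀ F : A[X], (F.map f).map (algebraMap V k) = F.map (algebraMap A k) := by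
    intro F; rw [Polynomial.map_map]; rfl
  have hWV : (WrR (pA.map f) (qA.map f)).map (algebraMap V k) = Wr p q := by
    rw [← hpA, ← hqA]
    exact WrV (hmf _) (hmf _)
  have hmain := main_ineq h.good (hmf pA) (hmf qA) h.tree (Ideal.absNorm v.asIdeal) h.resQ h.hT
    (h.hTd (hmf pA) (hmf qA)) hNne hvan (p.natDegree ^ k0 - 1) (p.natDegree ^ l - 1)
    (by rw [← hpA]; exact fun i => NN_coeff_deg _ _ (by rw [hpA]; omega) _ i) (by rw [← hpA]; exact NN_deg _ _ (by rw [hpA]; omega) _) Z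
    (by have : 0 < p.natDegree ^ l := by positivity
        omega)
    (by
      intro z hz
      refine ⟨⟨z, hZV z hz⟩, rfl, ?_⟩
      rw [← map_pow, ← sub_eq_zero, ← map_sub, residue_eq_zero_iff]
      obtain ⟨_, h4⟩ := ValuationSubring.mem_nonunits_iff_exists_mem_maximalIdeal.1 (hZ z hz)
      exact h4)
    (by
      intro z hz z' hz' hcong
      by_contra hne
      rw [h.cong_iff (hZV z hz) (hZV z' hz')] at hcong
      obtain ⟨h2, h3⟩ := ValuationSubring.mem_nonunits_iff_exists_mem_maximalIdeal.1 hcong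
      refine h3 (IsUnit.of_mul_eq_one ⟨_, hZd z hz z' hz'⟩ (Subtype.ext ?_))
      exact mul_inv_cancel₀ (sub_ne_zero.2 hne))
    j0 N' c (by rw [hpA, hqA]; exact hZj)
    (by rw [hpA, hqA]; exact fun z hz i hi => (hZq z hz i hi).unitAt ((hmf _).trans hqA))
    (by rw [hpA, hqA]; exact hcW)
    (by rw [hpA, hqA]; exact fun i hi => (hcq i hi).unitAt ((hmf _).trans hqA))
    (by rw [hpA, hqA]; exact fun i h1 hi => (hcu i h1 hi).unitAt hWV)
    (by rw [hpA, hqA]; exact hci)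
  rw [hpA, hN'] at hmain
  exact absurd (core_num2 _ _ k0 l (j0+1) hd2 hk2 hmain) (by omega)

end M8c
end ArbPCF

namespace ArbPCF
section M8d
set_option linter.unusedSectionVars false
open IsLocalRing NumberField IsDedekindDomain Height Filter

universe uK uk

variable {K : Type uK} [Field K] [NumberField K]

/-- the local ring of `K` at `v` -/
noncomputable abbrev Av (v : HeightOneSpectrum (𝓞 K)) : ValuationSubring K :=
  v.valuationSubringAtPrime K

lemma ae_mem (x : K) : ∀ᶠ v : HeightOneSpectrum (𝓞 K) in cofinite, x ∈ Av v := by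
  have h := HeightOneSpectrum.Support.finite (𝓞 K) x
  filter_upwards [h.compl_mem_cofinite] with v hv
  rw [Av, HeightOneSpectrum.valuationSubringAtPrime_eq_valuationSubring,
    Valuation.mem_valuationSubring_iff]
  simpa [HeightOneSpectrum.Support] using hv

lemma ae_lift (p : K[X]) : ∀ᶠ v : HeightOneSpectrum (𝓞 K) in cofinite,
    ∃ pA : (Av v)[X], pA.map (algebraMap (Av v) K) = p := by
  have h : ∀ᶠ v : HeightOneSpectrum (𝓞 K) in cofinite, ∀ i ∈ p.support, p.coeff i ∈ Av v :=
    (eventually_all_finset _).2 fun i _ => ae_mem _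
  filter_upwards [h] with v hv
  have : p ∈ Polynomial.lifts (algebraMap (Av v) K) := by
    rw [Polynomial.lifts_iff_coeff_lifts]
    intro i
    by_cases hi : i ∈ p.support
    · exact ⟨⟨_, hv i hi⟩, rfl⟩
    · rw [notMem_support_iff.1 hi]
      exact ⟨0, map_zero _⟩
  exact (Polynomial.mem_lifts _).1 this

lemma ae_big (M : ℕ) : ∀ᶠ v : HeightOneSpectrum (𝓞 K) in cofinite,
    M < Ideal.absNorm v.asIdeal := by
  have h := Ideal.finite_setOfPred_absNorm_le (S := 𝓞 K) M
  have h2 : {v : HeightOneSpectrum (𝓞 K) | Ideal.absNorm v.asIdeal ≤ M}.Finite := by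
    apply Set.Finite.preimage (f := HeightOneSpectrum.asIdeal) _ h
    intro a _ b _ hab
    exact HeightOneSpectrum.ext hab
  filter_upwards [h2.compl_mem_cofinite] with v hv
  simpa using hv

variable {k : Type uk} [Field k] [Algebra K k] [Algebra.IsAlgebraic K k]

lemma ae_int (x : k) : ∀ᶠ v : HeightOneSpectrum (𝓞 K) in cofinite, IsIntegral (Av v) x := by
  filter_upwards [ae_lift (minpoly K x)] with v ⟨g, hg⟩
  have hx : IsIntegral K x := Algebra.IsIntegral.isIntegral x
  refine ⟨g, ?_, ?_⟩
  · apply Polynomial.monic_of_injective (IsFractionRing.injective (Av v) K)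
    rw [hg]; exact minpoly.monic hx
  · rw [IsScalarTower.algebraMap_eq (Av v) K k, ← eval₂_map, hg]
    exact minpoly.aeval K x

lemma Good.map_alg {k : Type*} [Field k] {p q : K[X]} (h : Good p q) (f : K →+* k) :
    Good (p.map f) (q.map f) where
  monic := h.monic.map _
  two_le := by rw [natDegree_map]; exact h.two_le
  lt := by rw [natDegree_map, natDegree_map]; exact h.lt
  cop := h.cop.map (mapRingHom f)

theorem core [IsAlgClosed k] {p q : K[X]} (hg : Good p q) (γ : K)
    (hcomm : ∀ σ τ : k ≃ₐ[K] k, ∀ m, ∀ t ∈ Lev (p.map (algebraMap K k)) (q.map (algebraMap K k))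
      (algebraMap K k γ) m, σ (τ t) = τ (σ t)) (P R : k[X]) (hP : P = p.map (algebraMap K k))
    (hR : R = q.map (algebraMap K k)) (c : k) (hcW : (Wr P R).eval c = 0)
    (hcq : ∀ n, R.eval ((phi P R)^[n] c) ≠ 0)
    (hcu : ∀ n, 1 ≤ n → (Wr P R).eval ((phi P R)^[n] c) ≠ 0)
    (hci : ∀ m n, (phi P R)^[m] c = (phi P R)^[n] c → m = n)
    (hunb : ∀ M, ∃ j, M ≤ (Lev P R c j).ncard) :
    ∃ Z : Finset k, ∀ᶠ v : HeightOneSpectrum (𝓞 K) in cofinite, ∀ V : ValuationSubring k,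
      Dom (Av v) V → (∀ z ∈ Z, z ^ (Ideal.absNorm v.asIdeal) - z ∈ V.nonunits) →
      (∀ m, 1 ≤ m → ∀ t ∈ Lev P R (algebraMap K k γ) m, t - algebraMap K k γ ∉ V.nonunits ∧
        (Wr P R).eval t ∉ V.nonunits) → False := by
  have : CharZero k := charZero_of_injective_algebraMap (algebraMap K k).injective
  have : Normal K k := normal_iff.2 fun x =>
    ⟨Algebra.IsIntegral.isIntegral x, IsAlgClosed.splits _⟩
  have : IsGalois K k := ⟨⟩
  have hgk : Good P R := by rw [hP, hR]; exact hg.map_alg _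
  obtain ⟨C, hC1, hC⟩ := Good.height_Lev.{uK, uk} hg γ
  have hd2 := hgk.two_le
  obtain ⟨s, hs⟩ : ∃ s : ℕ, C < (P.natDegree : ℝ) ^ s :=
    pow_unbounded_of_one_lt C (by exact_mod_cast (by omega : 1 < P.natDegree))
  obtain ⟨T, hT⟩ : ∃ T, T = Module.finrank ℚ K * (2 + s * (P.natDegree - 1)) + 1 := ⟨_, rfl⟩
  obtain ⟨l, hl⟩ : ∃ l, 2 * T ^ 2 ≤ P.natDegree ^ l := ⟨_, (Nat.lt_pow_self (by omega)).le⟩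
  obtain ⟨j0, hj0⟩ := hunb (P.natDegree ^ l)
  obtain ⟨N', hN'⟩ : ∃ N', N' = 8 * P.natDegree ^ (2 * (j0+1) + 2 * l + 1) := ⟨_, rfl⟩
  let Z : Finset k := (hgk.Lev_finite (a := c) j0).toFinset
  have hZm : ∀ z ∈ Z, z ∈ Lev P R c j0 := fun z hz => by simpa [Z] using hz
  have hZc : P.natDegree ^ l ≤ Z.card := by
    rw [Set.ncard_eq_toFinset_card _ (hgk.Lev_finite (a := c) j0)] at hj0
    exact hj0
  refine ⟨Z, ?_⟩
  obtain ⟨a, b, hab⟩ := hg.cop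
  have eZ : ∀ᶠ v : HeightOneSpectrum (𝓞 K) in cofinite, ∀ z ∈ Z, IsIntegral (Av v) z :=
    (eventually_all_finset _).2 fun z _ => ae_int _
  have eZ2 : ∀ᶠ v : HeightOneSpectrum (𝓞 K) in cofinite, ∀ z ∈ Z, ∀ z' ∈ Z,
      IsIntegral (Av v) (z - z')⁻¹ :=
    (eventually_all_finset _).2 fun z _ => (eventually_all_finset _).2 fun z' _ => ae_int _
  have eZ3 : ∀ᶠ v : HeightOneSpectrum (𝓞 K) in cofinite, ∀ z ∈ Z, ∀ i ∈ Finset.range j0,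
      IsIntegral (Av v) ((phi P R)^[i] z) ∧ IsIntegral (Av v) (R.eval ((phi P R)^[i] z))⁻¹ :=
    (eventually_all_finset _).2 fun z _ => (eventually_all_finset _).2 fun i _ =>
      (ae_int _).and (ae_int _)
  have ec : ∀ᶠ v : HeightOneSpectrum (𝓞 K) in cofinite, ∀ i ∈ Finset.range (N' + 1),
      IsIntegral (Av v) ((phi P R)^[i] c) ∧ IsIntegral (Av v) (R.eval ((phi P R)^[i] c))⁻¹ ∧
        IsIntegral (Av v) ((Wr P R).eval ((phi P R)^[i] c))⁻¹ :=
    (eventually_all_finset _).2 fun i _ => (ae_int _).and ((ae_int _).and (ae_int _))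
  filter_upwards [eZ, eZ2, eZ3, ec, ae_lift p, ae_lift q, ae_lift a, ae_lift b, ae_mem γ,
    ae_big ((P.natDegree ^ ((2 * l + 1) * (1 + s * (P.natDegree - 1)))) ^ (Module.finrank ℚ K)),
    ae_big (2 * P.natDegree ^ (2 * (j0+1)) * ((2 * P.natDegree - 2) * (j0+1)))] with v hz1 hz2 hz3
    hc ⟨pA, hpA⟩ ⟨qA, hqA⟩ ⟨aA, haA⟩ ⟨bA, hbA⟩ hγ hb1 hb2
  intro V hV hZQ hgood
  have hinj : Function.Injective (algebraMap (Av v) K) := IsFractionRing.injective (Av v) K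
  have hpk : pA.map (algebraMap (Av v) k) = P := by
    rw [hP, IsScalarTower.algebraMap_eq (Av v) K k, ← Polynomial.map_map, hpA]
  have hqk : qA.map (algebraMap (Av v) k) = R := by
    rw [hR, IsScalarTower.algebraMap_eq (Av v) K k, ← Polynomial.map_map, hqA]
  obtain ⟨π, _, hπ⟩ := loc_max v (Av v)
  have := loc_fin v (Av v)
  obtain ⟨Φ, hΦ⟩ := hV.frob (K := K)
  rw [loc_card1 v (Av v)] at hΦ
  have hγk : algebraMap (Av v) k ⟨γ, hγ⟩ = algebraMap K k γ := rfl
  have hset : Setup (K := K) pA qA ⟨γ, hγ⟩ V Φ π (Ideal.absNorm v.asIdeal) :=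
    { dom := hV
      monic := Polynomial.monic_of_injective hinj (by rw [hpA]; exact hg.monic)
      cop := ⟨aA, bA, Polynomial.map_injective _ hinj (by
        rw [Polynomial.map_add, Polynomial.map_mul, Polynomial.map_mul, hpA, hqA, haA, hbA, hab,
          Polynomial.map_one])⟩
      good := by rw [hpk, hqk]; exact hgk
      frob := hΦ
      max := hπ
      Qp := loc_Qp v (Av v) hπ
      Qa := loc_Qa v (Av v) hπ
      g1 := by rw [hpk, hqk, hγk]; exact fun m hm t ht => (hgood m hm t ht).1
      g2 := by rw [hpk, hqk, hγk]; exact fun m hm t ht => (hgood m hm t ht).2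
      comm := by rw [hpk, hqk, hγk, hP, hR]; exact hcomm }
  refine core_local v hset C hC1 ?_ P R hpk hqk s T l j0 N' hs.le hT hl hN' hb1 hb2 Z hZc
    (fun z hz => hV.int (hz1 z hz)) hZQ (fun z hz z' hz' => hV.int (hz2 z hz z' hz')) c
    (fun z hz => ((mem_Lev_iff _ _).1 (hZm z hz)).2) ?_ hcW ?_ ?_ hci
  · rw [hpA, hqA]; exact hC
  · intro z hz i hi
    obtain ⟨h1, h2⟩ := hz3 z hz i (Finset.mem_range.2 hi)
    exact ⟨hV.int h1, ((mem_Lev_iff _ _).1 (hZm z hz)).1 i hi, hV.int h2⟩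
  · intro i hi
    obtain ⟨h1, h2, _⟩ := hc i (Finset.mem_range.2 (by omega))
    exact ⟨hV.int h1, hcq i, hV.int h2⟩
  · intro i h1 hi
    obtain ⟨h3, _, h2⟩ := hc i (Finset.mem_range.2 (by omega))
    exact ⟨hV.int h3, hcu i h1, hV.int h2⟩

end M8d
end ArbPCF

namespace ArbPCF
section M8e
set_option linter.unusedSectionVars false
open IsLocalRing NumberField IsDedekindDomain Filter

universe uK uk

variable {K : Type uK} [Field K] [NumberField K]

lemma exists_nonunit (g : (𝓞 K)[X]) (hg : 0 < g.natDegree) (a β : 𝓞 K) (ha : a ≠ 0) (hβ : β ≠ 0)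
    (u : ℕ → 𝓞 K) (hu : ∀ t : ℕ, g.eval (a * β * t) = a * u t) :
    ∃ t, u t ≠ 0 ∧ ¬ IsUnit (u t) := by
  have key : ∀ σ : K →ₐ[ℚ] ℂ, ∀ᶠ t : ℕ in atTop, 2 ≤ ‖σ (u t : K)‖ := by
    intro σ
    let f : 𝓞 K →+* ℂ := (σ : K →+* ℂ).comp (algebraMap (𝓞 K) K)
    have hf : Function.Injective f := σ.toRingHom.injective.comp RingOfIntegers.coe_injective
    have h1 : Tendsto (fun t : ℕ => ‖f (a * β * t)‖) atTop atTop := by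
      have : ∀ t : ℕ, ‖f (a * β * t)‖ = ‖f (a * β)‖ * (t : ℝ) := by
        intro t
        rw [map_mul, map_natCast, norm_mul, Complex.norm_natCast]
      simp only [this]
      apply Tendsto.const_mul_atTop _ tendsto_natCast_atTop_atTop
      rw [norm_pos_iff, map_ne_zero_iff f hf]
      exact mul_ne_zero ha hβ
    have h2 := tendsto_norm_atTop (g.map f) (by
      rw [← natDegree_pos_iff_degree_pos, natDegree_map_eq_of_injective hf]; exact hg) h1
    have ha' : 0 < ‖f a‖ := by rw [norm_pos_iff, map_ne_zero_iff f hf]; exact ha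
    filter_upwards [h2.eventually_ge_atTop (‖f a‖ * 2)] with t ht
    rw [eval_map_apply, hu, map_mul, norm_mul] at ht
    exact le_of_mul_le_mul_left ht ha'
  obtain ⟨t, ht⟩ := (eventually_all.2 key).exists
  have hn : (2 : ℝ) ≤ ‖(algebraMap ℚ ℂ) (Algebra.norm ℚ (u t : K))‖ := by
    rw [Algebra.norm_eq_prod_embeddings, norm_prod]
    calc (2 : ℝ) ≤ 2 ^ (Finset.univ : Finset (K →ₐ[ℚ] ℂ)).card := by
          apply le_self_pow₀ (by norm_num)
          rw [Finset.card_univ]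
          rw [AlgHom.card]
          exact Module.finrank_pos.ne'
      _ = ∏ σ : K →ₐ[ℚ] ℂ, (2 : ℝ) := by rw [Finset.prod_const]
      _ ≤ _ := Finset.prod_le_prod (fun _ _ => by norm_num) fun σ _ => ht σ
  refine ⟨t, ?_, ?_⟩
  · intro h0
    rw [h0] at hn
    simp at hn
    norm_num at hn
  · intro hunit
    rw [NumberField.isUnit_iff_norm, RingOfIntegers.coe_norm] at hunit
    rw [eq_ratCast, Complex.norm_ratCast, ← Rat.cast_abs, hunit] at hn
    norm_num at hn

lemma euclid (g : (𝓞 K)[X]) (hg : 0 < g.natDegree) :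
    ∃ᶠ v : HeightOneSpectrum (𝓞 K) in cofinite, ∃ r : 𝓞 K, g.eval r ∈ v.asIdeal := by
  have key : ∀ g : (𝓞 K)[X], 0 < g.natDegree → g.coeff 0 ≠ 0 →
      ∃ᶠ v : HeightOneSpectrum (𝓞 K) in cofinite, ∃ r : 𝓞 K, g.eval r ∈ v.asIdeal := by
    intro g hg h0 hcon
    have hfin : {v : HeightOneSpectrum (𝓞 K) | ∃ r : 𝓞 K, g.eval r ∈ v.asIdeal}.Finite := by
      rw [eventually_cofinite] at hcon
      simpa using hcon
    let I : Ideal (𝓞 K) := ∏ v ∈ hfin.toFinset, v.asIdeal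
    have hI : I ≠ ⊥ := by
      rw [← Ideal.zero_eq_bot]
      exact Finset.prod_ne_zero_iff.2 fun v _ => v.ne_bot
    obtain ⟨β, hβI, hβ⟩ := Submodule.exists_mem_ne_zero_of_ne_bot hI
    let u : ℕ → 𝓞 K := fun t => 1 + β * t * (g.divX.eval (g.coeff 0 * β * t))
    have hu : ∀ t : ℕ, g.eval (g.coeff 0 * β * t) = g.coeff 0 * u t := by
      intro t
      have h1 : ∀ x, g.eval x = g.divX.eval x * x + g.coeff 0 := by
        intro x
        conv_lhs => rw [← divX_mul_X_add g]
        simp only [eval_add, eval_mul, eval_X, eval_C]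
      rw [h1]
      simp only [u]
      ring
    obtain ⟨t, ht0, htu⟩ := exists_nonunit g hg _ β h0 hβ u hu
    obtain ⟨M, hM, hle⟩ := Ideal.exists_le_maximal (Ideal.span {u t})
      (fun hh => htu (Ideal.span_singleton_eq_top.1 hh))
    have hutM : u t ∈ M := hle (Ideal.mem_span_singleton_self _)
    let v : HeightOneSpectrum (𝓞 K) := ⟨M, hM.isPrime, by
      intro hb
      rw [hb, Ideal.mem_bot] at hutM
      exact ht0 hutM⟩
    have hv : v ∈ hfin.toFinset := by
      rw [Set.Finite.mem_toFinset]
      exact ⟨_, by rw [hu t]; exact M.mul_mem_left _ hutM⟩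
    have hβM : β ∈ M := (Ideal.prod_le_inf.trans (Finset.inf_le hv)) hβI
    apply hM.ne_top
    rw [Ideal.eq_top_iff_one]
    have : (1 : 𝓞 K) = u t - β * t * (g.divX.eval (g.coeff 0 * β * t)) := by
      simp only [u]; ring
    rw [this]
    exact M.sub_mem hutM (M.mul_mem_right _ (M.mul_mem_right _ hβM))
  have hg0 : g ≠ 0 := by rintro rfl; simp at hg
  obtain ⟨n, hn⟩ : ∃ n : ℕ, g.eval (n : 𝓞 K) ≠ 0 := by
    by_contra! h
    exact hg0 (Polynomial.eq_zero_of_infinite_isRoot g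
      ((Set.infinite_range_of_injective (Nat.cast_injective (R := 𝓞 K))).mono
        (by rintro _ ⟨n, rfl⟩; exact h n)))
  have h1 := key (g.comp (X + C (n : 𝓞 K))) (by rwa [natDegree_comp, natDegree_X_add_C, mul_one])
    (by rw [coeff_zero_eq_eval_zero, eval_comp]; simpa using hn)
  refine h1.mono ?_
  rintro v ⟨r, hr⟩
  rw [eval_comp] at hr
  exact ⟨_, hr⟩

variable {k : Type uk} [Field k] [Algebra K k] [Algebra.IsAlgebraic K k]

lemma eval_cong (V : ValuationSubring k) (G : V[X]) {x y : k} (hx : x ∈ V) (hy : y ∈ V)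
    (h : x - y ∈ V.nonunits) :
    (G.map (algebraMap V k)).eval x - (G.map (algebraMap V k)).eval y ∈ V.nonunits := by
  obtain ⟨c, hc⟩ := sub_dvd_eval_sub (⟨x, hx⟩ : V) ⟨y, hy⟩ G
  have h1 := congrArg (fun z : V => (z : k)) hc
  simp only [MulMemClass.coe_mul, AddSubgroupClass.coe_sub, coe_eval] at h1
  rw [h1]
  rw [ValuationSubring.mem_nonunits_iff] at h ⊢
  rw [map_mul]
  exact mul_lt_one_of_lt_of_le h (V.valuation_le_one c)

theorem split [IsAlgClosed k] (Z : Finset k) :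
    ∃ᶠ v : HeightOneSpectrum (𝓞 K) in cofinite, ∀ V : ValuationSubring k, Dom (Av v) V →
      ∀ z ∈ Z, z ^ (Ideal.absNorm v.asIdeal) - z ∈ V.nonunits := by
  have : CharZero k := charZero_of_injective_algebraMap (algebraMap K k).injective
  have : Normal K k := normal_iff.2 fun x =>
    ⟨Algebra.IsIntegral.isIntegral x, IsAlgClosed.splits _⟩
  have hfd : FiniteDimensional K (adjoin K (Z : Set k)) := by
    have : Finite (Z : Set k) := Z.finite_toSet
    exact IntermediateField.finiteDimensional_adjoin fun x _ => Algebra.IsIntegral.isIntegral x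
  let E := IntermediateField.normalClosure K (adjoin K (Z : Set k)) k
  have hZE : ∀ z ∈ Z, z ∈ E := fun z hz =>
    IntermediateField.le_normalClosure _ (subset_adjoin K _ hz)
  have hEn : ∀ σ : k ≃ₐ[K] k, E.map (σ : k →ₐ[K] k) = E :=
    IntermediateField.normal_iff_forall_map_eq'.1 (normalClosure.normal K _ k)
  let pb := Field.powerBasisOfFiniteOfSeparable K E
  let y : k := pb.gen
  have hyi : IsIntegral K y := Algebra.IsIntegral.isIntegral y
  have hG : ∀ z ∈ Z, ∀ y' ∈ ((minpoly K y).map (algebraMap K k)).roots.toFinset,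
      ∃ G : K[X], z = aeval y' G := by
    intro z hz y' hy'
    rw [Multiset.mem_toFinset, mem_roots', IsRoot, eval_map_algebraMap] at hy'
    obtain ⟨σ, hσ⟩ := minpoly.exists_algEquiv_of_root (K := K) hyi.isAlgebraic hy'.2
    have h1 : σ z ∈ E := by
      rw [← hEn σ]
      exact ⟨z, hZE z hz, rfl⟩
    obtain ⟨G, hG⟩ := pb.exists_eq_aeval' ⟨σ z, h1⟩
    refine ⟨G, σ.injective ?_⟩
    have h2 := congrArg (algebraMap E k) hG
    rw [← aeval_algebraMap_apply] at h2
    rw [← aeval_algHom_apply, hσ]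
    exact h2
  choose! G hG using hG
  obtain ⟨b, hb, hbm⟩ := IsLocalization.integerNormalization_spec (nonZeroDivisors (𝓞 K))
    (minpoly K y)
  let g := IsLocalization.integerNormalization (nonZeroDivisors (𝓞 K)) (minpoly K y)
  have hb0 : (b : K) ≠ 0 := by
    simpa using nonZeroDivisors.ne_zero hb
  have hgm : g.map (algebraMap (𝓞 K) K) = (b : K) • minpoly K y := hbm
  have hgd : 0 < g.natDegree := by
    rw [← natDegree_map_eq_of_injective (RingOfIntegers.coe_injective (K := K)) g, hgm,
      natDegree_smul _ hb0]
    exact minpoly.natDegree_pos hyi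
  have eG : ∀ᶠ v : HeightOneSpectrum (𝓞 K) in cofinite, ∀ z ∈ Z,
      ∀ y' ∈ ((minpoly K y).map (algebraMap K k)).roots.toFinset,
      ∃ GA : (Av v)[X], GA.map (algebraMap (Av v) K) = G z y' :=
    (eventually_all_finset _).2 fun z _ => (eventually_all_finset _).2 fun y' _ => ae_lift _
  have ey : ∀ᶠ v : HeightOneSpectrum (𝓞 K) in cofinite,
      ∀ y' ∈ ((minpoly K y).map (algebraMap K k)).roots.toFinset, IsIntegral (Av v) y' :=
    (eventually_all_finset _).2 fun z _ => ae_int _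
  refine ((euclid g hgd).and_eventually (eG.and (ey.and (ae_mem (b : K)⁻¹)))).mono ?_
  rintro v ⟨⟨r, hr⟩, hGv, hyv, hbv⟩ V hV z hz
  let rA : Av v := algebraMap (𝓞 K) (Av v) r
  have hrk : algebraMap (Av v) k rA = algebraMap K k r := by
    rw [IsScalarTower.algebraMap_apply (Av v) K k, ← IsScalarTower.algebraMap_apply (𝓞 K) (Av v) K]
  have hrV : algebraMap K k r ∈ V := by rw [← hrk]; exact hV.mem _
  have h1 : V.valuation (algebraMap K k (algebraMap (𝓞 K) K (g.eval r))) < 1 := by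
    rw [← ValuationSubring.mem_nonunits_iff]
    have h2 : algebraMap (𝓞 K) (Av v) (g.eval r) ∈ maximalIdeal (Av v) := by
      rw [← IsLocalization.AtPrime.map_eq_maximalIdeal v.asIdeal (Av v)]
      exact Ideal.mem_map_of_mem _ hr
    have h3 := hV.non _ h2
    rwa [IsScalarTower.algebraMap_apply (Av v) K k, ← IsScalarTower.algebraMap_apply (𝓞 K) (Av v) K]
      at h3
  have h2 : V.valuation (aeval (algebraMap K k r) (minpoly K y)) < 1 := by
    have e : aeval (algebraMap K k r) (minpoly K y) = algebraMap K k (b : K)⁻¹ *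
        algebraMap K k (algebraMap (𝓞 K) K (g.eval r)) := by
      have h3 : algebraMap (𝓞 K) K (g.eval r) = (b : K) * (minpoly K y).eval (r : K) := by
        rw [← eval_map_apply, hgm, eval_smul, smul_eq_mul]
      rw [h3, ← map_mul, inv_mul_cancel_left₀ hb0, aeval_algebraMap_apply, coe_aeval_eq_eval]
    rw [e, map_mul]
    exact (mul_le_of_le_one_left' ((V.valuation_le_one_iff _).2 (hV.mem ⟨_, hbv⟩))).trans_lt h1
  obtain ⟨y', hy', hry⟩ : ∃ y' ∈ ((minpoly K y).map (algebraMap K k)).roots,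
      V.valuation (algebraMap K k r - y') < 1 := by
    by_contra! hcon
    apply absurd h2
    rw [not_lt, ← eval_map_algebraMap, (IsAlgClosed.splits _).eval_eq_prod_roots,
      (((minpoly.monic hyi).map (algebraMap K k)) : _ = _), one_mul, map_multiset_prod]
    apply Multiset.one_le_prod_of_one_le
    intro x hx
    simp only [Multiset.mem_map] at hx
    obtain ⟨_, ⟨y', hy', rfl⟩, rfl⟩ := hx
    exact hcon y' hy'
  have hy'' := Multiset.mem_toFinset.2 hy'
  obtain ⟨GA, hGA⟩ := hGv z hz y' hy''
  let f : Av v →+* V := (algebraMap (Av v) k).codRestrict V.toSubring hV.mem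
  have hGm : (GA.map f).map (algebraMap V k) = (G z y').map (algebraMap K k) := by
    rw [Polynomial.map_map, ← hGA, Polynomial.map_map, ← IsScalarTower.algebraMap_eq]; rfl
  have hy'V := hV.int (hyv y' hy'')
  have hc := eval_cong V (GA.map f) hrV hy'V (by rw [ValuationSubring.mem_nonunits_iff]; exact hry)
  rw [hGm, eval_map_algebraMap, eval_map_algebraMap, ← hG z hz y' hy'', aeval_algebraMap_apply]
    at hc
  have hae : algebraMap K k (aeval (r : K) (G z y')) = algebraMap (Av v) k (GA.eval rA) := by
    rw [← hGA, IsScalarTower.algebraMap_apply (Av v) K k, ← eval_map_apply, coe_aeval_eq_eval]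
    rfl
  rw [hae] at hc
  set a := GA.eval rA
  obtain ⟨π, _, hπ⟩ := loc_max v (Av v)
  have ha := hV.non (a ^ (Ideal.absNorm v.asIdeal) - a) (by
    rw [hπ, Ideal.mem_span_singleton]; exact loc_Qa v (Av v) hπ a)
  rw [map_sub, map_pow] at ha
  have haV := hV.mem a
  have hzV : z ∈ V := by
    have : z = algebraMap (Av v) k a - (algebraMap (Av v) k a - z) := by ring
    rw [this]
    exact sub_mem haV (ValuationSubring.nonunits_subset hc)
  have hcp := eval_cong V (X ^ (Ideal.absNorm v.asIdeal) - X) haV hzV hc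
  simp only [Polynomial.map_sub, Polynomial.map_pow, map_X, eval_sub, eval_pow, eval_X] at hcp
  have e : z ^ (Ideal.absNorm v.asIdeal) - z =
      ((algebraMap (Av v) k a) ^ (Ideal.absNorm v.asIdeal) - algebraMap (Av v) k a) -
      (((algebraMap (Av v) k a) ^ (Ideal.absNorm v.asIdeal) - algebraMap (Av v) k a) -
        (z ^ (Ideal.absNorm v.asIdeal) - z)) := by ring
  rw [e]
  rw [ValuationSubring.mem_nonunits_iff] at ha hcp ⊢
  exact (V.valuation.map_sub _ _).trans_lt (max_lt ha hcp)

end M8e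
end ArbPCF

namespace ArbPCF
section M9a
set_option linter.unusedSectionVars false
open IsLocalRing

variable {k : Type*} [Field k] {V : ValuationSubring k}

/-- reduction modulo the maximal ideal of `V` (junk value `0` outside `V`) -/
noncomputable def red (V : ValuationSubring k) (x : k) : ResidueField V :=
  if h : x ∈ V then residue V ⟨x, h⟩ else 0

lemma red_coe (a : V) : red V (a : k) = residue V a := by
  rw [red, dif_pos a.2]

lemma red_eq_iff {x y : k} (hx : x ∈ V) (hy : y ∈ V) : red V x = red V y ↔ x - y ∈ V.nonunits := by
  rw [red, red, dif_pos hx, dif_pos hy, ← sub_eq_zero, ← map_sub, residue_eq_zero_iff,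
    ValuationSubring.mem_nonunits_iff_exists_mem_maximalIdeal]
  exact ⟨fun h => ⟨sub_mem hx hy, h⟩, fun ⟨_, h⟩ => h⟩

lemma red_eval (F : V[X]) {x : k} (hx : x ∈ V) :
    red V ((F.map (algebraMap V k)).eval x) = (F.map (residue V)).eval (red V x) := by
  have := coe_eval F ⟨x, hx⟩
  rw [← this, red_coe, red, dif_pos hx, eval_map_apply]

lemma per_eq {X : Type*} (f : X → X) {n : ℕ} {x y : X} (hx : Function.IsPeriodicPt f n x)
    (hy : Function.IsPeriodicPt f n y) (hn : 0 < n) (m : ℕ) (h : f^[m] x = f^[m] y) : x = y := by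
  have h1 := congrArg (f^[n * m - m]) h
  rw [← Function.iterate_add_apply, ← Function.iterate_add_apply, Nat.sub_add_cancel (Nat.le_mul_of_pos_left m hn)] at h1
  rwa [hx.mul_const m, hy.mul_const m] at h1

variable {p q : k[X]} (hg : Good p q) {pV qV : V[X]} (hp : pV.map (algebraMap V k) = p)
  (hq : qV.map (algebraMap V k) = q) (hcop : IsCoprime pV qV)
include hg hp hq hcop

lemma red_lev {a : k} (ha : a ∈ V) (n : ℕ) : ∀ t ∈ Lev p q a n, t ∈ V ∧
    (phi (pV.map (residue V)) (qV.map (residue V)))^[n] (red V t) = red V a := by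
  induction n with
  | zero => rintro t rfl; exact ⟨ha, rfl⟩
  | succ n ih =>
    intro t ht
    obtain ⟨s, hs, hts⟩ := (hg.Lev_succ' n t).1 ht
    obtain ⟨hsV, hsr⟩ := ih s hs
    have hpm : pV.Monic := Polynomial.monic_of_injective (f := algebraMap V k)
      Subtype.val_injective (by rw [hp]; exact hg.monic)
    have hdeg : (C (⟨s, hsV⟩ : V) * qV).degree < pV.degree := by
      have := hg.degq s
      rw [← hp, ← hq] at this
      rw [← degree_map_eq_of_injective (f := algebraMap V k) Subtype.val_injective,
        ← degree_map_eq_of_injective (f := algebraMap V k) Subtype.val_injective pV,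
        Polynomial.map_mul, map_C]
      exact this
    have htV : t ∈ V := by
      have h_integ : IsIntegral V t := by
        refine ⟨pV - C (⟨s, hsV⟩ : V) * qV, hpm.sub_of_left hdeg, ?_⟩
        rw [← eval_map, Polynomial.map_sub, Polynomial.map_mul, map_C, hp, hq, eval_sub, eval_mul,
          eval_C, hts]
        exact sub_self _
      obtain ⟨y, hy⟩ := IsIntegrallyClosed.isIntegral_iff.1 h_integ
      rw [← hy]
      exact y.2
    refine ⟨htV, ?_⟩
    rw [Function.iterate_succ_apply]
    have e1 : (pV.map (residue V)).eval (red V t) = red V s * (qV.map (residue V)).eval (red V t) := by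
      have h1 := red_eval pV htV
      have h2 := red_eval qV htV
      have hqV : q.eval t ∈ V := by
        rw [← hq, ← coe_eval qV ⟨t, htV⟩]; exact Subtype.mem _
      rw [← h1, ← h2, hp, hq, hts]
      have : red V (s * q.eval t) = residue V ((⟨s, hsV⟩ : V) * (⟨_, hqV⟩ : V)) := red_coe ((⟨s, hsV⟩ : V) * (⟨_, hqV⟩ : V))
      rw [this, map_mul, ← red_coe, ← red_coe]
    have e2 : (qV.map (residue V)).eval (red V t) ≠ 0 := by
      intro h0
      rw [h0, mul_zero] at e1
      obtain ⟨a, b, hab⟩ := hcop.map (mapRingHom (residue V))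
      have := congrArg (Polynomial.eval (red V t)) hab
      simp only [coe_mapRingHom] at this
      rw [eval_add, eval_mul, eval_mul, h0, e1] at this
      simp at this
    have e3 : phi (pV.map (residue V)) (qV.map (residue V)) (red V t) = red V s := by
      rw [phi, e1, mul_div_assoc, div_self e2, mul_one]
    rw [e3, hsr]

lemma good_one (hW : (WrR pV qV).map (residue V) ≠ 0) {a : k} (ha : a ∈ V)
    (hper : ∀ n, 1 ≤ n → (phi (pV.map (residue V)) (qV.map (residue V)))^[n] (red V a) ≠ red V a)
    (m' : ℕ) (hcard : 2 * p.natDegree - 1 ≤ (Lev p q a m').ncard)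
    (hdis : ∀ x ∈ Lev p q a m', ∀ y ∈ Lev p q a m', x - y ∈ V.nonunits → x = y) :
    ∃ γ ∈ Lev p q a m', ∀ m, 1 ≤ m → ∀ t ∈ Lev p q γ m, t - γ ∉ V.nonunits ∧
      (Wr p q).eval t ∉ V.nonunits := by
  by_contra! hcon
  set f := phi (pV.map (residue V)) (qV.map (residue V)) with hf
  have hWV : (WrR pV qV).map (algebraMap V k) = Wr p q := WrV hp hq
  have hcon2 : ∀ γ ∈ Lev p q a m', ∃ m, 1 ≤ m ∧ ∃ t ∈ Lev p q γ m,
      ((WrR pV qV).map (residue V)).eval (red V t) = 0 := by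
    intro γ hγ
    obtain ⟨m, hm, t, ht, h⟩ := hcon γ hγ
    obtain ⟨hγV, hγr⟩ := red_lev hg hp hq hcop ha m' γ hγ
    obtain ⟨htV, htr⟩ := red_lev hg hp hq hcop hγV m t ht
    refine ⟨m, hm, t, ht, ?_⟩
    by_cases h1 : t - γ ∈ V.nonunits
    · exfalso
      have h2 := (red_eq_iff htV hγV).2 h1
      rw [h2] at htr
      apply hper m hm
      rw [← hγr, ← Function.iterate_add_apply, add_comm, Function.iterate_add_apply, htr]
    · have h2 := h h1
      rw [← red_eval _ htV, hWV]
      have hz : (0 : ResidueField V) = red V (0 : k) := by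
        rw [show (0 : k) = ((0 : V) : k) from rfl, red_coe, map_zero]
      rw [hz, red_eq_iff _ (zero_mem V), sub_zero]
      · exact h2
      · exact ValuationSubring.nonunits_subset h2
  choose! m hm t ht htW using hcon2
  have hmaps : ∀ γ ∈ Lev p q a m', red V (t γ) ∈
      (((WrR pV qV).map (residue V)).roots.toFinset : Set (ResidueField V)) := by
    intro γ hγ
    rw [Finset.mem_coe, Multiset.mem_toFinset, mem_roots hW]
    exact htW γ hγ
  have hinj : Set.InjOn (fun γ => red V (t γ)) (Lev p q a m') := by
    intro γ hγ γ' hγ' heq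
    simp only at heq
    obtain ⟨hγV, hγr⟩ := red_lev hg hp hq hcop ha m' γ hγ
    obtain ⟨htV, htr⟩ := red_lev hg hp hq hcop hγV _ _ (ht γ hγ)
    obtain ⟨hγV', hγr'⟩ := red_lev hg hp hq hcop ha m' γ' hγ'
    obtain ⟨htV', htr'⟩ := red_lev hg hp hq hcop hγV' _ _ (ht γ' hγ')
    rw [heq] at htr
    have key : ∀ (u : ResidueField V) (i j : ℕ) (b b' : ResidueField V), i < j → f^[i] u = b →
        f^[j] u = b' → f^[m'] b = red V a → f^[m'] b' = red V a → False := by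
      intro u i j b b' hij h1 h2 h3 h4
      apply hper (j - i) (by omega)
      rw [← h4, ← h2]
      conv_lhs => rw [h2, h4, ← h3, ← h1, ← Function.iterate_add_apply, ← Function.iterate_add_apply]
      rw [← Function.iterate_add_apply]
      congr 1
      omega
    have hmm : m γ = m γ' := by
      rcases lt_trichotomy (m γ) (m γ') with h | h | h
      · exact (key _ _ _ _ _ h htr htr' hγr hγr').elim
      · exact h
      · exact (key _ _ _ _ _ h htr' htr hγr' hγr).elim
    rw [hmm, htr'] at htr
    exact (hdis _ hγ' _ hγ ((red_eq_iff hγV' hγV).1 htr)).symm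
  have hle := Set.ncard_le_ncard_of_injOn _ hmaps hinj (Finset.finite_toSet _)
  rw [Set.ncard_coe_finset] at hle
  have h1 := Multiset.toFinset_card_le ((WrR pV qV).map (residue V)).roots
  have h2 := card_roots' ((WrR pV qV).map (residue V))
  have h3 : ((WrR pV qV).map (residue V)).natDegree ≤ 2 * p.natDegree - 2 := by
    refine natDegree_map_le.trans ?_
    rw [← natDegree_map_eq_of_injective (f := algebraMap V k) Subtype.val_injective, hWV]
    exact hg.Wr_natDegree
  have := hg.two_le
  omega

lemma good_exists (hW : (WrR pV qV).map (residue V) ≠ 0) {α α₁ α₂ : k} (hα : α ∈ V) (m0 m' : ℕ)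
    (h1 : α₁ ∈ Lev p q α m0) (h2 : α₂ ∈ Lev p q α m0) (h12 : α₁ - α₂ ∉ V.nonunits)
    (hcard1 : 2 * p.natDegree - 1 ≤ (Lev p q α₁ m').ncard)
    (hcard2 : 2 * p.natDegree - 1 ≤ (Lev p q α₂ m').ncard)
    (hdis : ∀ x ∈ Lev p q α₁ m' ∪ Lev p q α₂ m', ∀ y ∈ Lev p q α₁ m' ∪ Lev p q α₂ m',
      x - y ∈ V.nonunits → x = y) :
    ∃ γ ∈ Lev p q α₁ m' ∪ Lev p q α₂ m', ∀ m, 1 ≤ m → ∀ t ∈ Lev p q γ m, t - γ ∉ V.nonunits ∧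
      (Wr p q).eval t ∉ V.nonunits := by
  obtain ⟨hV1, hr1⟩ := red_lev hg hp hq hcop hα m0 _ h1
  obtain ⟨hV2, hr2⟩ := red_lev hg hp hq hcop hα m0 _ h2
  set f := phi (pV.map (residue V)) (qV.map (residue V)) with hf
  by_cases hp1 : ∀ n, 1 ≤ n → f^[n] (red V α₁) ≠ red V α₁
  · obtain ⟨γ, hγ, h⟩ := good_one hg hp hq hcop hW hV1 hp1 m' hcard1
      (fun x hx y hy => hdis x (Or.inl hx) y (Or.inl hy))
    exact ⟨γ, Or.inl hγ, h⟩
  by_cases hp2 : ∀ n, 1 ≤ n → f^[n] (red V α₂) ≠ red V α₂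
  · obtain ⟨γ, hγ, h⟩ := good_one hg hp hq hcop hW hV2 hp2 m' hcard2
      (fun x hx y hy => hdis x (Or.inr hx) y (Or.inr hy))
    exact ⟨γ, Or.inr hγ, h⟩
  exfalso
  push Not at hp1 hp2
  obtain ⟨n1, hn1, e1⟩ := hp1
  obtain ⟨n2, hn2, e2⟩ := hp2
  apply h12
  rw [← red_eq_iff hV1 hV2]
  have p1 : Function.IsPeriodicPt f (n1 * n2) (red V α₁) := Function.IsPeriodicPt.mul_const e1 n2
  have p2 : Function.IsPeriodicPt f (n1 * n2) (red V α₂) := Function.IsPeriodicPt.const_mul e2 n1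
  have hpos : 0 < n1 * n2 := Nat.mul_pos hn1 hn2
  exact per_eq f p1 p2 hpos m0 (hr1.trans hr2.symm)

end M9a
end ArbPCF

namespace ArbPCF
section M9b
set_option linter.unusedSectionVars false
open IsLocalRing NumberField IsDedekindDomain Filter

universe uK uk

variable {K : Type uK} [Field K] [NumberField K]
variable {k : Type uk} [Field k] [Algebra K k] [Algebra.IsAlgebraic K k]

lemma non_inv {V : ValuationSubring k} {x : k} (hx : x ∈ V.nonunits) (hi : x⁻¹ ∈ V) : x = 0 := by
  by_contra h0
  rw [ValuationSubring.mem_nonunits_iff] at hx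
  have h1 := (V.valuation_le_one_iff _).2 hi
  have h2 : V.valuation x * V.valuation x⁻¹ = 1 := by
    rw [← map_mul, mul_inv_cancel₀ h0, map_one]
  have h3 := mul_lt_one_of_lt_of_le hx h1
  rw [h2] at h3
  exact lt_irrefl _ h3

theorem thmA' [IsAlgClosed k] {p q : K[X]} (hg : Good p q) (α : K)
    (P R : k[X]) (hP : P = p.map (algebraMap K k))
    (hR : R = q.map (algebraMap K k))
    (hcomm : ∀ σ τ : k ≃ₐ[K] k, ∀ m, ∀ t ∈ Lev P R (algebraMap K k α) m, σ (τ t) = τ (σ t))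
    (m0 m' : ℕ) (α₁ α₂ : k) (h12 : α₁ ≠ α₂) (h1 : α₁ ∈ Lev P R (algebraMap K k α) m0)
    (h2 : α₂ ∈ Lev P R (algebraMap K k α) m0)
    (hK : ∀ γ ∈ Lev P R α₁ m' ∪ Lev P R α₂ m', ∃ g : K, algebraMap K k g = γ)
    (hcard1 : 2 * P.natDegree - 1 ≤ (Lev P R α₁ m').ncard)
    (hcard2 : 2 * P.natDegree - 1 ≤ (Lev P R α₂ m').ncard)
    (c : k) (hcW : (Wr P R).eval c = 0)
    (hcq : ∀ n, R.eval ((phi P R)^[n] c) ≠ 0)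
    (hcu : ∀ n, 1 ≤ n → (Wr P R).eval ((phi P R)^[n] c) ≠ 0)
    (hci : ∀ m n, (phi P R)^[m] c = (phi P R)^[n] c → m = n)
    (hunb : ∀ M, ∃ j, M ≤ (Lev P R c j).ncard) : False := by
  have : CharZero k := charZero_of_injective_algebraMap (algebraMap K k).injective
  have : Normal K k := normal_iff.2 fun x =>
    ⟨Algebra.IsIntegral.isIntegral x, IsAlgClosed.splits _⟩
  have : IsGalois K k := ⟨⟩
  have hgk : Good P R := by rw [hP, hR]; exact hg.map_alg _
  have hfin : (Lev P R α₁ m' ∪ Lev P R α₂ m').Finite :=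
    (hgk.Lev_finite _).union (hgk.Lev_finite _)
  have hcore : ∀ γ ∈ Lev P R α₁ m' ∪ Lev P R α₂ m', ∃ Z : Finset k,
      ∀ᶠ v : HeightOneSpectrum (𝓞 K) in cofinite, ∀ V : ValuationSubring k,
      Dom (Av v) V → (∀ z ∈ Z, z ^ (Ideal.absNorm v.asIdeal) - z ∈ V.nonunits) →
      (∀ m, 1 ≤ m → ∀ t ∈ Lev P R γ m, t - γ ∉ V.nonunits ∧
        (Wr P R).eval t ∉ V.nonunits) → False := by
    intro γ hγ
    obtain ⟨g, rfl⟩ := hK γ hγ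
    refine core hg g ?_ P R hP hR c hcW hcq hcu hci hunb
    intro σ τ m t ht
    rw [← hP, ← hR] at ht
    rcases hγ with h | h
    · exact hcomm σ τ _ t (Lev_trans (Lev_trans h1 h) ht)
    · exact hcomm σ τ _ t (Lev_trans (Lev_trans h2 h) ht)
  choose! Z hZ using hcore
  obtain ⟨w, hw⟩ : ∃ i, (Wr P R).coeff i ≠ 0 := by
    by_contra! h
    exact hgk.Wr_ne (Polynomial.ext fun i => by rw [h i, coeff_zero])
  obtain ⟨a, b, hab⟩ := hg.cop
  have e1 : ∀ᶠ v : HeightOneSpectrum (𝓞 K) in cofinite, ∀ γ ∈ hfin.toFinset,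
      ∀ V : ValuationSubring k,
      Dom (Av v) V → (∀ z ∈ Z γ, z ^ (Ideal.absNorm v.asIdeal) - z ∈ V.nonunits) →
      (∀ m, 1 ≤ m → ∀ t ∈ Lev P R γ m, t - γ ∉ V.nonunits ∧
        (Wr P R).eval t ∉ V.nonunits) → False :=
    (eventually_all_finset _).2 fun γ hγ => hZ γ (hfin.mem_toFinset.1 hγ)
  have e2 : ∀ᶠ v : HeightOneSpectrum (𝓞 K) in cofinite, ∀ γ ∈ hfin.toFinset,
      ∀ γ' ∈ hfin.toFinset, IsIntegral (Av v) (γ - γ')⁻¹ :=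
    (eventually_all_finset _).2 fun z _ => (eventually_all_finset _).2 fun z' _ => ae_int _
  have e3 : ∀ᶠ v : HeightOneSpectrum (𝓞 K) in cofinite, IsIntegral (Av v) (α₁ - α₂)⁻¹ := ae_int _
  have e4 : ∀ᶠ v : HeightOneSpectrum (𝓞 K) in cofinite,
    IsIntegral (Av v) ((Wr P R).coeff w)⁻¹ := ae_int _
  have eall := (((((((e1.and e2).and e3).and e4).and (ae_lift p)).and (ae_lift q)).and
    (ae_lift a)).and (ae_lift b)).and (ae_mem α)
  obtain ⟨v, hv, ⟨⟨⟨⟨⟨⟨⟨f1, f2⟩, f3⟩, f4⟩, pA, hpA⟩, qA, hqA⟩, aA, haA⟩, bA, hbA⟩, hα⟩ :=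
    ((split (K := K) (hfin.toFinset.biUnion Z)).and_eventually eall).exists
  obtain ⟨V, hV⟩ := exists_dom (Av v) (K := K) (k := k)
  have hinj : Function.Injective (algebraMap (Av v) K) := IsFractionRing.injective (Av v) K
  have hpk : pA.map (algebraMap (Av v) k) = P := by
    rw [hP, IsScalarTower.algebraMap_eq (Av v) K k, ← Polynomial.map_map, hpA]
  have hqk : qA.map (algebraMap (Av v) k) = R := by
    rw [hR, IsScalarTower.algebraMap_eq (Av v) K k, ← Polynomial.map_map, hqA]
  have hcopA : IsCoprime pA qA := ⟨aA, bA, Polynomial.map_injective _ hinj (by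
        rw [Polynomial.map_add, Polynomial.map_mul, Polynomial.map_mul, hpA, hqA, haA, hbA, hab,
          Polynomial.map_one])⟩
  let f : Av v →+* V := (algebraMap (Av v) k).codRestrict V.toSubring hV.mem
  have hff : (algebraMap V k).comp f = algebraMap (Av v) k := rfl
  have hp' : (pA.map f).map (algebraMap V k) = P := by rw [Polynomial.map_map, hff, hpk]
  have hq' : (qA.map f).map (algebraMap V k) = R := by rw [Polynomial.map_map, hff, hqk]
  have hcop' : IsCoprime (pA.map f) (qA.map f) := hcopA.map (mapRingHom f)
  have hW : (WrR (pA.map f) (qA.map f)).map (residue V) ≠ 0 := by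
    intro h0
    have h3 := congrArg (fun F => F.coeff w) h0
    simp only [coeff_map, coeff_zero] at h3
    rw [residue_eq_zero_iff] at h3
    have h4 : ((WrR (pA.map f) (qA.map f)).coeff w : k) = (Wr P R).coeff w := by
      rw [← WrV hp' hq', coeff_map]; rfl
    have h5 : (Wr P R).coeff w ∈ V.nonunits := by
      rw [← h4, ValuationSubring.mem_nonunits_iff_exists_mem_maximalIdeal]
      exact ⟨Subtype.mem _, h3⟩
    exact hw (non_inv h5 (hV.int f4))
  have hαV : algebraMap K k α ∈ V := hV.mem ⟨α, hα⟩
  obtain ⟨γ, hγ, hgood⟩ := good_exists hgk hp' hq' hcop' hW hαV m0 m' h1 h2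
    (fun h => h12 (sub_eq_zero.1 (non_inv h (hV.int f3)))) hcard1 hcard2
    (fun x hx y hy h => sub_eq_zero.1 (non_inv h (hV.int
      (f2 x (hfin.mem_toFinset.2 hx) y (hfin.mem_toFinset.2 hy)))))
  refine f1 γ (hfin.mem_toFinset.2 hγ) V hV (fun z hz => hv V hV z ?_) hgood
  exact Finset.mem_biUnion.2 ⟨γ, hfin.mem_toFinset.2 hγ, hz⟩

end M9b
end ArbPCF

namespace ArbPCF
section M9c
set_option linter.unusedSectionVars false
open NumberField Filter

universe uK uk

lemma Good.inf_of_nonper {k : Type*} [Field k] [IsAlgClosed k] {P R : k[X]} (hg : Good P R) (a : k)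
    (h : ∀ n, 1 ≤ n → (phi P R)^[n] a ≠ a) : (⋃ n, Lev P R a n).Infinite := by
  choose x hx using fun n => hg.Lev_nonempty (a := a) n
  apply Set.infinite_of_injective_forall_mem (f := x) _ (fun n => Set.mem_iUnion.2 ⟨n, hx n⟩)
  have key : ∀ m n, m < n → x m = x n → False := by
    intro m n hmn he
    apply h (n - m) (by omega)
    have h1 := ((mem_Lev_iff _ _).1 (hx m)).2
    have h2 := ((mem_Lev_iff _ _).1 (hx n)).2
    rw [← he] at h2
    conv_lhs => rw [← h1]
    rw [← Function.iterate_add_apply, Nat.sub_add_cancel hmn.le, h2]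
  intro m n he
  rcases lt_trichotomy m n with h | h | h
  · exact (key m n h he).elim
  · exact h
  · exact (key n m h he.symm).elim

variable {K : Type uK} [Field K] [NumberField K]
variable {k : Type uk} [Field k] [Algebra K k] [Algebra.IsAlgebraic K k]

theorem thmA [IsAlgClosed k] {P R : k[X]} (hg : Good P R) (α : k)
    (hcomm : ∀ σ τ : k ≃ₐ[K] k, ∀ m, ∀ t ∈ Lev P R α m, σ (τ t) = τ (σ t))
    (hinf : (⋃ n, Lev P R α n).Infinite)
    (c : k) (hcW : (Wr P R).eval c = 0)
    (hcq : ∀ n, R.eval ((phi P R)^[n] c) ≠ 0)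
    (hci : ∀ m n, (phi P R)^[m] c = (phi P R)^[n] c → m = n) : False := by
  have : CharZero k := charZero_of_injective_algebraMap (algebraMap K k).injective
  -- last critical point
  have hfinW : {n | (Wr P R).eval ((phi P R)^[n] c) = 0}.Finite := by
    apply Set.Finite.of_finite_image (f := fun n => (phi P R)^[n] c)
    · apply ((Wr P R).roots.toFinset.finite_toSet).subset
      rintro _ ⟨n, hn, rfl⟩
      rw [Finset.mem_coe, Multiset.mem_toFinset, mem_roots hg.Wr_ne]
      exact hn
    · intro m _ n _ h
      exact hci m n h
  obtain ⟨N, hN, hNmax⟩ := hfinW.exists_maximalFor id _ ⟨0, hcW⟩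
  obtain ⟨c', hc'⟩ : ∃ c', c' = (phi P R)^[N] c := ⟨_, rfl⟩
  have hit : ∀ n, (phi P R)^[n] c' = (phi P R)^[n + N] c := by
    intro n; rw [hc', Function.iterate_add_apply]
  have hcW' : (Wr P R).eval c' = 0 := by rw [hc']; exact hN
  have hcq' : ∀ n, R.eval ((phi P R)^[n] c') ≠ 0 := fun n => by rw [hit]; exact hcq _
  have hci' : ∀ m n, (phi P R)^[m] c' = (phi P R)^[n] c' → m = n := by
    intro m n h
    rw [hit, hit] at h
    have := hci _ _ h
    omega
  have hcu' : ∀ n, 1 ≤ n → (Wr P R).eval ((phi P R)^[n] c') ≠ 0 := by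
    intro n hn h
    rw [hit] at h
    have := hNmax (j := n + N) h (by simp)
    simp at this
    omega
  have hunb : ∀ M, ∃ j, M ≤ (Lev P R c' j).ncard := by
    apply hg.grow
    apply hg.inf_of_nonper
    intro n hn h
    have := hci' n 0 h
    omega
  obtain ⟨m0, hm0⟩ := hg.grow hinf 3
  obtain ⟨α₁, α₂, h1, h2, h12, hn1, hn2⟩ : ∃ α₁ α₂, α₁ ∈ Lev P R α m0 ∧ α₂ ∈ Lev P R α m0 ∧
      α₁ ≠ α₂ ∧ (∀ n, 1 ≤ n → (phi P R)^[n] α₁ ≠ α₁) ∧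
      (∀ n, 1 ≤ n → (phi P R)^[n] α₂ ≠ α₂) := by
    obtain ⟨x, hx, y, hy, z, hz, hxy, hxz, hyz⟩ :=
      (Set.two_lt_ncard (hg.Lev_finite m0)).1 (by omega : 2 < (Lev P R α m0).ncard)
    have key : ∀ u ∈ Lev P R α m0, ∀ w ∈ Lev P R α m0, u ≠ w →
        (∀ n, 1 ≤ n → (phi P R)^[n] u ≠ u) ∨ (∀ n, 1 ≤ n → (phi P R)^[n] w ≠ w) := by
      intro u hu w hw huw
      by_contra! hcon
      obtain ⟨⟨n1, hn1, e1⟩, ⟨n2, hn2, e2⟩⟩ := hcon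
      apply huw
      have p1 : Function.IsPeriodicPt (phi P R) (n1 * n2) u := Function.IsPeriodicPt.mul_const e1 n2
      have p2 : Function.IsPeriodicPt (phi P R) (n1 * n2) w := Function.IsPeriodicPt.const_mul e2 n1
      exact per_eq _ p1 p2 (Nat.mul_pos hn1 hn2) m0
        (((mem_Lev_iff _ _).1 hu).2.trans ((mem_Lev_iff _ _).1 hw).2.symm)
    rcases key x hx y hy hxy with h | h
    · rcases key y hy z hz hyz with h' | h'
      · exact ⟨x, y, hx, hy, hxy, h, h'⟩
      · exact ⟨x, z, hx, hz, hxz, h, h'⟩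
    · rcases key x hx z hz hxz with h' | h'
      · exact ⟨x, y, hx, hy, hxy, h', h⟩
      · exact ⟨y, z, hy, hz, hyz, h, h'⟩
  obtain ⟨m1, hm1⟩ := hg.grow (hg.inf_of_nonper α₁ hn1) (2 * P.natDegree - 1)
  obtain ⟨m2, hm2⟩ := hg.grow (hg.inf_of_nonper α₂ hn2) (2 * P.natDegree - 1)
  have mono : ∀ a, Monotone (fun n => (Lev P R a n).ncard) :=
    fun a => monotone_nat_of_le_succ hg.ncard_mono
  obtain ⟨m', hm'⟩ : ∃ m', m' = max m1 m2 := ⟨_, rfl⟩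
  have hcard1 : 2 * P.natDegree - 1 ≤ (Lev P R α₁ m').ncard :=
    hm1.trans (mono α₁ (hm' ▸ le_max_left _ _))
  have hcard2 : 2 * P.natDegree - 1 ≤ (Lev P R α₂ m').ncard :=
    hm2.trans (mono α₂ (hm' ▸ le_max_right _ _))
  -- the field of definition
  let S : Set k := (Lev P R α₁ m' ∪ Lev P R α₂ m') ∪ {α} ∪ (P.coeffs ∪ R.coeffs : Finset k)
  have hS : S.Finite := ((((hg.Lev_finite _).union (hg.Lev_finite _)).union
    (Set.finite_singleton _)).union (Finset.finite_toSet _))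
  let L := adjoin K S
  have hfd : FiniteDimensional K L := by
    have := hS.to_subtype
    exact finiteDimensional_adjoin fun x _ => Algebra.IsIntegral.isIntegral x
  have : NumberField L := NumberField.of_module_finite K L
  have hSL : ∀ x ∈ S, ∃ y : L, algebraMap L k y = x := fun x hx => ⟨⟨x, subset_adjoin K S hx⟩, rfl⟩
  have hlift : ∀ F : k[X], F.coeffs ⊆ P.coeffs ∪ R.coeffs → ∃ F' : L[X], F'.map (algebraMap L k) = F := by
    intro F hF
    apply (Polynomial.mem_lifts _).1
    rw [Polynomial.lifts_iff_coeff_lifts]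
    intro i
    by_cases hi : F.coeff i = 0
    · rw [hi]; exact ⟨0, map_zero _⟩
    · exact hSL _ (Or.inr (hF (coeff_mem_coeffs hi)))
  obtain ⟨p, hp⟩ := hlift P Finset.subset_union_left
  obtain ⟨q, hq⟩ := hlift R Finset.subset_union_right
  have hgL : Good p q :=
    { monic := Polynomial.monic_of_injective (algebraMap L k).injective (by rw [hp]; exact hg.monic)
      two_le := by rw [← natDegree_map (algebraMap L k), hp]; exact hg.two_le
      lt := by
        rw [← natDegree_map (algebraMap L k), ← natDegree_map (algebraMap L k) (p := p), hp, hq]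
        exact hg.lt
      cop := by
        rw [← Polynomial.isCoprime_map (algebraMap L k), hp, hq]; exact hg.cop }
  obtain ⟨a, ha⟩ := hSL α (Or.inl (Or.inr rfl))
  have : Algebra.IsAlgebraic L k := Algebra.IsAlgebraic.tower_top (K := K) L
  refine thmA' hgL a P R hp.symm hq.symm ?_ m0 m' α₁ α₂ h12 ?_ ?_ ?_ hcard1 hcard2 c' hcW' hcq'
    hcu' hci' hunb
  · intro σ τ m t ht
    rw [ha] at ht
    exact hcomm (σ.restrictScalars K) (τ.restrictScalars K) m t ht
  · rw [ha]; exact h1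
  · rw [ha]; exact h2
  · exact fun γ hγ => hSL γ (Or.inl (Or.inl hγ))

end M9c
end ArbPCF

namespace ArbPCF
section M9d
set_option linter.unusedSectionVars false

universe uK uk

section basic
variable {k : Type*} [Field k]

lemma opm_some (P R : k[X]) (z : k) : onePointMap P R (OnePoint.some z) =
    if R.eval z = 0 then OnePoint.infty else OnePoint.some (P.eval z / R.eval z) := rfl

lemma opm_inf (P R : k[X]) : onePointMap P R OnePoint.infty =
    (if R.natDegree < P.natDegree then OnePoint.infty
     else OnePoint.some (P.coeff (max P.natDegree R.natDegree) /
            R.coeff (max P.natDegree R.natDegree))) := rfl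

lemma opm_scale (u : k) (hu : u ≠ 0) (P R : k[X]) :
    onePointMap (C u * P) (C u * R) = onePointMap P R := by
  funext x
  induction x using OnePoint.rec with
  | infty =>
    simp only [opm_inf, natDegree_C_mul hu, coeff_C_mul]
    rw [mul_div_mul_left _ _ hu]
  | coe z =>
    simp only [opm_some, eval_mul, eval_C, mul_eq_zero, hu, false_or]
    rw [mul_div_mul_left _ _ hu]

lemma inf_iter {P R : k[X]} (h : R.natDegree < P.natDegree) (n : ℕ) :
    (onePointMap P R)^[n] OnePoint.infty = OnePoint.infty := by
  apply Function.iterate_fixed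
  rw [opm_inf, if_pos h]

lemma Lev_opm {P R : k[X]} (h : R.natDegree < P.natDegree) (a : k) (n : ℕ) : ∀ x : k,
    x ∈ Lev P R a n ↔ (onePointMap P R)^[n] (OnePoint.some x) = OnePoint.some a := by
  induction n with
  | zero => intro x; rw [mem_Lev_zero]; exact OnePoint.coe_eq_coe.symm
  | succ n ih =>
    intro x
    rw [Lev_succ, Function.iterate_succ_apply, opm_some, ih]
    by_cases h0 : R.eval x = 0
    · rw [if_pos h0, inf_iter h]
      simp [h0]
    · rw [if_neg h0]
      simp only [ne_eq, h0, not_false_eq_true, true_and]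
      rfl

lemma opm_iter_or {P R : k[X]} (h : R.natDegree < P.natDegree) (c : k) (n : ℕ) :
    (∀ i < n, R.eval ((phi P R)^[i] c) ≠ 0) →
    (onePointMap P R)^[n] (OnePoint.some c) = OnePoint.some ((phi P R)^[n] c) := by
  induction n with
  | zero => intro _; rfl
  | succ n ih =>
    intro hn
    rw [Function.iterate_succ_apply', ih fun i hi => hn i (by omega), opm_some,
      if_neg (hn n (by omega)), Function.iterate_succ_apply']
    rfl

lemma fin_range {X : Type*} (f : X → X) (x : X) {m n : ℕ} (hmn : m < n) (h : f^[m] x = f^[n] x) :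
    (Set.range fun i : ℕ => f^[i] x).Finite := by
  apply ((Finset.range n).finite_toSet.image (fun i => f^[i] x)).subset
  rintro _ ⟨i, rfl⟩
  induction i using Nat.strong_induction_on with
  | _ i ih =>
    by_cases hi : i < n
    · exact ⟨i, by simpa using hi, rfl⟩
    · have := ih (i - (n - m)) (by omega)
      convert this using 1
      simp only
      rw [show i = (i - n) + n by omega, Function.iterate_add_apply, ← h, ← Function.iterate_add_apply]
      congr 2
      omega

end basic

variable {K : Type uK} [Field K] [NumberField K]
variable {k : Type uk} [Field k] [Algebra K k] [Algebra.IsAlgebraic K k]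

theorem caseOne [IsAlgClosed k] {P R : k[X]} (hcop : IsCoprime P R) (hd : 2 ≤ P.natDegree)
    (hlt : R.natDegree < P.natDegree) (β : k)
    (hcomm : ∀ σ τ : k ≃ₐ[K] k, ∀ t : k, ∀ n,
      (onePointMap P R)^[n] (OnePoint.some t) = OnePoint.some β → σ (τ t) = τ (σ t))
    (hinf : {t : k | ∃ n, (onePointMap P R)^[n] (OnePoint.some t) = OnePoint.some β}.Infinite)
    (c : k) (hcW : (Wr P R).eval c = 0) :
    (Set.range fun n : ℕ => (onePointMap P R)^[n] (OnePoint.some c)).Finite := by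
  have hP0 : P ≠ 0 := by rintro rfl; simp at hd
  obtain ⟨u, hu⟩ : ∃ u, u = P.leadingCoeff⁻¹ := ⟨_, rfl⟩
  have hu0 : u ≠ 0 := by rw [hu]; exact inv_ne_zero (leadingCoeff_ne_zero.2 hP0)
  have huU : IsUnit (C u) := isUnit_C.2 hu0.isUnit
  have hg : Good (C u * P) (C u * R) :=
    { monic := by rw [hu, mul_comm]; exact monic_mul_leadingCoeff_inv hP0
      two_le := by rw [natDegree_C_mul hu0]; exact hd
      lt := by rw [natDegree_C_mul hu0, natDegree_C_mul hu0]; exact hlt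
      cop := (isCoprime_mul_unit_left huU _ _).2 hcop }
  have hW' : (Wr (C u * P) (C u * R)).eval c = 0 := by
    have : Wr (C u * P) (C u * R) = C u * C u * Wr P R := by
      simp only [Wr, derivative_C_mul]; ring
    rw [this, eval_mul, hcW, mul_zero]
  rw [← opm_scale u hu0] at hcomm hinf ⊢
  by_cases hq : ∀ n, (C u * R).eval ((phi (C u * P) (C u * R))^[n] c) ≠ 0
  · by_contra hnf
    have hit := fun n => opm_iter_or hg.lt c n (fun i _ => hq i)
    refine thmA hg β (fun σ τ m t ht => hcomm σ τ t m ((Lev_opm hg.lt β m t).1 ht)) ?_ c hW' hq ?_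
    · refine hinf.mono ?_
      rintro t ⟨n, hn⟩
      exact Set.mem_iUnion.2 ⟨n, (Lev_opm hg.lt β n t).2 hn⟩
    · intro m n h
      by_contra hmn
      rcases Nat.lt_or_gt_of_ne hmn with h' | h'
      · exact hnf (fin_range _ _ h' (by rw [hit, hit, h]))
      · exact hnf (fin_range _ _ h' (by rw [hit, hit, h]))
  · push Not at hq
    have hex := Nat.find_spec hq
    have hmin := fun i (hi : i < Nat.find hq) => Nat.find_min hq hi
    have h1 : (onePointMap (C u * P) (C u * R))^[Nat.find hq + 1] (OnePoint.some c) =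
        OnePoint.infty := by
      rw [Function.iterate_succ_apply', opm_iter_or hg.lt c _ hmin, opm_some, if_pos hex]
    have h2 : (onePointMap (C u * P) (C u * R))^[Nat.find hq + 2] (OnePoint.some c) =
        OnePoint.infty := by
      rw [Function.iterate_succ_apply', h1]
      exact inf_iter hg.lt 1
    exact fin_range _ _ (Nat.lt_succ_self _) (h1.trans h2.symm)

end M9d
end ArbPCF

namespace ArbPCF
section M9e
set_option linter.unusedSectionVars false

section basic
variable {k : Type*} [Field k]

lemma refl_eval {d : ℕ} {S : k[X]} (hS : S.natDegree ≤ d) {y : k} (hy : y ≠ 0) :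
    (S.reflect d).eval y = y ^ d * S.eval y⁻¹ := by
  have : Invertible y⁻¹ := invertibleOfNonzero (inv_ne_zero hy)
  have h := eval₂_reflect_mul_pow (RingHom.id k) y⁻¹ d S hS
  rw [invOf_eq_inv, inv_inv] at h
  change (S.reflect d).eval y * _ = S.eval y⁻¹ at h
  rw [← h, inv_pow, mul_comm, mul_assoc, inv_mul_cancel₀ (pow_ne_zero _ hy), mul_one]

lemma X_der_coeff (S : k[X]) (n : ℕ) : (X * derivative S).coeff n = n * S.coeff n := by
  cases n with
  | zero => simp
  | succ n => rw [coeff_X_mul, coeff_derivative]; push_cast; ring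

lemma refl_der {d : ℕ} {S : k[X]} (hS : S.natDegree ≤ d) :
    X * derivative (S.reflect d) = C (d : k) * S.reflect d - (X * derivative S).reflect d := by
  ext n
  rw [X_der_coeff, coeff_sub, coeff_C_mul, coeff_reflect, coeff_reflect, X_der_coeff]
  by_cases hn : n ≤ d
  · rw [revAt_le hn, Nat.cast_sub hn]; ring
  · rw [revAt_eq_self_of_lt (by omega), coeff_eq_zero_of_natDegree_lt (by omega)]; ring

lemma refl_Wr {d : ℕ} {S T : k[X]} (hS : S.natDegree ≤ d) (hT : T.natDegree ≤ d) {y : k}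
    (hy : y ≠ 0) (h : (Wr S T).eval y⁻¹ = 0) : (Wr (S.reflect d) (T.reflect d)).eval y = 0 := by
  have key : ∀ U : k[X], U.natDegree ≤ d → y * (derivative (U.reflect d)).eval y =
      y ^ d * (d * U.eval y⁻¹ - y⁻¹ * (derivative U).eval y⁻¹) := by
    intro U hU
    have h1 := congrArg (Polynomial.eval y) (refl_der hU)
    have h2 : (X * derivative U).natDegree ≤ d := by
      rw [natDegree_le_iff_coeff_eq_zero]
      intro N hN
      rw [X_der_coeff, coeff_eq_zero_of_natDegree_lt (by omega), mul_zero]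
    rw [eval_mul, eval_X, eval_sub, eval_mul, eval_C, refl_eval hU hy, refl_eval h2 hy, eval_mul,
      eval_X] at h1
    rw [h1]; ring
  have hS' := key S hS
  have hT' := key T hT
  have : y * (Wr (S.reflect d) (T.reflect d)).eval y = 0 := by
    rw [Wr] at h ⊢
    rw [eval_sub, eval_mul, eval_mul] at h ⊢
    rw [refl_eval hS hy, refl_eval hT hy]
    linear_combination (y ^ d * T.eval y⁻¹) * hS' - (y ^ d * S.eval y⁻¹) * hT' -
      (y ^ d * y ^ d * y⁻¹) * h
  exact (mul_eq_zero.1 this).resolve_left hy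

lemma taylor_top {d : ℕ} (r : k) {S : k[X]} (hS : S.natDegree ≤ d + 1) :
    (taylor r S).coeff (d + 1) = S.coeff (d + 1) ∧
    (taylor r S).coeff d = S.coeff d + (d + 1) * r * S.coeff (d + 1) := by
  rw [taylor_coeff, taylor_coeff]
  have h1 := natDegree_hasseDeriv_le S (d + 1)
  have h2 := natDegree_hasseDeriv_le S d
  rw [eval_eq_sum_range' (n := 1) (by omega), eval_eq_sum_range' (n := 2) (by omega)]
  simp only [Finset.sum_range_succ, Finset.sum_range_zero, hasseDeriv_coeff]
  simp [add_comm 1 d]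
  ring

lemma Wr_zero (S T : k[X]) : (Wr S T).eval 0 = S.coeff 1 * T.coeff 0 - S.coeff 0 * T.coeff 1 := by
  rw [Wr, eval_sub, eval_mul, eval_mul]
  simp only [← coeff_zero_eq_eval_zero, coeff_derivative]
  simp

lemma taylor_Wr (r : k) (S T : k[X]) : Wr (taylor r S) (taylor r T) = taylor r (Wr S T) := by
  simp [Wr, taylor_apply, derivative_comp]

lemma taylor_eval' (r x : k) (S : k[X]) : (taylor r S).eval x = S.eval (r + x) := by
  rw [taylor_eval, add_comm]

end basic

/-- data for the conjugation by `1/(x-x0)` -/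
structure Cj {k : Type*} [Field k] (P R : k[X]) (d : ℕ) (x0 : k) : Prop where
  cop : IsCoprime P R
  two : 2 ≤ d
  hP : P.natDegree ≤ d
  hR : R.natDegree = d
  fix : P.eval x0 = x0 * R.eval x0

namespace Cj
variable {k : Type*} [Field k] {P R : k[X]} {d : ℕ} {x0 : k} (h : Cj P R d x0)

/-- new numerator -/
noncomputable def P1 (R : k[X]) (d : ℕ) (x0 : k) : k[X] := (taylor x0 R).reflect d
/-- new denominator -/
noncomputable def R1 (P R : k[X]) (d : ℕ) (x0 : k) : k[X] := (taylor x0 (P - C x0 * R)).reflect d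
/-- coordinate change -/
noncomputable def hh (x0 : k) (y : OnePoint k) : OnePoint k :=
  Option.elim y (OnePoint.some x0) (fun y => if y = 0 then OnePoint.infty
    else OnePoint.some (x0 + y⁻¹))
/-- inverse coordinate change -/
noncomputable def gg (x0 : k) (y : OnePoint k) : OnePoint k :=
  Option.elim y (OnePoint.some 0) (fun y => if y = x0 then OnePoint.infty
    else OnePoint.some (y - x0)⁻¹)

lemma hh_some (y : k) : hh x0 (OnePoint.some y) = if y = 0 then OnePoint.infty
    else OnePoint.some (x0 + y⁻¹) := rfl
lemma hh_inf : hh x0 OnePoint.infty = OnePoint.some x0 := rfl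
lemma gg_some (y : k) : gg x0 (OnePoint.some y) = if y = x0 then OnePoint.infty
    else OnePoint.some (y - x0)⁻¹ := rfl
lemma gg_inf : gg x0 OnePoint.infty = OnePoint.some 0 := rfl

lemma gg_hh (y : OnePoint k) : gg x0 (hh x0 y) = y := by
  induction y using OnePoint.rec with
  | infty => rw [hh_inf, gg_some, if_pos rfl]
  | coe y =>
    rw [hh_some]
    by_cases h0 : y = 0
    · rw [if_pos h0, gg_inf, h0]
    · rw [if_neg h0, gg_some, if_neg (by simpa using h0)]
      simp

lemma hh_gg (y : OnePoint k) : hh x0 (gg x0 y) = y := by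
  induction y using OnePoint.rec with
  | infty => rw [gg_inf, hh_some, if_pos rfl]
  | coe y =>
    rw [gg_some]
    by_cases h0 : y = x0
    · rw [if_pos h0, hh_inf, h0]
    · rw [if_neg h0, hh_some, if_neg (by simpa [sub_eq_zero] using h0)]
      simp

include h

lemma R0 : R.eval x0 ≠ 0 := by
  intro h0
  obtain ⟨a, b, hab⟩ := h.cop
  have := congrArg (eval x0) hab
  simp [h.fix, h0] at this

lemma hd2 : (P - C x0 * R).natDegree ≤ d :=
  (natDegree_sub_le_of_le h.hP ((natDegree_C_mul_le _ _).trans h.hR.le)).trans (max_self d).le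

lemma P1_coeff : (P1 R d x0).coeff d = R.eval x0 := by
  rw [P1, coeff_reflect, revAt_le le_rfl, Nat.sub_self, taylor_coeff_zero]

lemma P1_deg : (P1 R d x0).natDegree = d := by
  apply natDegree_eq_of_le_of_coeff_ne_zero
  · rw [P1, natDegree_le_iff_coeff_eq_zero]
    intro N hN
    rw [coeff_reflect, revAt_eq_self_of_lt hN, coeff_eq_zero_of_natDegree_lt]
    rw [natDegree_taylor, h.hR]; exact hN
  · rw [h.P1_coeff]; exact h.R0

lemma R1_deg : (R1 P R d x0).natDegree < d := by
  have := h.two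
  rw [Nat.lt_iff_le_pred (by omega), natDegree_le_iff_coeff_eq_zero]
  intro N hN
  rw [R1, coeff_reflect]
  rcases Nat.lt_or_ge d N with h1 | h1
  · rw [revAt_eq_self_of_lt h1, coeff_eq_zero_of_natDegree_lt]
    rw [natDegree_taylor]; exact h.hd2.trans_lt h1
  · obtain rfl : N = d := by omega
    rw [revAt_le le_rfl, Nat.sub_self, taylor_coeff_zero]
    simp [h.fix]

lemma P1_eval {y : k} (hy : y ≠ 0) : (P1 R d x0).eval y = y ^ d * R.eval (x0 + y⁻¹) := by
  rw [P1, refl_eval (by rw [natDegree_taylor, h.hR]) hy, taylor_eval']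

lemma R1_eval {y : k} (hy : y ≠ 0) : (R1 P R d x0).eval y =
    y ^ d * (P.eval (x0 + y⁻¹) - x0 * R.eval (x0 + y⁻¹)) := by
  rw [R1, refl_eval (by rw [natDegree_taylor]; exact h.hd2) hy, taylor_eval']
  simp

lemma P1_zero : (P1 R d x0).eval 0 = R.coeff d := by
  obtain ⟨e, rfl⟩ : ∃ e, d = e + 1 := ⟨d - 1, by have := h.two; omega⟩
  rw [← coeff_zero_eq_eval_zero, P1, coeff_reflect, revAt_le (Nat.zero_le _), Nat.sub_zero,
    (taylor_top x0 h.hR.le).1]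

lemma R1_zero : (R1 P R d x0).eval 0 = P.coeff d - x0 * R.coeff d := by
  obtain ⟨e, rfl⟩ : ∃ e, d = e + 1 := ⟨d - 1, by have := h.two; omega⟩
  rw [← coeff_zero_eq_eval_zero, R1, coeff_reflect, revAt_le (Nat.zero_le _), Nat.sub_zero,
    (taylor_top x0 h.hd2).1, coeff_sub, coeff_C_mul]

lemma Rd : R.coeff d ≠ 0 := by
  have h0 : R ≠ 0 := by
    rintro rfl
    have h1 := h.hR
    have h2 := h.two
    simp at h1; omega
  have := leadingCoeff_ne_zero.2 h0
  rwa [leadingCoeff, h.hR] at this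

lemma cop0 {x : k} (h1 : R.eval x = 0) : P.eval x ≠ 0 := by
  intro h2
  obtain ⟨a, b, hab⟩ := h.cop
  have := congrArg (eval x) hab
  simp [h1, h2] at this

lemma cop1 [IsAlgClosed k] : IsCoprime (P1 R d x0) (R1 P R d x0) := by
  rw [Polynomial.isCoprime_iff_aeval_ne_zero_of_isAlgClosed k k]
  intro y
  rw [coe_aeval_eq_eval]
  by_cases hy : y = 0
  · left; rw [hy, h.P1_zero]; exact h.Rd
  · rw [h.P1_eval hy, h.R1_eval hy]
    by_cases h0 : R.eval (x0 + y⁻¹) = 0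
    · right
      rw [h0, mul_zero, sub_zero]
      exact mul_ne_zero (pow_ne_zero _ hy) (h.cop0 h0)
    · left
      exact mul_ne_zero (pow_ne_zero _ hy) h0

lemma semi (y : OnePoint k) : onePointMap P R (hh x0 y) =
    hh x0 (onePointMap (P1 R d x0) (R1 P R d x0) y) := by
  induction y using OnePoint.rec with
  | infty =>
    rw [hh_inf, opm_inf, if_pos (by rw [h.P1_deg]; exact h.R1_deg), hh_inf, opm_some, if_neg h.R0,
      h.fix, mul_div_assoc, div_self h.R0, mul_one]
  | coe y =>
    by_cases hy : y = 0
    · have hmax : max P.natDegree R.natDegree = d := by rw [h.hR]; exact max_eq_right h.hP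
      have hRd := h.Rd
      rw [hh_some, if_pos hy, opm_inf, if_neg (by rw [h.hR]; exact not_lt.2 h.hP), hmax, opm_some,
        hy, h.P1_zero, h.R1_zero]
      by_cases h0 : P.coeff d - x0 * R.coeff d = 0
      · rw [if_pos h0, hh_inf, sub_eq_zero.1 h0, mul_div_assoc, div_self hRd, mul_one]
      · rw [if_neg h0, hh_some, if_neg (div_ne_zero hRd h0)]
        congr 1
        field_simp
        ring
    · rw [hh_some, if_neg hy, opm_some, opm_some, h.P1_eval hy, h.R1_eval hy]
      have hyd := pow_ne_zero d hy
      rw [mul_div_mul_left _ _ hyd]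
      simp only [mul_eq_zero, hyd, false_or]
      by_cases h0 : R.eval (x0 + y⁻¹) = 0
      · have := h.cop0 h0
        rw [if_pos h0, h0, if_neg (by simpa using this), hh_some, if_pos (by simp)]
      · rw [if_neg h0]
        by_cases h1 : P.eval (x0 + y⁻¹) - x0 * R.eval (x0 + y⁻¹) = 0
        · rw [if_pos h1, hh_inf, sub_eq_zero.1 h1, mul_div_assoc, div_self h0, mul_one]
        · rw [if_neg h1, hh_some, if_neg (div_ne_zero h0 h1)]
          congr 1
          generalize P.eval (x0 + y⁻¹) = A at *
          generalize R.eval (x0 + y⁻¹) = B at *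
          field_simp
          ring

lemma semi_iter (n : ℕ) (y : OnePoint k) : (onePointMap P R)^[n] (hh x0 y) =
    hh x0 ((onePointMap (P1 R d x0) (R1 P R d x0))^[n] y) := by
  induction n generalizing y with
  | zero => rfl
  | succ n ih => rw [Function.iterate_succ_apply, h.semi, ih, Function.iterate_succ_apply]

lemma crit {c : k} (hc : c ≠ x0) (hW : (Wr P R).eval c = 0) :
    (Wr (P1 R d x0) (R1 P R d x0)).eval (c - x0)⁻¹ = 0 := by
  apply refl_Wr (by rw [natDegree_taylor, h.hR]) (by rw [natDegree_taylor]; exact h.hd2)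
    (inv_ne_zero (sub_ne_zero.2 hc))
  rw [taylor_Wr, taylor_eval', inv_inv, add_sub_cancel]
  have : Wr R (P - C x0 * R) = - Wr P R := by
    simp [Wr]; ring
  rw [this, eval_neg, hW, neg_zero]

lemma crit_inf (hW : (Wr (P.reflect d) (R.reflect d)).eval 0 = 0) :
    (Wr (P1 R d x0) (R1 P R d x0)).eval 0 = 0 := by
  have h2 := h.two
  rw [Wr_zero] at hW ⊢
  simp only [P1, R1, coeff_reflect] at hW ⊢
  rw [revAt_le (by omega), revAt_le (by omega)] at hW ⊢
  obtain ⟨e, rfl⟩ : ∃ e, d = e + 1 := ⟨d - 1, by omega⟩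
  rw [Nat.add_sub_cancel, Nat.sub_zero] at hW ⊢
  rw [(taylor_top x0 h.hR.le).1, (taylor_top x0 h.hR.le).2, (taylor_top x0 h.hd2).1,
    (taylor_top x0 h.hd2).2]
  simp only [coeff_sub, coeff_C_mul]
  linear_combination -hW

lemma fin_of {x : OnePoint k}
    (hf : (Set.range fun n : ℕ => (onePointMap (P1 R d x0) (R1 P R d x0))^[n] (gg x0 x)).Finite) :
    (Set.range fun n : ℕ => (onePointMap P R)^[n] x).Finite := by
  refine (hf.image (hh x0)).subset ?_
  rintro _ ⟨n, rfl⟩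
  refine ⟨_, ⟨n, rfl⟩, ?_⟩
  simp only
  rw [← h.semi_iter, hh_gg]

end Cj
end M9e
end ArbPCF

namespace ArbPCF
section M9f
set_option linter.unusedSectionVars false

universe uK uk

lemma Good.inf_of_nonper2 {k : Type*} [Field k] {f : OnePoint k → OnePoint k} (a : OnePoint k)
    (hs : Function.Surjective f) (hi : f OnePoint.infty = OnePoint.infty) (ha : a ≠ OnePoint.infty)
    (h : ∀ n, 1 ≤ n → f^[n] a ≠ a) : {t : k | ∃ n, f^[n] (OnePoint.some t) = a}.Infinite := by
  have hex : ∀ n, ∃ t : k, f^[n] (OnePoint.some t) = a := by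
    intro n
    obtain ⟨t, ht⟩ := hs.iterate n a
    induction t using OnePoint.rec with
    | infty =>
      rw [Function.iterate_fixed hi] at ht
      exact (ha ht.symm).elim
    | coe t => exact ⟨t, ht⟩
  choose x hx using hex
  refine Set.infinite_of_injective_forall_mem (f := x) ?_ (fun n => ⟨n, hx n⟩)
  have key : ∀ m n, m < n → x m = x n → False := by
    intro m n hmn he
    apply h (n - m) (by omega)
    have h1 := hx m
    have h2 := hx n
    rw [← he] at h2
    conv_lhs => rw [← h1]
    rw [← Function.iterate_add_apply, Nat.sub_add_cancel hmn.le, h2]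
  intro m n he
  rcases lt_trichotomy m n with h | h | h
  · exact (key m n h he).elim
  · exact h
  · exact (key n m h he.symm).elim

lemma opm_surj {k : Type*} [Field k] [IsAlgClosed k] {P R : k[X]} (hcop : IsCoprime P R)
    (hd : 2 ≤ P.natDegree) (hlt : R.natDegree < P.natDegree) :
    Function.Surjective (onePointMap P R) := by
  intro y
  induction y using OnePoint.rec with
  | infty => exact ⟨OnePoint.infty, by rw [opm_inf, if_pos hlt]⟩
  | coe y =>
    have h1 : (P - C y * R).natDegree = P.natDegree :=
      natDegree_sub_eq_left_of_natDegree_lt ((natDegree_C_mul_le _ _).trans_lt hlt)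
    obtain ⟨x, hx⟩ := IsAlgClosed.exists_root (P - C y * R) (by
      intro h0
      have := natDegree_eq_zero_iff_degree_le_zero.2 h0.le
      omega)
    have hx' : P.eval x = y * R.eval x := by simpa [IsRoot.def, sub_eq_zero] using hx
    have h0 : R.eval x ≠ 0 := by
      intro h0
      obtain ⟨a, b, hab⟩ := hcop
      have := congrArg (eval x) hab
      simp [hx', h0] at this
    refine ⟨OnePoint.some x, ?_⟩
    rw [opm_some, if_neg h0, hx', mul_div_assoc, div_self h0, mul_one]

variable {K : Type uK} [Field K] [NumberField K]
variable {k : Type uk} [Field k] [Algebra K k] [Algebra.IsAlgebraic K k]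

theorem caseTwo [IsAlgClosed k] {P R : k[X]} {d : ℕ} {x0 : k} (h : Cj P R d x0) (α : k)
    (hcomm : ∀ σ τ : k ≃ₐ[K] k, ∀ t : k, ∀ n,
      (onePointMap P R)^[n] (OnePoint.some t) = OnePoint.some α → σ (τ t) = τ (σ t))
    (hinf : {t : k | ∃ n, (onePointMap P R)^[n] (OnePoint.some t) = OnePoint.some α}.Infinite)
    (c : k) (hcW : (Wr (Cj.P1 R d x0) (Cj.R1 P R d x0)).eval c = 0) :
    (Set.range fun n : ℕ => (onePointMap (Cj.P1 R d x0) (Cj.R1 P R d x0))^[n]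
      (OnePoint.some c)).Finite := by
  have h2 : 2 ≤ (Cj.P1 R d x0).natDegree := by rw [h.P1_deg]; exact h.two
  have hlt : (Cj.R1 P R d x0).natDegree < (Cj.P1 R d x0).natDegree := by
    rw [h.P1_deg]; exact h.R1_deg
  have hfix : onePointMap P R (OnePoint.some x0) = OnePoint.some x0 := by
    rw [← Cj.hh_inf, h.semi, opm_inf, if_pos hlt]
  -- choice of the base point
  obtain ⟨β, m0, hβ, hm0, hβinf⟩ : ∃ β : k, ∃ m0 : ℕ, β ≠ x0 ∧
      (onePointMap P R)^[m0] (OnePoint.some β) = OnePoint.some α ∧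
      {t : k | ∃ n, (onePointMap (Cj.P1 R d x0) (Cj.R1 P R d x0))^[n] (OnePoint.some t) =
        OnePoint.some (β - x0)⁻¹}.Infinite := by
    by_cases hα : α = x0
    · obtain ⟨β, ⟨m0, hm0⟩, hβ⟩ := hinf.exists_notMem_finite (Set.finite_singleton x0)
      have hβ : β ≠ x0 := hβ
      refine ⟨β, m0, hβ, hm0, ?_⟩
      apply Good.inf_of_nonper2 _ (opm_surj h.cop1 h2 hlt) (by rw [opm_inf, if_pos hlt])
        (OnePoint.coe_ne_infty _)
      intro n hn he
      have hb : OnePoint.some β = Cj.hh x0 (OnePoint.some (β - x0)⁻¹) := by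
        have := Cj.hh_gg (x0 := x0) (OnePoint.some β)
        rw [Cj.gg_some, if_neg hβ] at this
        exact this.symm
      have hper : (onePointMap P R)^[n] (OnePoint.some β) = OnePoint.some β := by
        rw [hb, h.semi_iter, he]
      have hper' : (onePointMap P R)^[n * m0] (OnePoint.some β) = OnePoint.some β :=
        Function.IsPeriodicPt.mul_const hper m0
      obtain ⟨j, hj⟩ := Nat.exists_eq_add_of_le (Nat.le_mul_of_pos_left m0 hn)
      rw [hj, add_comm, Function.iterate_add_apply, hm0, hα, Function.iterate_fixed hfix] at hper'
      exact hβ (OnePoint.coe_injective hper').symm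
    · refine ⟨α, 0, hα, rfl, ?_⟩
      have hinf2 := hinf.sdiff (Set.finite_singleton x0)
      have hinj : Set.InjOn (fun t : k => (t - x0)⁻¹)
        ({t : k | ∃ n, (onePointMap P R)^[n] (OnePoint.some t) = OnePoint.some α} \ {x0}) := by
        intro a _ b _ hab
        simpa using hab
      refine (hinf2.image hinj).mono ?_
      rintro _ ⟨t, ⟨⟨n, hn⟩, ht⟩, rfl⟩
      have ht : t ≠ x0 := ht
      refine ⟨n, ?_⟩
      have e1 : Cj.gg x0 (OnePoint.some t) = OnePoint.some (t - x0)⁻¹ := by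
        rw [Cj.gg_some, if_neg ht]
      have e2 : Cj.gg x0 (OnePoint.some α) = OnePoint.some (α - x0)⁻¹ := by
        rw [Cj.gg_some, if_neg hα]
      have h3 := h.semi_iter n (Cj.gg x0 (OnePoint.some t))
      rw [Cj.hh_gg, hn] at h3
      rw [← e1, ← e2, h3, Cj.gg_hh]
  let L := adjoin K {x0}
  have hfd : FiniteDimensional K L := adjoin.finiteDimensional (Algebra.IsIntegral.isIntegral x0)
  have : NumberField L := NumberField.of_module_finite K L
  have : Algebra.IsAlgebraic L k := Algebra.IsAlgebraic.tower_top (K := K) L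
  refine caseOne (K := L) h.cop1 h2 hlt (β - x0)⁻¹ ?_ hβinf c hcW
  intro σ τ t n hn
  by_cases ht : t = 0
  · simp [ht]
  have hfx : ∀ σ : k ≃ₐ[L] k, σ x0 = x0 := fun σ =>
    σ.commutes (⟨x0, mem_adjoin_simple_self K x0⟩ : L)
  have e3 : (onePointMap P R)^[m0 + n] (OnePoint.some (x0 + t⁻¹)) = OnePoint.some α := by
    have h3 := h.semi_iter n (OnePoint.some t)
    rw [hn, Cj.hh_some, if_neg ht, Cj.hh_some, if_neg (inv_ne_zero (sub_ne_zero.2 hβ)), inv_inv,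
      add_sub_cancel] at h3
    rw [Function.iterate_add_apply, h3, hm0]
  have h4 := hcomm (σ.restrictScalars K) (τ.restrictScalars K) _ _ e3
  have h5 : σ (τ (x0 + t⁻¹)) = τ (σ (x0 + t⁻¹)) := h4
  simp only [map_add, hfx, map_inv₀] at h5
  exact inv_injective (add_left_cancel h5)

/-- Galois equivariance -/
lemma opm_gal (p q : K[X]) (σ : k ≃ₐ[K] k) (n : ℕ) (x : OnePoint k) :
    (onePointMap (p.map (algebraMap K k)) (q.map (algebraMap K k)))^[n] (OnePoint.map σ x) =
      OnePoint.map σ ((onePointMap (p.map (algebraMap K k)) (q.map (algebraMap K k)))^[n] x) := by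
  induction n generalizing x with
  | zero => rfl
  | succ n ih =>
    rw [Function.iterate_succ_apply, Function.iterate_succ_apply, ← ih]
    congr 1
    induction x using OnePoint.rec with
    | infty =>
      rw [OnePoint.map_infty, opm_inf]
      split_ifs
      · rfl
      · rw [OnePoint.map_some]
        simp
    | coe z =>
      have he : ∀ F : K[X], (F.map (algebraMap K k)).eval (σ z) =
          σ ((F.map (algebraMap K k)).eval z) := by
        intro F
        rw [eval_map_algebraMap, eval_map_algebraMap]
        exact aeval_algHom_apply σ z F
      rw [OnePoint.map_some, opm_some, opm_some, he, he]
      simp only [map_eq_zero]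
      split_ifs
      · rfl
      · rw [OnePoint.map_some, map_div₀]

lemma comm_of (p q : K[X]) [IsAlgClosed k] (α : K)
    (habelian : ∀ σ τ : (IntermediateField.adjoin K
        (backOrbit (p.map (algebraMap K k)) (q.map (algebraMap K k)) (algebraMap K k α))) ≃ₐ[K]
        (IntermediateField.adjoin K
        (backOrbit (p.map (algebraMap K k)) (q.map (algebraMap K k)) (algebraMap K k α))),
        σ * τ = τ * σ) (σ τ : k ≃ₐ[K] k) (t : k) (n : ℕ)
    (ht : (onePointMap (p.map (algebraMap K k)) (q.map (algebraMap K k)))^[n] (OnePoint.some t) =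
      OnePoint.some (algebraMap K k α)) : σ (τ t) = τ (σ t) := by
  have : Normal K k := normal_iff.2 fun x =>
    ⟨Algebra.IsIntegral.isIntegral x, IsAlgClosed.splits _⟩
  cases n with
  | zero =>
    have : t = algebraMap K k α := OnePoint.coe_injective ht
    rw [this]; simp
  | succ n =>
    obtain ⟨B, hB⟩ : ∃ B, B = backOrbit (p.map (algebraMap K k)) (q.map (algebraMap K k))
      (algebraMap K k α) := ⟨_, rfl⟩
    rw [← hB] at habelian
    have htB : t ∈ B := by rw [hB]; exact ⟨n + 1, by omega, ht⟩
    have hnorm : Normal K (adjoin K B) := by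
      rw [IntermediateField.normal_iff_forall_map_le']
      intro σ
      rw [adjoin_map]
      apply adjoin.mono
      rintro _ ⟨b, hb, rfl⟩
      rw [hB] at hb ⊢
      obtain ⟨m, hm, hb⟩ := hb
      refine ⟨m, hm, ?_⟩
      have := opm_gal p q σ m (OnePoint.some b)
      rw [OnePoint.map_some, hb, OnePoint.map_some, AlgEquiv.commutes] at this
      exact this
    let t' : adjoin K B := ⟨t, subset_adjoin K B htB⟩
    have hc := habelian (σ.restrictNormal (adjoin K B)) (τ.restrictNormal (adjoin K B))
    have h1 := congrArg (fun F => algebraMap (adjoin K B) k (F t')) hc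
    simp only [AlgEquiv.mul_apply, AlgEquiv.restrictNormal_commutes] at h1
    exact h1

theorem final (p q : K[X]) [IsAlgClosed k] (hcop : IsCoprime (p.map (algebraMap K k))
      (q.map (algebraMap K k))) (hdeg : 2 ≤ max p.natDegree q.natDegree) (α : K)
    (hexc : (backOrbit (p.map (algebraMap K k)) (q.map (algebraMap K k))
      (algebraMap K k α)).Infinite)
    (habelian : ∀ σ τ : (IntermediateField.adjoin K
        (backOrbit (p.map (algebraMap K k)) (q.map (algebraMap K k)) (algebraMap K k α))) ≃ₐ[K]
        (IntermediateField.adjoin K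
        (backOrbit (p.map (algebraMap K k)) (q.map (algebraMap K k)) (algebraMap K k α))),
        σ * τ = τ * σ) : IsPCF (p.map (algebraMap K k)) (q.map (algebraMap K k)) := by
  have hcomm := comm_of p q α habelian
  have hinf : {t : k | ∃ n, (onePointMap (p.map (algebraMap K k)) (q.map (algebraMap K k)))^[n]
      (OnePoint.some t) = OnePoint.some (algebraMap K k α)}.Infinite := by
    refine hexc.mono ?_
    rintro t ⟨n, _, hn⟩
    exact ⟨n, hn⟩
  obtain ⟨P, hP⟩ : ∃ P, P = p.map (algebraMap K k) := ⟨_, rfl⟩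
  obtain ⟨R, hR⟩ : ∃ R, R = q.map (algebraMap K k) := ⟨_, rfl⟩
  have hdeg' : 2 ≤ max P.natDegree R.natDegree := by
    rw [hP, hR, natDegree_map, natDegree_map]; exact hdeg
  rw [← hP, ← hR] at hcop hcomm hinf ⊢
  by_cases hlt : R.natDegree < P.natDegree
  · rw [max_eq_left hlt.le] at hdeg'
    refine ⟨fun c hc => caseOne hcop hdeg' hlt _ hcomm hinf c hc, fun _ => ?_⟩
    exact fin_range _ _ Nat.zero_lt_one ((inf_iter hlt 0).trans (inf_iter hlt 1).symm)
  · have hle : P.natDegree ≤ R.natDegree := not_lt.1 hlt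
    have hmax := max_eq_right hle
    rw [hmax] at hdeg'
    have hR0 : R ≠ 0 := by rintro rfl; simp at hdeg'
    obtain ⟨x0, hx0⟩ := IsAlgClosed.exists_root (X * R - P) (by
      intro h0
      have h1 := natDegree_eq_zero_iff_degree_le_zero.2 h0.le
      rw [natDegree_sub_eq_left_of_natDegree_lt, natDegree_X_mul hR0] at h1
      · omega
      · rw [natDegree_X_mul hR0]; omega)
    have hfix : P.eval x0 = x0 * R.eval x0 := by
      have : x0 * R.eval x0 - P.eval x0 = 0 := by simpa [IsRoot.def] using hx0
      exact (sub_eq_zero.1 this).symm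
    have hC : Cj P R R.natDegree x0 := ⟨hcop, hdeg', hle, rfl, hfix⟩
    have key := caseTwo hC _ hcomm hinf
    refine ⟨fun c hc => ?_, fun hc => ?_⟩
    · by_cases hcx : c = x0
      · have h1 : onePointMap P R (OnePoint.some c) = OnePoint.some c := by
          rw [hcx, opm_some, if_neg hC.R0, hfix, mul_div_assoc, div_self hC.R0, mul_one]
        exact fin_range _ _ Nat.zero_lt_one h1.symm
      · apply hC.fin_of
        rw [Cj.gg_some, if_neg hcx]
        exact key _ (hC.crit hcx hc)
    · rw [hmax] at hc
      apply hC.fin_of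
      rw [Cj.gg_inf]
      exact key 0 (hC.crit_inf hc)

end M9f
end ArbPCF

/-- Let `K` be a number field, `φ = p/q ∈ K(x)` of degree `d ≥ 2` and
`α ∈ K` not exceptional for `φ` (its backward orbit is infinite). If the Galois group
`G_∞(φ,α)` of the extension generated by the backward orbit of `α` is abelian, then `φ`
is post-critically finite. -/
theorem abelian_arboreal_galois_implies_pcf
    (K : Type*) [Field K] [NumberField K]
    (p q : Polynomial K)
    (hcop : IsCoprime (p.map (algebraMap K (AlgebraicClosure K)))
      (q.map (algebraMap K (AlgebraicClosure K))))
    (hdeg : 2 ≤ max p.natDegree q.natDegree) (α : K)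
    (hexc : (backOrbit (p.map (algebraMap K (AlgebraicClosure K)))
        (q.map (algebraMap K (AlgebraicClosure K)))
        (algebraMap K (AlgebraicClosure K) α)).Infinite)
    (habelian : ∀ σ τ : (IntermediateField.adjoin K
        (backOrbit (p.map (algebraMap K (AlgebraicClosure K)))
          (q.map (algebraMap K (AlgebraicClosure K)))
          (algebraMap K (AlgebraicClosure K) α))) ≃ₐ[K]
        (IntermediateField.adjoin K
        (backOrbit (p.map (algebraMap K (AlgebraicClosure K)))
          (q.map (algebraMap K (AlgebraicClosure K)))
          (algebraMap K (AlgebraicClosure K) α))), σ * τ = τ * σ) :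
    IsPCF (p.map (algebraMap K (AlgebraicClosure K)))
      (q.map (algebraMap K (AlgebraicClosure K))) := by
  exact ArbPCF.final p q hcop hdeg α hexc habelian
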